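/- arXiv:2604.26992 — 3 statements merged into one kernel-verified Lean document; each statement's English description precedes it below -/
import Mathlib

section
/- Fix δ ∈ (0,1/4) and εmax ∈ (0,1/2). There exists a constant c > 0 depending only on δ and εmax such that the following holds for every n ≥ 1 and every σ > 0. Let (l,u) be any confidence-interval procedure on n samples and r : [0,εmax] → (0,∞) any function such that for all θ ∈ ℝ, all ε ∈ [0,εmax], and all probability measures Q on ℝ: P_{θ,σ,ε,Q}^{⊗n}( {x : l(x) ≤ θ ≤ u(x)} ) ≥ 1 − δ and P_{θ,σ,ε,Q}^{⊗n}( {x : u(x) − l(x) ≤ r(ε)} ) ≥ 1 − δ. Then for every ε ∈ [0,εmax], r(ε) ≥ c·σ·( n^{-1/4} + ε^{1/2} / max(1, √(log(e·n·ε²))) ), with the convention that the second summand is 0 when ε = 0. -/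
open MeasureTheory ProbabilityTheory Real
open scoped ENNReal NNReal

/-- Gaussian measure on `ℝ` with mean `m` and variance `v`. -/
noncomputable def gauss (m v : ℝ) : Measure ℝ := gaussianReal m (Real.toNNReal v)

/-- Efron's Gaussian two-groups model:
`(1-ε)·N(θ,σ²) + ε·(Q ∗ N(0,σ²))`. -/
noncomputable def efron (θ σ ε : ℝ) (Q : Measure ℝ) : Measure ℝ :=
  (ENNReal.ofReal (1 - ε)) • gauss θ (σ ^ 2) +
    (ENNReal.ofReal ε) • (Measure.conv Q (gauss 0 (σ ^ 2)))

/-- The `n`-fold product (i.i.d.) measure on `ℝⁿ`. -/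
noncomputable def iid (n : ℕ) (P : Measure ℝ) : Measure (Fin n → ℝ) :=
  Measure.pi fun _ => P

theorem withDensity_pi {n : ℕ} (γ : Measure ℝ) [IsProbabilityMeasure γ] (f : ℝ → ℝ)
    (hf0 : ∀ x, 0 ≤ f x) (hfi : Integrable f γ) :
    Measure.pi (fun _ : Fin n => γ.withDensity fun x => ENNReal.ofReal (f x)) =
      (Measure.pi fun _ : Fin n => γ).withDensity
        fun x => ENNReal.ofReal (∏ i, f (x i)) := by
  have : IsFiniteMeasure (γ.withDensity fun x => ENNReal.ofReal (f x)) :=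
    isFiniteMeasure_withDensity_ofReal hfi.2
  refine Measure.pi_eq fun s hs => ?_
  rw [withDensity_apply _ (MeasurableSet.univ_pi hs),
    ← lintegral_indicator (MeasurableSet.univ_pi hs)]
  have h : ∀ x : Fin n → ℝ, (Set.univ.pi s).indicator
      (fun x => ENNReal.ofReal (∏ i, f (x i))) x =
      ENNReal.ofReal (∏ i, (s i).indicator f (x i)) := by
    intro x
    by_cases hx : x ∈ Set.univ.pi s
    · rw [Set.indicator_of_mem hx]
      congr 1
      refine Finset.prod_congr rfl fun i _ => ?_
      rw [Set.indicator_of_mem (hx i trivial)]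
    · rw [Set.indicator_of_notMem hx]
      obtain ⟨i, hi⟩ : ∃ i, x i ∉ s i := by simpa [Set.mem_pi] using hx
      rw [Finset.prod_eq_zero (Finset.mem_univ i) (Set.indicator_of_notMem hi f)]
      simp
  have hnn : ∀ i y, 0 ≤ (s i).indicator f y := fun i y => Set.indicator_nonneg (fun y _ => hf0 y) y
  simp_rw [h]
  rw [← ofReal_integral_eq_lintegral_ofReal
      (Integrable.fintype_prod_dep fun i => hfi.indicator (hs i))
      (Filter.Eventually.of_forall fun x => Finset.prod_nonneg fun i _ => hnn i _),
    integral_fintype_prod_eq_prod (f := fun i => (s i).indicator f),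
    ENNReal.ofReal_prod_of_nonneg fun i _ => integral_nonneg (hnn i)]
  refine Finset.prod_congr rfl fun i _ => ?_
  rw [withDensity_apply _ (hs i), integral_indicator (hs i),
    ofReal_integral_eq_lintegral_ofReal hfi.integrableOn
      (Filter.Eventually.of_forall fun x => hf0 x)]

theorem real_iid_withDensity {n : ℕ} (γ : Measure ℝ) [IsProbabilityMeasure γ] (f : ℝ → ℝ)
    (hf0 : ∀ x, 0 ≤ f x) (hfi : Integrable f γ)
    {A : Set (Fin n → ℝ)} (hA : MeasurableSet A) :
    (iid n (γ.withDensity fun x => ENNReal.ofReal (f x))).real A =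
      ∫ x in A, ∏ i, f (x i) ∂(Measure.pi fun _ : Fin n => γ) := by
  rw [iid, withDensity_pi γ f hf0 hfi, measureReal_def, withDensity_apply _ hA,
    integral_eq_lintegral_of_nonneg_ae]
  · exact Filter.Eventually.of_forall fun x => Finset.prod_nonneg fun i _ => hf0 _
  · exact (Integrable.fintype_prod fun _ => hfi).aestronglyMeasurable.restrict

/-- Two product measures whose single-sample densities are within `χ²`-distance `O(1/n)`
cannot be told apart. -/
theorem real_iid_sub_le {n : ℕ} (γ : Measure ℝ) [IsProbabilityMeasure γ] (f g : ℝ → ℝ)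
    (hf : Measurable f) (hg : Measurable g) (hf0 : ∀ x, 1 / 2 ≤ f x) (hg0 : ∀ x, 0 ≤ g x)
    (hfi : Integrable f γ) (hgi : Integrable g γ) (hf1 : ∫ x, f x ∂γ = 1)
    (hg1 : ∫ x, g x ∂γ = 1) (hfg : Integrable (fun x => (g x - f x) ^ 2) γ)
    (hχ : n * (2 * ∫ x, (g x - f x) ^ 2 ∂γ) ≤ 1 / 17)
    {A : Set (Fin n → ℝ)} (hA : MeasurableSet A) :
    (iid n (γ.withDensity fun x => ENNReal.ofReal (f x))).real A -
      (iid n (γ.withDensity fun x => ENNReal.ofReal (g x))).real A ≤ 1 / 4 := by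
  have hfpos : ∀ x, 0 < f x := fun x => lt_of_lt_of_le (by norm_num) (hf0 x)
  set Γ := Measure.pi fun _ : Fin n => γ with hΓ
  set F : (Fin n → ℝ) → ℝ := fun x => ∏ i, f (x i) with hF
  set G : (Fin n → ℝ) → ℝ := fun x => ∏ i, g (x i) with hG
  set k : ℝ → ℝ := fun x => g x ^ 2 / f x with hk
  set K : (Fin n → ℝ) → ℝ := fun x => ∏ i, k (x i) with hK
  have hq : ∀ x, k x = (g x - f x) ^ 2 / f x + 2 * g x - f x := by
    intro x
    have := (hfpos x).ne'
    simp only [hk]; field_simp; ring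
  have hdom : ∀ x, (g x - f x) ^ 2 / f x ≤ 2 * (g x - f x) ^ 2 := by
    intro x
    rw [div_le_iff₀ (hfpos x)]
    nlinarith [sq_nonneg (g x - f x), hf0 x]
  have hdi : Integrable (fun x => (g x - f x) ^ 2 / f x) γ := by
    refine (hfg.const_mul 2).mono' (((hg.sub hf).pow_const 2).div hf).aestronglyMeasurable
      (Filter.Eventually.of_forall fun x => ?_)
    rw [Real.norm_of_nonneg (div_nonneg (sq_nonneg _) (hfpos x).le)]
    exact hdom x
  have hki : Integrable k γ := by
    have : k = fun x => (g x - f x) ^ 2 / f x + 2 * g x - f x := funext hq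
    rw [this]
    exact (hdi.add (hgi.const_mul 2)).sub hfi
  set η := 2 * ∫ x, (g x - f x) ^ 2 ∂γ with hη
  have hη0 : 0 ≤ η := mul_nonneg zero_le_two (integral_nonneg fun x => sq_nonneg _)
  have hkint : ∫ x, k x ∂γ ≤ 1 + η := by
    have h1 : ∫ x, k x ∂γ = ∫ x, (g x - f x) ^ 2 / f x ∂γ + 1 := by
      simp_rw [hq]
      rw [integral_sub (by exact hdi.add (hgi.const_mul 2)) hfi, integral_add hdi (hgi.const_mul 2),
        integral_const_mul, hf1, hg1]
      ring
    have h2 : ∫ x, (g x - f x) ^ 2 / f x ∂γ ≤ η := by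
      rw [hη, ← integral_const_mul]
      exact integral_mono hdi (hfg.const_mul 2) hdom
    linarith
  have hFi : Integrable F Γ := Integrable.fintype_prod fun _ => hfi
  have hGi : Integrable G Γ := Integrable.fintype_prod fun _ => hgi
  have hKi : Integrable K Γ := Integrable.fintype_prod fun _ => hki
  have hF1 : ∫ x, F x ∂Γ = 1 := by
    rw [hF, hΓ, integral_fintype_prod_eq_pow, hf1, one_pow]
  have hG1 : ∫ x, G x ∂Γ = 1 := by
    rw [hG, hΓ, integral_fintype_prod_eq_pow, hg1, one_pow]
  have hK1 : ∫ x, K x ∂Γ ≤ 17 / 16 := by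
    rw [hK, hΓ, integral_fintype_prod_eq_pow, Fintype.card_fin]
    have hk0 : 0 ≤ ∫ x, k x ∂γ :=
      integral_nonneg fun x => div_nonneg (sq_nonneg _) (hfpos x).le
    calc (∫ x, k x ∂γ) ^ n ≤ (1 + η) ^ n := pow_le_pow_left₀ hk0 hkint n
      _ ≤ (exp η) ^ n := pow_le_pow_left₀ (by linarith) (by linarith [add_one_le_exp η]) n
      _ = exp (n * η) := by rw [← exp_nat_mul]
      _ ≤ exp (1 / 17) := exp_le_exp.2 hχ
      _ ≤ 17 / 16 := by
        have h := add_one_le_exp (-(1 / 17) : ℝ)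
        rw [exp_neg] at h
        have hp := exp_pos (1 / 17 : ℝ)
        rw [le_inv_comm₀ (by norm_num) hp] at h
        refine h.trans (by norm_num)
  have hFpos : ∀ x, 0 < F x := fun x => Finset.prod_pos fun i _ => hfpos _
  have hKF : ∀ x, K x = G x ^ 2 / F x := by
    intro x
    simp only [hK, hG, hF, hk, Finset.prod_div_distrib, Finset.prod_pow]
  have hpt : ∀ x, F x - G x ≤ F x / 8 + 2 * (K x - 2 * G x + F x) := by
    intro x
    have hx := hFpos x
    rw [hKF]
    have : G x ^ 2 / F x - 2 * G x + F x = (F x - G x) ^ 2 / F x := by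
      field_simp; ring
    rw [this]
    have h2 : F x / 8 + 2 * ((F x - G x) ^ 2 / F x) - (F x - G x) =
        2 * (F x / 4 - (F x - G x)) ^ 2 / F x := by
      field_simp; ring
    have h3 : 0 ≤ 2 * (F x / 4 - (F x - G x)) ^ 2 / F x := by positivity
    linarith
  have hRi : Integrable (fun x => F x / 8 + 2 * (K x - 2 * G x + F x)) Γ :=
    (hFi.div_const 8).add (((hKi.sub (hGi.const_mul 2)).add hFi).const_mul 2)
  rw [real_iid_withDensity γ f (fun x => (hfpos x).le) hfi hA,
    real_iid_withDensity γ g hg0 hgi hA, ← integral_sub hFi.integrableOn hGi.integrableOn]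
  calc ∫ x in A, (F x - G x) ∂Γ
      ≤ ∫ x in A, (F x / 8 + 2 * (K x - 2 * G x + F x)) ∂Γ :=
        setIntegral_mono (hFi.sub hGi).integrableOn hRi.integrableOn hpt
    _ ≤ ∫ x, (F x / 8 + 2 * (K x - 2 * G x + F x)) ∂Γ := by
        refine setIntegral_le_integral hRi (Filter.Eventually.of_forall fun x => ?_)
        have hx := hFpos x
        have : K x - 2 * G x + F x = (F x - G x) ^ 2 / F x := by
          rw [hKF]; field_simp; ring
        simp only [Pi.zero_apply, this]
        positivity
    _ = 1 / 8 + 2 * (∫ x, K x ∂Γ - 2 * 1 + 1) := by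
        rw [integral_add (hFi.div_const 8)
            (by exact ((hKi.sub (hGi.const_mul 2)).add hFi).const_mul 2),
          integral_const_mul, integral_add (by exact hKi.sub (hGi.const_mul 2)) hFi,
          integral_sub hKi (hGi.const_mul 2), integral_const_mul, integral_div, hF1, hG1]
    _ ≤ 1 / 4 := by linarith

theorem gauss_eq_withDensity {σ : ℝ} (hσ : 0 < σ) (x : ℝ) :
    gauss (x * σ) (σ ^ 2) = (gauss 0 (σ ^ 2)).withDensity
      fun y => ENNReal.ofReal (exp (x * y / σ - x ^ 2 / 2)) := by
  have hv : (σ ^ 2).toNNReal ≠ 0 := by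
    rw [ne_eq, Real.toNNReal_eq_zero, not_le]; positivity
  have hc : ((σ ^ 2).toNNReal : ℝ) = σ ^ 2 := Real.coe_toNNReal _ (sq_nonneg σ)
  rw [gauss, gauss, gaussianReal_of_var_ne_zero _ hv, gaussianReal_of_var_ne_zero _ hv,
    ← withDensity_mul _ (measurable_gaussianPDF _ _) (by fun_prop)]
  congr 1
  ext y
  rw [Pi.mul_apply, gaussianPDF, gaussianPDF,
    ← ENNReal.ofReal_mul (gaussianPDFReal_nonneg _ _ _), gaussianPDFReal, gaussianPDFReal,
    mul_assoc _ (exp _) (exp _), ← exp_add, hc]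
  congr 3
  field_simp
  ring

theorem integrable_exp_gauss (σ t c : ℝ) :
    Integrable (fun y => exp (t * y / σ - c)) (gauss 0 (σ ^ 2)) := by
  have h := (integrable_exp_mul_gaussianReal (μ := 0) (v := (σ ^ 2).toNNReal) (t / σ)).mul_const
    (exp (-c))
  refine h.congr (Filter.Eventually.of_forall fun y => ?_)
  simp only [← exp_add]
  congr 1; ring

theorem integral_exp_gauss {σ : ℝ} (hσ : 0 < σ) (t c : ℝ) :
    ∫ y, exp (t * y / σ - c) ∂(gauss 0 (σ ^ 2)) = exp (t ^ 2 / 2 - c) := by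
  have h := congrFun (mgf_fun_id_gaussianReal (μ := 0) (v := (σ ^ 2).toNNReal)) (t / σ)
  rw [mgf, Real.coe_toNNReal _ (sq_nonneg σ)] at h
  have h2 : ∀ y, exp (t * y / σ - c) = exp (t / σ * y) * exp (-c) := by
    intro y; rw [← exp_add]; congr 1; ring
  simp_rw [h2]
  rw [integral_mul_const, gauss, h, ← exp_add]
  congr 1
  field_simp
  ring

/-- The Gaussian mixture with component means `x * h * σ` and weights `p x`, `x ∈ s`. -/
noncomputable def gaussMix (s : Finset ℝ) (p : ℝ → ℝ) (h σ : ℝ) : Measure ℝ :=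
  ∑ x ∈ s, ENNReal.ofReal (p x) • gauss (x * h * σ) (σ ^ 2)

/-- The density of `gaussMix s p h σ` with respect to the centred Gaussian. -/
noncomputable def gaussMixDensity (s : Finset ℝ) (p : ℝ → ℝ) (h σ y : ℝ) : ℝ :=
  ∑ x ∈ s, p x * exp (x * h * y / σ - (x * h) ^ 2 / 2)

theorem withDensity_finset_sum {ι : Type*} (s : Finset ι) (γ : Measure ℝ) (f : ι → ℝ → ℝ≥0∞)
    (hf : ∀ i, Measurable (f i)) :
    γ.withDensity (fun y => ∑ i ∈ s, f i y) = ∑ i ∈ s, γ.withDensity (f i) := by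
  classical
  induction s using Finset.induction_on with
  | empty => simp
  | insert a s ha ih =>
    simp_rw [Finset.sum_insert ha]
    rw [← ih, ← withDensity_add_left (hf a)]
    rfl

theorem gaussMix_eq_withDensity (s : Finset ℝ) {p : ℝ → ℝ} (hp : ∀ x ∈ s, 0 ≤ p x) (h : ℝ) {σ : ℝ}
    (hσ : 0 < σ) : gaussMix s p h σ = (gauss 0 (σ ^ 2)).withDensity
      fun y => ENNReal.ofReal (gaussMixDensity s p h σ y) := by
  have h1 : (fun y => ENNReal.ofReal (gaussMixDensity s p h σ y)) = fun y => ∑ x ∈ s,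
      (ENNReal.ofReal (p x) • fun y => ENNReal.ofReal (exp (x * h * y / σ - (x * h) ^ 2 / 2))) y := by
    ext y
    rw [gaussMixDensity, ENNReal.ofReal_sum_of_nonneg fun x hx => mul_nonneg (hp x hx) (exp_pos _).le]
    refine Finset.sum_congr rfl fun x hx => ?_
    rw [ENNReal.ofReal_mul (hp x hx)]
    rfl
  rw [h1, withDensity_finset_sum _ _ _ fun x => by fun_prop, gaussMix]
  refine Finset.sum_congr rfl fun x _ => ?_
  rw [withDensity_smul _ (by fun_prop), gauss_eq_withDensity hσ]

theorem measurable_gaussMixDensity (s : Finset ℝ) (p : ℝ → ℝ) (h σ : ℝ) :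
    Measurable (gaussMixDensity s p h σ) := by
  unfold gaussMixDensity; fun_prop

theorem integrable_gaussMixDensity (s : Finset ℝ) (p : ℝ → ℝ) (h σ : ℝ) :
    Integrable (gaussMixDensity s p h σ) (gauss 0 (σ ^ 2)) := by
  unfold gaussMixDensity
  exact integrable_finsetSum _ fun x _ => (integrable_exp_gauss _ _ _).const_mul _

theorem integral_gaussMixDensity (s : Finset ℝ) (p : ℝ → ℝ) (h : ℝ) {σ : ℝ} (hσ : 0 < σ) :
    ∫ y, gaussMixDensity s p h σ y ∂(gauss 0 (σ ^ 2)) = ∑ x ∈ s, p x := by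
  unfold gaussMixDensity
  rw [integral_finsetSum _ fun x _ => (integrable_exp_gauss _ _ _).const_mul _]
  refine Finset.sum_congr rfl fun x _ => ?_
  rw [integral_const_mul, integral_exp_gauss hσ, sub_self, exp_zero, mul_one]

theorem gaussMixDensity_sq (s : Finset ℝ) (d : ℝ → ℝ) (h σ y : ℝ) :
    gaussMixDensity s d h σ y ^ 2 = ∑ x ∈ s, ∑ x' ∈ s, d x * d x' *
      exp ((x * h + x' * h) * y / σ - ((x * h) ^ 2 / 2 + (x' * h) ^ 2 / 2)) := by
  rw [gaussMixDensity, sq, Finset.sum_mul_sum]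
  refine Finset.sum_congr rfl fun x _ => Finset.sum_congr rfl fun x' _ => ?_
  rw [mul_mul_mul_comm, ← exp_add]
  congr 2; ring

theorem integrable_gaussMixDensity_sq (s : Finset ℝ) (d : ℝ → ℝ) (h σ : ℝ) :
    Integrable (fun y => gaussMixDensity s d h σ y ^ 2) (gauss 0 (σ ^ 2)) := by
  simp_rw [gaussMixDensity_sq]
  exact integrable_finsetSum _ fun x _ => integrable_finsetSum _ fun x' _ =>
    (integrable_exp_gauss _ _ _).const_mul _

theorem integral_gaussMixDensity_sq (s : Finset ℝ) (d : ℝ → ℝ) (h : ℝ) {σ : ℝ} (hσ : 0 < σ) :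
    ∫ y, gaussMixDensity s d h σ y ^ 2 ∂(gauss 0 (σ ^ 2)) =
      ∑ x ∈ s, ∑ x' ∈ s, d x * d x' * exp (h ^ 2 * (x * x')) := by
  simp_rw [gaussMixDensity_sq]
  rw [integral_finsetSum _ fun x _ => integrable_finsetSum _ fun x' _ =>
    (integrable_exp_gauss _ _ _).const_mul _]
  refine Finset.sum_congr rfl fun x _ => ?_
  rw [integral_finsetSum _ fun x' _ => (integrable_exp_gauss _ _ _).const_mul _]
  refine Finset.sum_congr rfl fun x' _ => ?_
  rw [integral_const_mul, integral_exp_gauss hσ]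
  congr 2; ring

theorem finset_sum_conv {ι : Type*} (s : Finset ι) (μ : ι → Measure ℝ) [∀ i, SFinite (μ i)]
    (ν : Measure ℝ) [SFinite ν] :
    Measure.conv (∑ i ∈ s, μ i) ν = ∑ i ∈ s, Measure.conv (μ i) ν := by
  classical
  induction s using Finset.induction_on with
  | empty => simp
  | insert a s ha ih =>
    rw [Finset.sum_insert ha, Finset.sum_insert ha]
    have : SFinite (∑ i ∈ s, μ i) := by
      rw [← Measure.sum_coe_finset]; infer_instance
    rw [Measure.add_conv, ih]

theorem dirac_conv_gauss (m v : ℝ) : Measure.conv (Measure.dirac m) (gauss 0 v) = gauss m v := by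
  have : SFinite (gauss 0 v) := by unfold gauss; infer_instance
  rw [Measure.dirac_conv, gauss, gaussianReal_map_const_add, zero_add, gauss]

/-- A finite Gaussian mixture with a component of weight at least `1 - ε` is a two-groups model. -/
theorem exists_efron_eq_gaussMix (s : Finset ℝ) {p : ℝ → ℝ} (hp : ∀ x ∈ s, 0 ≤ p x)
    (hsum : ∑ x ∈ s, p x = 1) {c : ℝ} (hc : c ∈ s) {ε : ℝ} (hε : 0 ≤ ε) (hε1 : ε ≤ 1)
    (hpc : 1 - ε ≤ p c) (h σ : ℝ) :
    ∃ Q : Measure ℝ, IsProbabilityMeasure Q ∧ efron (c * h * σ) σ ε Q = gaussMix s p h σ := by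
  rcases hε.eq_or_lt with rfl | hε
  · refine ⟨Measure.dirac 0, inferInstance, ?_⟩
    have h0 : ∀ x ∈ s, x ≠ c → p x = 0 := by
      intro x hx hxc
      have h1 := Finset.add_sum_erase s p hc
      have h2 := Finset.single_le_sum (f := p) (s := s.erase c)
        (fun y hy => hp y (Finset.mem_of_mem_erase hy)) (Finset.mem_erase.2 ⟨hxc, hx⟩)
      linarith [hp x hx]
    have h1 : p c = 1 := by
      rw [← hsum, Finset.sum_eq_single_of_mem c hc h0]
    rw [gaussMix, Finset.sum_eq_single_of_mem c hc fun x hx hxc => by simp [h0 x hx hxc], h1, efron]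
    simp
  set w : ℝ → ℝ := fun x => (p x - if x = c then 1 - ε else 0) / ε with hw
  have hw0 : ∀ x ∈ s, 0 ≤ w x := by
    intro x hx
    refine div_nonneg ?_ hε.le
    split_ifs with hxc
    · rw [hxc]; linarith
    · linarith [hp x hx]
  have hw1 : ∑ x ∈ s, w x = 1 := by
    simp only [hw]
    rw [← Finset.sum_div, Finset.sum_sub_distrib, hsum, Finset.sum_ite_eq' s c, if_pos hc]
    field_simp; ring
  have : SFinite (gauss 0 (σ ^ 2)) := by unfold gauss; infer_instance
  refine ⟨∑ x ∈ s, ENNReal.ofReal (w x) • Measure.dirac (x * h * σ), ⟨?_⟩, ?_⟩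
  · rw [Measure.finsetSum_apply]
    simp only [Measure.smul_apply, measure_univ, smul_eq_mul, mul_one]
    rw [← ENNReal.ofReal_sum_of_nonneg hw0, hw1, ENNReal.ofReal_one]
  · rw [efron, finset_sum_conv, gaussMix]
    simp_rw [Measure.conv_smul_left, dirac_conv_gauss]
    rw [Finset.smul_sum, ← Finset.add_sum_erase _ _ hc, ← add_assoc,
      ← Finset.add_sum_erase s (fun x => ENNReal.ofReal (p x) • gauss (x * h * σ) (σ ^ 2)) hc]
    congr 1
    · rw [smul_smul, ← add_smul, ← ENNReal.ofReal_mul hε.le,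
        ← ENNReal.ofReal_add (by linarith) (mul_nonneg hε.le (hw0 c hc))]
      congr 2
      simp only [hw, if_true]
      field_simp; ring
    · refine Finset.sum_congr rfl fun x hx => ?_
      rw [smul_smul, ← ENNReal.ofReal_mul hε.le]
      congr 2
      simp only [hw, if_neg (Finset.ne_of_mem_erase hx)]
      field_simp; ring

/-- If the moments of a finitely supported signed measure vanish below order `K` and grow at most
geometrically, the exponential kernel is small on it. -/
theorem sum_sum_exp_le (s : Finset ℝ) (d : ℝ → ℝ) {h B M t : ℝ} {K : ℕ} (ht : 1 ≤ t)
    (h0 : ∀ k < K, ∑ x ∈ s, d x * x ^ k = 0)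
    (hB : ∀ k, K ≤ k → |h ^ k * ∑ x ∈ s, d x * x ^ k| ≤ B * M ^ k) :
    ∑ x ∈ s, ∑ x' ∈ s, d x * d x' * exp (h ^ 2 * (x * x')) ≤
      B ^ 2 * (t ^ K)⁻¹ * exp (t * M ^ 2) := by
  have hexp : ∀ z : ℝ, HasSum (fun k : ℕ => z ^ k / (k.factorial : ℝ)) (exp z) := by
    intro z
    rw [Real.exp_eq_exp_ℝ]
    exact NormedSpace.expSeries_div_hasSum_exp z
  have h1 : HasSum (fun k : ℕ => ∑ x ∈ s, ∑ x' ∈ s, d x * d x' *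
      ((h ^ 2 * (x * x')) ^ k / (k.factorial : ℝ)))
      (∑ x ∈ s, ∑ x' ∈ s, d x * d x' * exp (h ^ 2 * (x * x'))) :=
    hasSum_sum fun x _ => hasSum_sum fun x' _ => (hexp _).mul_left _
  have h2 : HasSum (fun k : ℕ => B ^ 2 * (t ^ K)⁻¹ * ((t * M ^ 2) ^ k / (k.factorial : ℝ)))
      (B ^ 2 * (t ^ K)⁻¹ * exp (t * M ^ 2)) := (hexp _).mul_left _
  refine hasSum_le (fun k => ?_) h1 h2
  have h3 : ∑ x ∈ s, ∑ x' ∈ s, d x * d x' * ((h ^ 2 * (x * x')) ^ k / (k.factorial : ℝ)) =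
      (h ^ k * ∑ x ∈ s, d x * x ^ k) ^ 2 / (k.factorial : ℝ) := by
    rw [mul_pow, sq (∑ x ∈ s, d x * x ^ k), Finset.sum_mul_sum, Finset.mul_sum, Finset.sum_div]
    refine Finset.sum_congr rfl fun x _ => ?_
    rw [Finset.mul_sum, Finset.sum_div]
    refine Finset.sum_congr rfl fun x' _ => ?_
    rw [mul_pow, mul_pow]
    ring
  have htpos : 0 < t := by linarith
  rw [h3, ← mul_div_assoc]
  gcongr
  rcases lt_or_ge k K with hk | hk
  · rw [h0 k hk]
    simp only [mul_zero, ne_eq, OfNat.ofNat_ne_zero, not_false_eq_true, zero_pow]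
    positivity
  · have h4 := sq_le_sq' (by linarith [neg_abs_le (h ^ k * ∑ x ∈ s, d x * x ^ k), hB k hk])
      ((le_abs_self _).trans (hB k hk))
    refine h4.trans ?_
    have h5 : 1 ≤ (t ^ K)⁻¹ * t ^ k := by
      rw [← div_eq_inv_mul, one_le_div (by positivity)]
      exact pow_le_pow_right₀ ht hk
    calc (B * M ^ k) ^ 2 = (B * M ^ k) ^ 2 * 1 := (mul_one _).symm
      _ ≤ (B * M ^ k) ^ 2 * ((t ^ K)⁻¹ * t ^ k) := by gcongr
      _ = B ^ 2 * (t ^ K)⁻¹ * (t * M ^ 2) ^ k := by rw [mul_pow t]; ring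

/-- An adaptive confidence interval is at least as long as the separation between two
indistinguishable two-groups models. -/
theorem le_length_of_gaussMix {δ εmax ε σ h a : ℝ} {n : ℕ} (hδ : δ ∈ Set.Ioo (0 : ℝ) (1 / 4))
    (hεm : εmax ∈ Set.Ioo (0 : ℝ) (1 / 2)) (hε : ε ∈ Set.Icc 0 εmax) (hσ : 0 < σ)
    {l u : (Fin n → ℝ) → ℝ} (hl : Measurable l) (hu : Measurable u) {r : ℝ → ℝ}
    (hlu : ∀ (θ ε : ℝ), ε ∈ Set.Icc 0 εmax → ∀ Q : Measure ℝ, IsProbabilityMeasure Q →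
      ENNReal.ofReal (1 - δ) ≤ iid n (efron θ σ ε Q) {x | l x ≤ θ ∧ θ ≤ u x} ∧
      ENNReal.ofReal (1 - δ) ≤ iid n (efron θ σ ε Q) {x | u x - l x ≤ r ε})
    (s : Finset ℝ) {p q : ℝ → ℝ} (hp : ∀ x ∈ s, 0 ≤ p x) (hq : ∀ x ∈ s, 0 ≤ q x)
    (hps : ∑ x ∈ s, p x = 1) (hqs : ∑ x ∈ s, q x = 1) (h0s : 0 ∈ s) (has : a ∈ s)
    (hp0 : 1 - ε ≤ p 0) (hqa : 1 - εmax ≤ q a)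
    (hχ : n * (2 * ∑ x ∈ s, ∑ x' ∈ s, (q x - p x) * (q x' - p x') * exp (h ^ 2 * (x * x'))) ≤
      1 / 17) :
    a * h * σ ≤ r ε := by
  by_contra! hr
  have hγ : IsProbabilityMeasure (gauss 0 (σ ^ 2)) := by unfold gauss; infer_instance
  obtain ⟨Q₀, hQ₀, hP₀⟩ := exists_efron_eq_gaussMix s hp hps h0s hε.1
    (by linarith [hε.2, hεm.2]) hp0 h σ
  obtain ⟨Q₁, hQ₁, hP₁⟩ := exists_efron_eq_gaussMix s hq hqs has hεm.1.le
    (by linarith [hεm.2]) hqa h σ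
  have hdiff : ∀ y, gaussMixDensity s q h σ y - gaussMixDensity s p h σ y =
      gaussMixDensity s (fun x => q x - p x) h σ y := by
    intro y
    simp only [gaussMixDensity, sub_mul, Finset.sum_sub_distrib]
  set A : Set (Fin n → ℝ) := {x | l x ≤ a * h * σ ∧ a * h * σ ≤ u x}ᶜ with hA
  have hAm : MeasurableSet A :=
    ((measurableSet_le hl measurable_const).inter (measurableSet_le measurable_const hu)).compl
  have hkey := real_iid_sub_le (n := n) (gauss 0 (σ ^ 2)) (gaussMixDensity s p h σ)
    (gaussMixDensity s q h σ) (measurable_gaussMixDensity s p h σ)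
    (measurable_gaussMixDensity s q h σ) ?_
    (fun y => Finset.sum_nonneg fun x hx => mul_nonneg (hq x hx) (exp_pos _).le)
    (integrable_gaussMixDensity s p h σ) (integrable_gaussMixDensity s q h σ)
    ((integral_gaussMixDensity s p h hσ).trans hps)
    ((integral_gaussMixDensity s q h hσ).trans hqs)
    (by simp_rw [hdiff]; exact integrable_gaussMixDensity_sq s _ h σ)
    (by simp_rw [hdiff]; rwa [integral_gaussMixDensity_sq s _ h hσ]) hAm
  · have hpr : ∀ {p : ℝ → ℝ}, (∀ x ∈ s, 0 ≤ p x) → ∑ x ∈ s, p x = 1 →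
        IsProbabilityMeasure (iid n (gaussMix s p h σ)) := by
      intro p hp hps
      have : IsProbabilityMeasure (gaussMix s p h σ) := by
        refine ⟨?_⟩
        rw [gaussMix_eq_withDensity s hp h hσ, withDensity_apply _ MeasurableSet.univ,
          Measure.restrict_univ, ← ofReal_integral_eq_lintegral_ofReal
            (integrable_gaussMixDensity s p h σ) (Filter.Eventually.of_forall fun y =>
              Finset.sum_nonneg fun x hx => mul_nonneg (hp x hx) (exp_pos _).le),
          integral_gaussMixDensity s p h hσ, hps, ENNReal.ofReal_one]
      unfold iid; infer_instance
    have hpr₀ := hpr hp hps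
    have hpr₁ := hpr hq hqs
    rw [← gaussMix_eq_withDensity s hp h hσ, ← gaussMix_eq_withDensity s hq h hσ] at hkey
    obtain ⟨hc₀, hr₀⟩ := hlu _ ε hε Q₀ hQ₀
    obtain ⟨hc₁, -⟩ := hlu _ εmax ⟨hεm.1.le, le_rfl⟩ Q₁ hQ₁
    rw [hP₀] at hc₀ hr₀
    rw [hP₁] at hc₁
    rw [ENNReal.ofReal_le_iff_le_toReal (measure_ne_top _ _), ← measureReal_def] at hc₀ hr₀ hc₁
    have hA₁ : (iid n (gaussMix s q h σ)).real A ≤ δ := by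
      rw [hA, probReal_compl_eq_one_sub (by simpa [hA] using hAm.compl)]
      linarith
    have hE : MeasurableSet {x | u x - l x ≤ r ε} := measurableSet_le (hu.sub hl) measurable_const
    have hE' := probReal_compl_eq_one_sub (μ := iid n (gaussMix s p h σ)) hE
    have hsub : {x | l x ≤ 0 * h * σ ∧ 0 * h * σ ≤ u x} ⊆ A ∪ {x | u x - l x ≤ r ε}ᶜ := by
      rintro x ⟨hx, -⟩
      rw [zero_mul, zero_mul] at hx
      by_cases hx2 : u x - l x ≤ r ε
      · left
        rintro ⟨-, hx3⟩
        linarith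
      · exact Or.inr hx2
    have h3 := (measureReal_mono (μ := iid n (gaussMix s p h σ)) hsub).trans
      (measureReal_union_le _ _)
    linarith [hδ.2]
  · intro y
    have h1 : p 0 * exp (0 * h * y / σ - (0 * h) ^ 2 / 2) ≤ gaussMixDensity s p h σ y :=
      Finset.single_le_sum (f := fun x => p x * exp (x * h * y / σ - (x * h) ^ 2 / 2))
        (fun x hx => mul_nonneg (hp x hx) (exp_pos _).le) h0s
    simp only [zero_mul, zero_div, ne_eq, OfNat.ofNat_ne_zero, not_false_eq_true, zero_pow,
      sub_zero, exp_zero, mul_one] at h1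
    linarith [hε.2, hεm.2]

/-- The real numbers `±(i + 1)` for `i ∈ S`. -/
noncomputable def symmNodes (S : Finset ℕ) : Finset ℝ :=
  S.biUnion fun i => {(i + 1 : ℝ), -(i + 1 : ℝ)}

theorem mem_symmNodes {S : Finset ℕ} {y : ℝ} :
    y ∈ symmNodes S ↔ ∃ i ∈ S, y = (i + 1 : ℝ) ∨ y = -(i + 1 : ℝ) := by
  simp [symmNodes]

theorem one_le_abs_of_mem_symmNodes {S : Finset ℕ} {y : ℝ} (hy : y ∈ symmNodes S) : 1 ≤ |y| := by
  obtain ⟨i, -, rfl | rfl⟩ := mem_symmNodes.1 hy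
  · rw [abs_of_pos (by positivity)]; simp
  · rw [abs_neg, abs_of_pos (by positivity)]; simp

theorem symmNodes_pairwiseDisjoint (S : Finset ℕ) :
    (S : Set ℕ).PairwiseDisjoint fun i : ℕ => ({(i + 1 : ℝ), -(i + 1 : ℝ)} : Finset ℝ) := by
  intro i _ j _ hij
  have hi : (0 : ℝ) ≤ i := Nat.cast_nonneg i
  have hj : (0 : ℝ) ≤ j := Nat.cast_nonneg j
  have hne : (i : ℝ) ≠ j := Nat.cast_injective.ne hij
  rw [Function.onFun, Finset.disjoint_left]
  intro y hy hy'
  simp only [Finset.mem_insert, Finset.mem_singleton] at hy hy'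
  rcases hy with rfl | rfl <;> rcases hy' with h | h
  · exact hne (by linarith)
  · linarith
  · linarith
  · exact hne (by linarith)

theorem ne_neg_add_one (i : ℕ) : (i + 1 : ℝ) ≠ -(i + 1 : ℝ) := by
  have hi : (0 : ℝ) ≤ i := Nat.cast_nonneg i
  intro h; linarith

theorem prod_symmNodes (S : Finset ℕ) (f : ℝ → ℝ) :
    ∏ y ∈ symmNodes S, f y = ∏ i ∈ S, f (i + 1) * f (-(i + 1)) := by
  rw [symmNodes, Finset.prod_biUnion (symmNodes_pairwiseDisjoint S)]
  exact Finset.prod_congr rfl fun i _ => Finset.prod_pair (ne_neg_add_one i)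

theorem sum_symmNodes (S : Finset ℕ) (f : ℝ → ℝ) :
    ∑ y ∈ symmNodes S, f y = ∑ i ∈ S, (f (i + 1) + f (-(i + 1))) := by
  rw [symmNodes, Finset.sum_biUnion (symmNodes_pairwiseDisjoint S)]
  exact Finset.sum_congr rfl fun i _ => Finset.sum_pair (ne_neg_add_one i)

theorem card_symmNodes (S : Finset ℕ) : (symmNodes S).card = 2 * S.card := by
  rw [symmNodes, Finset.card_biUnion (symmNodes_pairwiseDisjoint S),
    Finset.sum_congr rfl fun i _ => Finset.card_pair (ne_neg_add_one i), Finset.sum_const,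
    smul_eq_mul, mul_comm]

theorem prod_sub_symmNodes (S : Finset ℕ) (x : ℝ) :
    ∏ y ∈ symmNodes S, (x - y) = ∏ i ∈ S, (x ^ 2 - (i + 1 : ℝ) ^ 2) := by
  rw [prod_symmNodes S fun y => x - y]
  exact Finset.prod_congr rfl fun i _ => by ring

theorem symmNodes_erase {S : Finset ℕ} {k : ℕ} (hk : k ∈ S) {y : ℝ}
    (hy : y = (k + 1 : ℝ) ∨ y = -(k + 1 : ℝ)) :
    (symmNodes S).erase y = insert (-y) (symmNodes (S.erase k)) ∧
      -y ∉ symmNodes (S.erase k) := by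
  have key : ∀ i : ℕ, ∀ z : ℝ, (z = (i + 1 : ℝ) ∨ z = -(i + 1 : ℝ)) → (z = y ∨ z = -y) →
      i = k := by
    intro i z hz hzy
    have hi : (0 : ℝ) ≤ i := Nat.cast_nonneg i
    have hk : (0 : ℝ) ≤ k := Nat.cast_nonneg k
    have : (i : ℝ) = k := by
      rcases hy with rfl | rfl <;> rcases hz with rfl | rfl <;> rcases hzy with h | h <;> linarith
    exact_mod_cast this
  have hk0 : (0 : ℝ) ≤ k := Nat.cast_nonneg k
  constructor
  · ext z
    rw [Finset.mem_erase, Finset.mem_insert, mem_symmNodes, mem_symmNodes]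
    constructor
    · rintro ⟨hzy, i, hi, hz⟩
      by_cases hik : i = k
      · subst hik
        left
        rcases hy with rfl | rfl <;> rcases hz with rfl | rfl <;> simp at hzy ⊢
      · exact Or.inr ⟨i, Finset.mem_erase.2 ⟨hik, hi⟩, hz⟩
    · rintro (rfl | ⟨i, hi, hz⟩)
      · refine ⟨?_, k, hk, ?_⟩
        · rcases hy with rfl | rfl <;> intro h <;> linarith
        · rcases hy with rfl | rfl
          · exact Or.inr rfl
          · exact Or.inl (neg_neg _)
      · rw [Finset.mem_erase] at hi
        exact ⟨fun h => hi.1 (key i z hz (Or.inl h)), i, hi.2, hz⟩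
  · rw [mem_symmNodes]
    rintro ⟨i, hi, hz⟩
    exact (Finset.mem_erase.1 hi).1 (key i _ hz (Or.inr rfl))

theorem prod_range_erase_abs_sq_sub_sq (k j : ℕ) :
    2 * (k + 1 : ℝ) ^ 2 * ∏ i ∈ (Finset.range (k + 1 + j)).erase k,
      |(k + 1 : ℝ) ^ 2 - (i + 1 : ℝ) ^ 2| = (j.factorial : ℝ) * ((2 * k + 2 + j).factorial : ℝ) := by
  induction j with
  | zero =>
    have h1 : (Finset.range (k + 1 + 0)).erase k = Finset.range k := by
      rw [add_zero, Finset.range_add_one, Finset.erase_insert (by simp)]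
    have h2 : ∀ i ∈ Finset.range k, |(k + 1 : ℝ) ^ 2 - (i + 1 : ℝ) ^ 2| =
        ((k - 1 - i : ℕ) + 1 : ℕ) * ((k + 1 + 1 + i : ℕ) : ℝ) := by
      intro i hi
      have hik : i < k := Finset.mem_range.1 hi
      have h3 : k - 1 - i + 1 = k - i := by omega
      have h4 : (i : ℝ) ≤ k := by exact_mod_cast hik.le
      rw [h3, Nat.cast_sub hik.le, abs_of_nonneg (by nlinarith [Nat.cast_nonneg (α := ℝ) i])]
      push_cast; ring
    rw [h1, Finset.prod_congr rfl h2, Finset.prod_mul_distrib,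
      Finset.prod_range_reflect (fun i => ((i + 1 : ℕ) : ℝ)) k, ← Nat.cast_prod, ← Nat.cast_prod,
      Finset.prod_range_add_one_eq_factorial, ← Nat.ascFactorial_eq_prod_range]
    have h5 := Nat.factorial_mul_ascFactorial (k + 1) k
    have h6 : 2 * k + 2 + 0 = (k + 1 + k) + 1 := by ring
    rw [h6, Nat.factorial_succ (k + 1 + k), ← h5, Nat.factorial_succ k]
    push_cast
    ring
  | succ j ih =>
    have h1 : (Finset.range (k + 1 + (j + 1))).erase k =
        insert (k + 1 + j) ((Finset.range (k + 1 + j)).erase k) := by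
      rw [← add_assoc, Finset.range_add_one, Finset.erase_insert_of_ne (by omega)]
    rw [h1, Finset.prod_insert (by simp), mul_left_comm, ih, ← add_assoc,
      Nat.factorial_succ, Nat.factorial_succ,
      abs_of_nonpos (by push_cast; nlinarith [Nat.cast_nonneg (α := ℝ) k, Nat.cast_nonneg (α := ℝ) j])]
    push_cast
    ring

theorem factorial_sq_le {m d : ℕ} (hd : d ≤ m) :
    m.factorial * m.factorial ≤ (m - d).factorial * (m + d).factorial := by
  calc m.factorial * m.factorial
      = (m - d).factorial * (m.factorial * m.descFactorial d) := by
        rw [← Nat.factorial_mul_descFactorial hd]; ring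
    _ ≤ (m - d).factorial * (m.factorial * (m + 1) ^ d) := by
        gcongr
        exact (Nat.descFactorial_le_pow m d).trans (Nat.pow_le_pow_left (by omega) d)
    _ ≤ _ := by
        gcongr
        exact Nat.factorial_mul_pow_le_factorial

theorem prod_range_sq_eq (m : ℕ) :
    ∏ i ∈ Finset.range m, (i + 1 : ℝ) ^ 2 = (m.factorial : ℝ) * m.factorial := by
  rw [Finset.prod_pow, sq]
  have : ∏ i ∈ Finset.range m, (i + 1 : ℝ) = m.factorial := by
    rw [← Finset.prod_range_add_one_eq_factorial]; push_cast; rfl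
  rw [this]

theorem prod_sq_le_abs_prod_erase {m : ℕ} {y : ℝ} (hy : y ∈ symmNodes (Finset.range m)) :
    ∏ i ∈ Finset.range m, (i + 1 : ℝ) ^ 2 ≤
      |y| * |∏ z ∈ (symmNodes (Finset.range m)).erase y, (y - z)| := by
  obtain ⟨k, hk, hyk⟩ := mem_symmNodes.1 hy
  obtain ⟨he, hn⟩ := symmNodes_erase hk hyk
  have hk' : k < m := Finset.mem_range.1 hk
  have hsq : y ^ 2 = (k + 1 : ℝ) ^ 2 := by rcases hyk with rfl | rfl <;> ring
  have h1 : |y| * |∏ z ∈ (symmNodes (Finset.range m)).erase y, (y - z)| =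
      2 * (k + 1 : ℝ) ^ 2 * ∏ i ∈ (Finset.range m).erase k,
        |(k + 1 : ℝ) ^ 2 - (i + 1 : ℝ) ^ 2| := by
    rw [he, Finset.prod_insert hn, prod_sub_symmNodes, hsq, abs_mul, Finset.abs_prod, ← mul_assoc,
      ← abs_mul]
    congr 1
    rw [show y * (y - -y) = 2 * (k + 1 : ℝ) ^ 2 by rw [← hsq]; ring, abs_of_nonneg (by positivity)]
  obtain ⟨j, rfl⟩ : ∃ j, m = k + 1 + j := ⟨m - (k + 1), by omega⟩
  rw [h1, prod_range_erase_abs_sq_sub_sq, prod_range_sq_eq]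
  have h2 := factorial_sq_le (m := k + 1 + j) (d := k + 1) (by omega)
  rw [show k + 1 + j - (k + 1) = j by omega, show k + 1 + j + (k + 1) = 2 * k + 2 + j by ring] at h2
  exact_mod_cast h2

/-- Divided differences annihilate polynomials of low degree. -/
theorem sum_pow_div_prod_eq_zero (s : Finset ℝ) {k : ℕ} (hk : k + 1 < s.card) :
    ∑ x ∈ s, x ^ k / ∏ y ∈ s.erase x, (x - y) = 0 := by
  have h := Lagrange.coeff_eq_sum (s := s) (v := (id : ℝ → ℝ)) Function.injective_id.injOn
    (P := (Polynomial.X : Polynomial ℝ) ^ k) (by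
      rw [Polynomial.degree_X_pow]; exact_mod_cast (by omega : k < s.card))
  rw [Polynomial.coeff_X_pow, if_neg (by omega)] at h
  simpa using h.symm

theorem prod_ratio_ge_one (m : ℕ) {x : ℝ} (hx : |x| < 1) :
    1 ≤ (∏ i ∈ Finset.range m, ((0 : ℝ) ^ 2 - (i + 1 : ℝ) ^ 2)) /
      ∏ i ∈ Finset.range m, (x ^ 2 - (i + 1 : ℝ) ^ 2) := by
  rw [← Finset.prod_div_distrib]
  refine Finset.one_le_prod fun i _ => ?_
  have hx2 : x ^ 2 < 1 := by rwa [sq_lt_one_iff_abs_lt_one]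
  have hi : (1 : ℝ) ≤ (i + 1 : ℝ) ^ 2 := one_le_pow₀ (by simp)
  rw [← neg_div_neg_eq, one_le_div (by linarith)]
  linarith [sq_nonneg x]

/-- A signed measure on few points annihilating all polynomials of degree at most `2 * m + 1`,
whose negative part is concentrated at `0` and whose positive part charges `a`. -/
theorem exists_moment_matching (m : ℕ) {a b κ : ℝ} (ha : 0 < a) (hab : a ≤ b) (hb : b ≤ 1 / 2)
    (hκ : κ = 8 * (a * b) * ∑ i ∈ Finset.range m, 1 / (i + 1 : ℝ) ^ 2) :
    ∃ (s : Finset ℝ) (v : ℝ → ℝ), 0 ∈ s ∧ a ∈ s ∧ v 0 = -1 ∧ b / (a + b) ≤ v a ∧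
      ∑ x ∈ s.erase 0, max (-v x) 0 ≤ κ ∧
      (∀ k < 2 * m + 2, ∑ x ∈ s, v x * x ^ k = 0) ∧
      ∀ k, k ≠ 0 → |∑ x ∈ s, v x * x ^ k| ≤ (1 + κ) * b ^ k + κ * (m : ℝ) ^ k := by
  have hbpos : 0 < b := ha.trans_le hab
  set Z := symmNodes (Finset.range m) with hZ
  have hZ1 : ∀ y ∈ Z, 1 ≤ |y| := fun y hy => one_le_abs_of_mem_symmNodes hy
  have hnot : ∀ x : ℝ, |x| < 1 → x ∉ Z := fun x hx hxZ => (hZ1 x hxZ).not_gt hx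
  have ha1 : |a| < 1 := by rw [abs_of_pos ha]; linarith
  have hb1 : |-b| < 1 := by rw [abs_neg, abs_of_pos hbpos]; linarith
  have h0Z := hnot 0 (by simp)
  have haZ := hnot a ha1
  have hbZ := hnot (-b) hb1
  set T : ℝ → ℝ := fun x => ∏ y ∈ Z, (x - y) with hT
  have hTeq : ∀ x, T x = ∏ i ∈ Finset.range m, (x ^ 2 - (i + 1 : ℝ) ^ 2) :=
    fun x => prod_sub_symmNodes _ x
  have hT0 : ∀ x, x ∉ Z → T x ≠ 0 := fun x hx =>
    Finset.prod_ne_zero_iff.2 fun y hy => sub_ne_zero.2 fun h => hx (h ▸ hy)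
  set s : Finset ℝ := insert 0 (insert a (insert (-b) Z)) with hs
  have hn3 : -b ∉ Z := hbZ
  have hn2 : a ∉ insert (-b) Z := by
    rw [Finset.mem_insert, not_or]; exact ⟨by linarith, haZ⟩
  have hn1 : (0 : ℝ) ∉ insert a (insert (-b) Z) := by
    simp only [Finset.mem_insert, not_or]; exact ⟨by linarith, by linarith, h0Z⟩
  have hcard : s.card = 2 * m + 3 := by
    rw [hs, Finset.card_insert_of_notMem hn1, Finset.card_insert_of_notMem hn2,
      Finset.card_insert_of_notMem hn3, hZ, card_symmNodes, Finset.card_range]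
  set D : ℝ → ℝ := fun x => ∏ y ∈ s.erase x, (x - y) with hD
  have hD0 : D 0 = -(a * b) * T 0 := by
    simp only [hD, hs]
    rw [Finset.erase_insert hn1, Finset.prod_insert hn2, Finset.prod_insert hn3]
    ring
  have hDa : D a = a * (a + b) * T a := by
    simp only [hD, hs]
    rw [Finset.erase_insert_of_ne (by linarith), Finset.erase_insert hn2,
      Finset.prod_insert (fun h => hn1 (Finset.mem_insert_of_mem h)), Finset.prod_insert hn3]
    ring
  have hDb : D (-b) = b * (a + b) * T (-b) := by
    simp only [hD, hs]
    rw [Finset.erase_insert_of_ne (by linarith), Finset.erase_insert_of_ne (by linarith),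
      Finset.erase_insert hn3, Finset.prod_insert (by
        rw [Finset.mem_insert, not_or]; exact ⟨by linarith, h0Z⟩), Finset.prod_insert haZ]
    ring
  have hDy : ∀ y ∈ Z, D y = y * (y - a) * (y + b) * ∏ z ∈ Z.erase y, (y - z) := by
    intro y hy
    have e1 : (0 : ℝ) ≠ y := fun h => h0Z (h ▸ hy)
    have e2 : a ≠ y := fun h => haZ (h ▸ hy)
    have e3 : -b ≠ y := fun h => hbZ (h ▸ hy)
    simp only [hD, hs]
    rw [Finset.erase_insert_of_ne e1, Finset.erase_insert_of_ne e2, Finset.erase_insert_of_ne e3,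
      Finset.prod_insert, Finset.prod_insert, Finset.prod_insert]
    · ring
    · exact fun h => hbZ (Finset.mem_of_mem_erase h)
    · rw [Finset.mem_insert, not_or]
      exact ⟨by linarith, fun h => haZ (Finset.mem_of_mem_erase h)⟩
    · simp only [Finset.mem_insert, not_or]
      exact ⟨by linarith, by linarith, fun h => h0Z (Finset.mem_of_mem_erase h)⟩
  have hD0ne : D 0 ≠ 0 := by
    rw [hD0]; exact mul_ne_zero (neg_ne_zero.2 (mul_pos ha hbpos).ne') (hT0 0 h0Z)
  set v : ℝ → ℝ := fun x => -D 0 / D x with hv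
  have hva : v a = b / (a + b) * (T 0 / T a) := by
    have := hT0 a haZ
    simp only [hv, hD0, hDa]; field_simp
  have hvb : v (-b) = a / (a + b) * (T 0 / T (-b)) := by
    have := hT0 (-b) hbZ
    simp only [hv, hD0, hDb]; field_simp
  have hra : 1 ≤ T 0 / T a := by rw [hTeq, hTeq]; exact prod_ratio_ge_one m ha1
  have hrb : 1 ≤ T 0 / T (-b) := by rw [hTeq, hTeq]; exact prod_ratio_ge_one m hb1
  have hva0 : b / (a + b) ≤ v a := by
    rw [hva]; exact le_mul_of_one_le_right (by positivity) hra
  have hva1 : 0 ≤ v a := le_trans (by positivity) hva0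
  have hvb0 : 0 ≤ v (-b) := by
    rw [hvb]; exact mul_nonneg (by positivity) (by linarith)
  have hvy : ∀ y ∈ Z, |v y| ≤ 4 * (a * b) * (1 / y ^ 2) := by
    intro y hy
    have hy1 := hZ1 y hy
    have hypos : 0 < |y| := by linarith
    have hP := prod_sq_le_abs_prod_erase hy
    set P := |∏ z ∈ Z.erase y, (y - z)| with hPdef
    have hTabs : |T 0| = ∏ i ∈ Finset.range m, (i + 1 : ℝ) ^ 2 := by
      rw [hTeq, Finset.abs_prod]
      refine Finset.prod_congr rfl fun i _ => ?_
      rw [abs_sub_comm, zero_pow two_ne_zero, sub_zero, abs_of_nonneg (sq_nonneg _)]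
    have hTpos : 0 < |T 0| := abs_pos.2 (hT0 0 h0Z)
    have h1 : |y| / 2 ≤ |y - a| := by
      have := abs_sub_abs_le_abs_sub y a
      rw [abs_of_pos ha] at this; linarith
    have h2 : |y| / 2 ≤ |y + b| := by
      have := abs_sub_abs_le_abs_sub y (-b)
      rw [abs_neg, abs_of_pos hbpos, sub_neg_eq_add] at this; linarith
    have h3 : y ^ 2 / 4 ≤ |y - a| * |y + b| := by
      calc y ^ 2 / 4 = |y| / 2 * (|y| / 2) := by rw [← sq_abs]; ring
        _ ≤ _ := mul_le_mul h1 h2 (by positivity) (abs_nonneg _)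
    have hy2 : 0 < y ^ 2 := by rw [← sq_abs]; positivity
    have h4 : y ^ 2 / 4 * |T 0| ≤ |D y| := by
      rw [hDy y hy, abs_mul, abs_mul, abs_mul, ← hPdef]
      calc y ^ 2 / 4 * |T 0| ≤ (|y - a| * |y + b|) * (|y| * P) :=
            mul_le_mul h3 (hTabs ▸ hP) (abs_nonneg _) (by positivity)
        _ = _ := by ring
    have h5 : 0 < |D y| := lt_of_lt_of_le (by positivity) h4
    have hyne : y ≠ 0 := abs_pos.1 hypos
    simp only [hv]
    rw [abs_div, div_le_iff₀ h5, hD0, abs_neg, abs_mul, abs_neg, abs_of_pos (mul_pos ha hbpos)]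
    calc a * b * |T 0| = 4 * (a * b) * (1 / y ^ 2) * (y ^ 2 / 4 * |T 0|) := by field_simp
      _ ≤ _ := by gcongr
  have hκsum : ∑ y ∈ Z, |v y| ≤ κ := by
    calc ∑ y ∈ Z, |v y| ≤ ∑ y ∈ Z, 4 * (a * b) * (1 / y ^ 2) := Finset.sum_le_sum hvy
      _ = κ := by
        rw [hZ, sum_symmNodes, hκ, Finset.mul_sum]
        exact Finset.sum_congr rfl fun i _ => by rw [neg_sq]; ring
  have hmom : ∀ k < 2 * m + 2, ∑ x ∈ s, v x * x ^ k = 0 := by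
    intro k hk
    have h := sum_pow_div_prod_eq_zero s (k := k) (by omega)
    calc ∑ x ∈ s, v x * x ^ k = -D 0 * ∑ x ∈ s, x ^ k / D x := by
          rw [Finset.mul_sum]
          exact Finset.sum_congr rfl fun x _ => by simp only [hv]; ring
      _ = 0 := by simp only [hD]; rw [h, mul_zero]
  have hv0 : v 0 = -1 := by
    simp only [hv]; rw [neg_div, div_self hD0ne]
  have hsplit : ∀ f : ℝ → ℝ, ∑ x ∈ s, f x = f 0 + (f a + (f (-b) + ∑ y ∈ Z, f y)) := by
    intro f
    rw [hs, Finset.sum_insert hn1, Finset.sum_insert hn2, Finset.sum_insert hn3]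
  refine ⟨s, v, by simp [hs], by simp [hs], hv0, hva0, ?_, hmom, ?_⟩
  · rw [hs, Finset.erase_insert hn1, Finset.sum_insert hn2, Finset.sum_insert hn3,
      max_eq_right (by linarith), max_eq_right (by linarith), zero_add, zero_add]
    exact (Finset.sum_le_sum fun y _ => max_le (neg_le_abs _) (abs_nonneg _)).trans hκsum
  · intro k hk
    have hmass : v a + v (-b) ≤ 1 + κ := by
      have h := hmom 0 (by omega)
      simp only [pow_zero, mul_one] at h
      rw [hsplit, hv0] at h
      have h2 := Finset.abs_sum_le_sum_abs v Z
      linarith [neg_abs_le (∑ y ∈ Z, v y)]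
    have hZm : ∀ y ∈ Z, |y| ≤ m := by
      intro y hy
      obtain ⟨i, hi, hyi⟩ := mem_symmNodes.1 hy
      have him : (i + 1 : ℝ) ≤ m := by exact_mod_cast Finset.mem_range.1 hi
      rcases hyi with rfl | rfl
      · rwa [abs_of_nonneg (by positivity)]
      · rwa [abs_neg, abs_of_nonneg (by positivity)]
    rw [hsplit, zero_pow hk, mul_zero, zero_add]
    have h1 : |v a * a ^ k| ≤ v a * b ^ k := by
      rw [abs_of_nonneg (by positivity)]; gcongr
    have h2 : |v (-b) * (-b) ^ k| = v (-b) * b ^ k := by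
      rw [abs_mul, abs_pow, abs_neg, abs_of_pos hbpos, abs_of_nonneg hvb0]
    have h3 : |∑ y ∈ Z, v y * y ^ k| ≤ κ * (m : ℝ) ^ k := by
      calc |∑ y ∈ Z, v y * y ^ k| ≤ ∑ y ∈ Z, |v y * y ^ k| := Finset.abs_sum_le_sum_abs _ _
        _ ≤ ∑ y ∈ Z, |v y| * (m : ℝ) ^ k := by
          refine Finset.sum_le_sum fun y hy => ?_
          rw [abs_mul, abs_pow]
          gcongr
          exact hZm y hy
        _ = (∑ y ∈ Z, |v y|) * (m : ℝ) ^ k := by rw [Finset.sum_mul]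
        _ ≤ _ := by gcongr
    have h4 : (v a + v (-b)) * b ^ k ≤ (1 + κ) * b ^ k := by gcongr
    calc _ ≤ |v a * a ^ k| + (|v (-b) * (-b) ^ k| + |∑ y ∈ Z, v y * y ^ k|) :=
          (abs_add_le _ _).trans (add_le_add_right (abs_add_le _ _) _)
      _ ≤ _ := by linarith

/-- The length lower bound produced by a moment-matching pair with parameters `m, a, b`. -/
theorem le_length_of_moment_bound {δ εmax ε σ h : ℝ} {n : ℕ} (hδ : δ ∈ Set.Ioo (0 : ℝ) (1 / 4))
    (hεm : εmax ∈ Set.Ioo (0 : ℝ) (1 / 2)) (hε : ε ∈ Set.Icc 0 εmax) (hσ : 0 < σ)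
    {l u : (Fin n → ℝ) → ℝ} (hl : Measurable l) (hu : Measurable u) {r : ℝ → ℝ}
    (hlu : ∀ (θ ε : ℝ), ε ∈ Set.Icc 0 εmax → ∀ Q : Measure ℝ, IsProbabilityMeasure Q →
      ENNReal.ofReal (1 - δ) ≤ iid n (efron θ σ ε Q) {x | l x ≤ θ ∧ θ ≤ u x} ∧
      ENNReal.ofReal (1 - δ) ≤ iid n (efron θ σ ε Q) {x | u x - l x ≤ r ε})
    (m : ℕ) {a b κ B M t : ℝ} (ha : 0 < a) (hab : a ≤ b) (hb : b ≤ 1 / 2)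
    (hκ : κ = 8 * (a * b) * ∑ i ∈ Finset.range m, 1 / (i + 1 : ℝ) ^ 2) (hκε : κ ≤ ε)
    (hmass : (1 - εmax) * (1 + κ) ≤ b / (a + b)) (hh : 0 ≤ h) (ht : 1 ≤ t)
    (hB : ∀ k, 2 * m + 2 ≤ k → h ^ k * ((1 + κ) * b ^ k + κ * (m : ℝ) ^ k) ≤ B * M ^ k)
    (hn : n * (2 * (B ^ 2 * (t ^ (2 * m + 2))⁻¹ * exp (t * M ^ 2))) ≤ 1 / 17) :
    a * h * σ ≤ r ε := by
  obtain ⟨s, v, h0s, has, hv0, hva, hneg, hmom, hmomle⟩ :=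
    exists_moment_matching m ha hab hb hκ
  set W : ℝ := ∑ x ∈ s, max (-v x) 0 with hW
  have hWeq : W = 1 + ∑ x ∈ s.erase 0, max (-v x) 0 := by
    rw [hW, ← Finset.add_sum_erase s _ h0s, hv0]; norm_num
  have hW1 : 1 ≤ W := by
    rw [hWeq]
    linarith [Finset.sum_nonneg fun x (_ : x ∈ s.erase 0) => le_max_right (-v x) 0]
  have hW2 : W ≤ 1 + κ := by rw [hWeq]; linarith
  have hW0 : 0 < W := by linarith
  have hκ1 : 0 < 1 + κ := by linarith
  have hpm : ∀ x, max (v x) 0 - max (-v x) 0 = v x := by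
    intro x
    rcases le_total (v x) 0 with hx | hx
    · rw [max_eq_right hx, max_eq_left (by linarith)]; ring
    · rw [max_eq_left hx, max_eq_right (by linarith)]; ring
  have hWp : ∑ x ∈ s, max (v x) 0 = W := by
    have h1 := hmom 0 (by omega)
    simp only [pow_zero, mul_one] at h1
    rw [← Finset.sum_congr rfl fun x _ => hpm x, Finset.sum_sub_distrib] at h1
    linarith
  have hd : ∀ x, max (v x) 0 / W - max (-v x) 0 / W = v x / W := fun x => by
    rw [← sub_div, hpm]
  have hdm : ∀ k, ∑ x ∈ s, v x / W * x ^ k = (∑ x ∈ s, v x * x ^ k) / W := fun k => by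
    rw [Finset.sum_div]
    exact Finset.sum_congr rfl fun x _ => by ring
  refine le_length_of_gaussMix hδ hεm hε hσ hl hu hlu s (p := fun x => max (-v x) 0 / W)
    (q := fun x => max (v x) 0 / W) (fun x _ => by positivity) (fun x _ => by positivity)
    ?_ ?_ h0s has ?_ ?_ ?_
  · rw [← Finset.sum_div, div_self hW0.ne']
  · rw [← Finset.sum_div, hWp, div_self hW0.ne']
  · simp only [hv0, neg_neg]
    rw [max_eq_left zero_le_one, le_div_iff₀ hW0]
    rcases le_total 1 ε with h1 | h1
    · nlinarith
    · nlinarith [hε.1]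
  · rw [le_div_iff₀ hW0]
    calc (1 - εmax) * W ≤ (1 - εmax) * (1 + κ) := by
          have := hεm.2
          gcongr
          linarith
      _ ≤ v a := hmass.trans hva
      _ ≤ _ := le_max_left _ _
  · simp only [hd]
    refine le_trans ?_ hn
    gcongr
    refine sum_sum_exp_le s (fun x => v x / W) ht (fun k hk => ?_) fun k hk => ?_
    · rw [hdm, hmom k hk, zero_div]
    · rw [hdm, abs_mul, abs_of_nonneg (pow_nonneg hh k), abs_div, abs_of_pos hW0]
      refine le_trans ?_ (hB k hk)
      gcongr
      exact (div_le_self (abs_nonneg _) hW1).trans (hmomle k (by omega))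

theorem sum_range_one_div_sq_le (m : ℕ) :
    ∑ i ∈ Finset.range m, 1 / (i + 1 : ℝ) ^ 2 ≤ 2 := by
  suffices h : ∑ i ∈ Finset.range m, 1 / (i + 1 : ℝ) ^ 2 ≤ 2 - 1 / (m : ℝ) from
    h.trans (by simp)
  induction m with
  | zero => norm_num
  | succ m ih =>
    rw [Finset.sum_range_succ]
    rcases m.eq_zero_or_pos with rfl | hm
    · norm_num
    have hm : (0 : ℝ) < m := Nat.cast_pos.2 hm
    have h1 : 1 / (m + 1 : ℝ) ^ 2 ≤ 1 / (m * (m + 1)) := by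
      gcongr; nlinarith
    have h2 : 1 / (m : ℝ) - 1 / (m + 1) = 1 / (m * (m + 1)) := by field_simp; ring
    push_cast
    linarith

theorem mul_exp_tail_le {n ε C : ℝ} {m : ℕ} (hn : 0 < n) (hε : 0 < ε) (hC : 0 < C)
    (hm : log (exp 1 * n * ε ^ 2) + 34 * C ^ 2 ≤ m) :
    n * (2 * ((C * ε) ^ 2 * (exp 1 ^ (2 * m + 2))⁻¹ * exp (exp 1 * (√m / 2) ^ 2))) ≤ 1 / 17 := by
  have hlog : log (exp 1 * n * ε ^ 2) = 1 + log (n * ε ^ 2) := by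
    rw [mul_assoc, log_mul (exp_pos 1).ne' (by positivity), log_exp]
  have hy : n * ε ^ 2 = exp (log (n * ε ^ 2)) := (exp_log (by positivity)).symm
  set y := log (n * ε ^ 2) with hydef
  have h1 : exp (exp 1 * (√m / 2) ^ 2) ≤ exp m := by
    rw [exp_le_exp, div_pow, sq_sqrt (Nat.cast_nonneg m)]
    nlinarith [exp_one_lt_d9, Nat.cast_nonneg (α := ℝ) m]
  have h2 : (exp 1 ^ (2 * m + 2))⁻¹ = exp (-(2 * m + 2)) := by
    rw [← exp_nat_mul, exp_neg]; push_cast; ring_nf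
  have h3 : exp y * (exp (-(2 * m + 2)) * exp m) ≤ exp (-(34 * C ^ 2)) := by
    rw [← exp_add, ← exp_add, exp_le_exp]
    linarith
  have h4 : exp (-(34 * C ^ 2)) ≤ (34 * C ^ 2)⁻¹ := by
    rw [exp_neg]
    gcongr
    linarith [add_one_le_exp (34 * C ^ 2)]
  calc n * (2 * ((C * ε) ^ 2 * (exp 1 ^ (2 * m + 2))⁻¹ * exp (exp 1 * (√m / 2) ^ 2)))
      ≤ n * (2 * ((C * ε) ^ 2 * (exp 1 ^ (2 * m + 2))⁻¹ * exp m)) := by gcongr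
    _ = 2 * C ^ 2 * (n * ε ^ 2 * (exp (-(2 * m + 2)) * exp m)) := by rw [h2]; ring
    _ ≤ 2 * C ^ 2 * (34 * C ^ 2)⁻¹ := by
        rw [hy]; gcongr; exact h3.trans h4
    _ = 1 / 17 := by field_simp; norm_num

/-- In the regime `1 ≤ n * ε ^ 2` the parametric rate is dominated by the contamination rate. -/
theorem rpow_neg_quarter_mul_sqrt_log_le {n ε : ℝ} (hn : 0 < n) (hε : 0 < ε)
    (hnε : 1 ≤ n * ε ^ 2) :
    1 ≤ log (exp 1 * n * ε ^ 2) ∧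
      n ^ (-(1 / 4 : ℝ)) * √(log (exp 1 * n * ε ^ 2)) ≤ 2 * √ε := by
  have hlog : log (exp 1 * n * ε ^ 2) = 1 + log (n * ε ^ 2) := by
    rw [mul_assoc, log_mul (exp_pos 1).ne' (by positivity), log_exp]
  have hL : 1 ≤ log (exp 1 * n * ε ^ 2) := by rw [hlog]; linarith [log_nonneg hnε]
  refine ⟨hL, ?_⟩
  set N := n ^ (-(1 / 4 : ℝ)) with hN
  have hNpos : 0 < N := rpow_pos_of_pos hn _
  have hN2 : N ^ 2 = (√n)⁻¹ := by
    rw [hN, ← rpow_natCast, ← rpow_mul hn.le, sqrt_eq_rpow, ← rpow_neg hn.le]; norm_num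
  have hsn : 0 < √n := sqrt_pos.2 hn
  have h1 : log (n * ε ^ 2) ≤ 2 * (√n * ε) - 2 := by
    have h2 : n * ε ^ 2 = (√n * ε) ^ 2 := by rw [mul_pow, sq_sqrt hn.le]
    rw [h2, log_pow]
    have := log_le_sub_one_of_pos (mul_pos hsn hε)
    push_cast; linarith
  refine abs_le_of_sq_le_sq' ?_ (by positivity) |>.2
  rw [mul_pow, mul_pow, sq_sqrt (by linarith), sq_sqrt hε.le, hN2, inv_mul_le_iff₀ hsn, hlog]
  nlinarith [mul_pos hsn hε]

theorem mass_le_ratio {e a lam κ : ℝ} (he : e ∈ Set.Ioo (0 : ℝ) (1 / 2)) (ha : 0 < a)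
    (hlam : lam = 2 * (1 - e) / e) (hκ : κ ≤ e / 2) :
    2 < lam ∧ (1 - e) * (1 + κ) ≤ lam * a / (a + lam * a) := by
  obtain ⟨he0, he1⟩ := he
  have h2 : 2 < lam := by rw [hlam, lt_div_iff₀ he0]; linarith
  refine ⟨h2, ?_⟩
  have h1 : lam * a / (a + lam * a) = 2 * (1 - e) / (2 - e) := by
    have h3 : (0 : ℝ) < 2 - e := by linarith
    have h4 : (e + 2 * (1 - e)) ≠ 0 := by linarith
    rw [show a + lam * a = (1 + lam) * a by ring, mul_div_mul_right _ _ ha.ne',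
      div_eq_div_iff (by linarith) h3.ne', hlam]
    field_simp
    ring
  rw [h1, le_div_iff₀ (by linarith)]
  have h5 : (1 + κ) * (2 - e) ≤ 2 := by nlinarith
  nlinarith

theorem parametric_le_length {δ εmax ε σ lam : ℝ} {n : ℕ} (hδ : δ ∈ Set.Ioo (0 : ℝ) (1 / 4))
    (hεm : εmax ∈ Set.Ioo (0 : ℝ) (1 / 2)) (hε : ε ∈ Set.Icc 0 εmax) (hσ : 0 < σ)
    {l u : (Fin n → ℝ) → ℝ} (hl : Measurable l) (hu : Measurable u) {r : ℝ → ℝ}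
    (hlu : ∀ (θ ε : ℝ), ε ∈ Set.Icc 0 εmax → ∀ Q : Measure ℝ, IsProbabilityMeasure Q →
      ENNReal.ofReal (1 - δ) ≤ iid n (efron θ σ ε Q) {x | l x ≤ θ ∧ θ ≤ u x} ∧
      ENNReal.ofReal (1 - δ) ≤ iid n (efron θ σ ε Q) {x | u x - l x ≤ r ε})
    (hlam : lam = 2 * (1 - εmax) / εmax) (hn : 1 ≤ n) :
    1 / (5 * lam) * (n : ℝ) ^ (-(1 / 4 : ℝ)) * σ ≤ r ε := by
  have hn0 : (0 : ℝ) < n := by exact_mod_cast hn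
  have hn1 : (1 : ℝ) ≤ n := by exact_mod_cast hn
  have hlam2 := (mass_le_ratio (a := 1) (κ := 0) hεm one_pos hlam (by linarith [hεm.1])).1
  have hlam0 : 0 < lam := by linarith
  set a : ℝ := 1 / (5 * lam) with ha
  have ha0 : 0 < a := by positivity
  have hla : lam * a = 1 / 5 := by rw [ha]; field_simp
  set h : ℝ := (n : ℝ) ^ (-(1 / 4 : ℝ)) with hh
  have hh0 : 0 < h := rpow_pos_of_pos hn0 _
  have hh1 : h ≤ 1 := rpow_le_one_of_one_le_of_nonpos hn1 (by norm_num)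
  have hh4 : n * h ^ 4 = 1 := by
    rw [hh, ← rpow_natCast, ← rpow_mul hn0.le]
    norm_num [rpow_neg_one, hn0.ne']
  refine le_length_of_moment_bound hδ hεm hε hσ hl hu hlu 0 (a := a) (b := lam * a) (κ := 0)
    (B := 1) (M := h / 5) (t := ((h / 5) ^ 2)⁻¹) ha0 (by nlinarith) (by linarith) (by simp) hε.1
    (mass_le_ratio hεm ha0 hlam (by linarith [hεm.1])).2 hh0.le ?_ (fun k _ => ?_) ?_
  · exact (one_le_inv₀ (by positivity)).2 (by nlinarith)
  · rw [hla, div_pow, div_pow]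
    simp only [one_pow, add_zero, zero_mul, one_mul]
    exact (mul_one_div _ _).le
  · rw [inv_mul_cancel₀ (by positivity)]
    have h1 : n * (2 * (1 ^ 2 * ((((h / 5) ^ 2)⁻¹) ^ (2 * 0 + 2))⁻¹ * exp 1)) =
        2 / 625 * (n * h ^ 4) * exp 1 := by
      rw [inv_pow, inv_inv]
      ring
    rw [h1, hh4]
    linarith [exp_one_lt_d9]

theorem contamination_le_length {δ εmax ε σ lam C : ℝ} {n : ℕ}
    (hδ : δ ∈ Set.Ioo (0 : ℝ) (1 / 4))
    (hεm : εmax ∈ Set.Ioo (0 : ℝ) (1 / 2)) (hε : ε ∈ Set.Icc 0 εmax) (hσ : 0 < σ)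
    {l u : (Fin n → ℝ) → ℝ} (hl : Measurable l) (hu : Measurable u) {r : ℝ → ℝ}
    (hlu : ∀ (θ ε : ℝ), ε ∈ Set.Icc 0 εmax → ∀ Q : Measure ℝ, IsProbabilityMeasure Q →
      ENNReal.ofReal (1 - δ) ≤ iid n (efron θ σ ε Q) {x | l x ≤ θ ∧ θ ≤ u x} ∧
      ENNReal.ofReal (1 - δ) ≤ iid n (efron θ σ ε Q) {x | u x - l x ≤ r ε})
    (hlam : lam = 2 * (1 - εmax) / εmax) (hC : C = lam / 16 + 1 / 2) (hε0 : 0 < ε)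
    (hnε : 1 ≤ n * ε ^ 2) :
    √(ε / (32 * lam)) / (2 * √((34 * C ^ 2 + 2) * log (exp 1 * n * ε ^ 2))) * σ ≤ r ε := by
  have hn0 : (0 : ℝ) < n := by
    rcases (Nat.cast_nonneg (α := ℝ) n).eq_or_lt with h | h
    · rw [← h] at hnε; norm_num at hnε
    · exact h
  have hL := (rpow_neg_quarter_mul_sqrt_log_le hn0 hε0 hnε).1
  set L := log (exp 1 * n * ε ^ 2) with hLdef
  have hlam2 := (mass_le_ratio (a := 1) (κ := 0) hεm one_pos hlam (by linarith [hεm.1])).1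
  have hlam0 : 0 < lam := by linarith
  have hC0 : 0 < C := by rw [hC]; positivity
  have hlamε : lam * ε ≤ 2 := by
    calc lam * ε ≤ lam * εmax := by gcongr; exact hε.2
      _ = 2 * (1 - εmax) := by rw [hlam]; field_simp [hεm.1.ne']
      _ ≤ 2 := by linarith [hεm.1]
  set a := √(ε / (32 * lam)) with ha
  have ha0 : 0 < a := sqrt_pos.2 (by positivity)
  have ha2 : lam * a ^ 2 = ε / 32 := by rw [ha, sq_sqrt (by positivity)]; field_simp
  set b := lam * a with hb
  have hb0 : 0 < b := by positivity
  have hb2 : b ^ 2 = lam * ε / 32 := by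
    rw [hb, mul_pow, sq lam, mul_assoc, ha2]; ring
  have hb4 : b ≤ 1 / 4 := by
    refine (abs_le_of_sq_le_sq' ?_ (by norm_num)).2
    rw [hb2]; linarith
  set m := ⌈L + 34 * C ^ 2⌉₊ with hm
  have hm1 : L + 34 * C ^ 2 ≤ m := Nat.le_ceil _
  have hm2 : (m : ℝ) < L + 34 * C ^ 2 + 1 := Nat.ceil_lt_add_one (by positivity)
  have hmge : (1 : ℝ) ≤ m := by nlinarith [sq_nonneg C]
  have hmle : (m : ℝ) ≤ (34 * C ^ 2 + 2) * L := by nlinarith [sq_nonneg C]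
  have hsm : 0 < √(m : ℝ) := sqrt_pos.2 (by linarith)
  set κ := 8 * (a * b) * ∑ i ∈ Finset.range m, 1 / (i + 1 : ℝ) ^ 2 with hκ
  have hκ0 : 0 ≤ κ := by positivity
  have hκε : κ ≤ ε / 2 := by
    calc κ ≤ 8 * (a * b) * 2 := by
          rw [hκ]; gcongr; exact sum_range_one_div_sq_le m
      _ = 16 * (lam * a ^ 2) := by rw [hb]; ring
      _ = ε / 2 := by rw [ha2]; ring
  have hε1 : ε < 1 / 2 := hε.2.trans_lt hεm.2
  set h : ℝ := 1 / (2 * √(m : ℝ)) with hh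
  have hh0 : 0 < h := by positivity
  have hhm : √(m : ℝ) / 2 = h * m := by
    rw [hh]
    field_simp
    rw [sq_sqrt (by linarith)]
  have key : a * h * σ ≤ r ε := by
    refine le_length_of_moment_bound hδ hεm hε hσ hl hu hlu m (b := b) (κ := κ) (B := C * ε)
      (M := √m / 2) (t := exp 1) ha0 (by nlinarith) (by linarith) hκ (by linarith)
      (mass_le_ratio hεm ha0 hlam (by linarith [hε.2])).2 hh0.le (one_le_exp zero_le_one)
      (fun k hk => ?_) (mul_exp_tail_le hn0 hε0 hC0 hm1)
    rw [hhm, mul_pow h, mul_left_comm (C * ε)]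
    refine mul_le_mul_of_nonneg_left ?_ (pow_nonneg hh0.le k)
    have hmk : (1 : ℝ) ≤ (m : ℝ) ^ k := one_le_pow₀ hmge
    have hbk : b ^ k ≤ b ^ 2 := pow_le_pow_of_le_one hb0.le (by linarith) (by omega)
    have hbk0 : 0 < b ^ k := by positivity
    calc (1 + κ) * b ^ k + κ * (m : ℝ) ^ k ≤ 2 * b ^ 2 * (m : ℝ) ^ k + ε / 2 * (m : ℝ) ^ k := by
          refine add_le_add ?_ (by gcongr)
          calc (1 + κ) * b ^ k ≤ 2 * b ^ 2 := by gcongr; linarith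
            _ ≤ 2 * b ^ 2 * (m : ℝ) ^ k := le_mul_of_one_le_right (by positivity) hmk
      _ = C * ε * (m : ℝ) ^ k := by rw [hb2, hC]; ring
  refine le_trans ?_ key
  rw [hh, mul_one_div]
  gcongr

/-- Known-variance lower bound (Theorem 5.3): any adaptive confidence interval with
coverage `1-δ` and length `r(ε)` (uniformly over `ε ∈ [0,εmax]` and all adversaries `Q`)
must satisfy `r(ε) ≥ c·σ·(n^{-1/4} + ε^{1/2}/max(1, √(log(e n ε²))))`. -/
theorem knownVariance_lower_bound (δ εmax : ℝ)
    (hδ : δ ∈ Set.Ioo (0:ℝ) (1/4)) (hεm : εmax ∈ Set.Ioo (0:ℝ) (1/2)) :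
    ∃ c : ℝ, 0 < c ∧
      ∀ n : ℕ, 1 ≤ n → ∀ σ : ℝ, 0 < σ →
        ∀ l u : (Fin n → ℝ) → ℝ, Measurable l → Measurable u → (∀ x, l x ≤ u x) →
          ∀ r : ℝ → ℝ, (∀ ε ∈ Set.Icc (0:ℝ) εmax, 0 < r ε) →
            (∀ (θ ε : ℝ), ε ∈ Set.Icc 0 εmax →
              ∀ Q : Measure ℝ, IsProbabilityMeasure Q →
                ENNReal.ofReal (1 - δ) ≤
                    iid n (efron θ σ ε Q) {x | l x ≤ θ ∧ θ ≤ u x} ∧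
                ENNReal.ofReal (1 - δ) ≤
                    iid n (efron θ σ ε Q) {x | u x - l x ≤ r ε}) →
            ∀ ε ∈ Set.Icc (0:ℝ) εmax,
              c * σ * ((n : ℝ) ^ (-(1/4 : ℝ)) +
                  ε ^ ((1:ℝ)/2) /
                    max 1 (Real.sqrt (Real.log (Real.exp 1 * n * ε ^ 2)))) ≤ r ε := by
  set lam := 2 * (1 - εmax) / εmax with hlam
  have hlam0 : 0 < lam :=
    div_pos (by linarith [hεm.2]) hεm.1
  set C := lam / 16 + 1 / 2 with hC
  set D := 6 * √(32 * lam) * √(34 * C ^ 2 + 2) with hD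
  have hD0 : 0 < D := by positivity
  refine ⟨min (1 / (10 * lam)) (1 / D), by positivity, ?_⟩
  intro n hn σ hσ l u hl hu _ r _ hlu ε hε
  have hn0 : (0 : ℝ) < n := by exact_mod_cast hn
  rw [← sqrt_eq_rpow]
  rcases le_or_gt (n * ε ^ 2) 1 with hnε | hnε
  · refine le_trans ?_ (parametric_le_length hδ hεm hε hσ hl hu hlu hlam hn)
    have hN : 0 < (n : ℝ) ^ (-(1 / 4 : ℝ)) := rpow_pos_of_pos hn0 _
    have h1 : √ε ≤ (n : ℝ) ^ (-(1 / 4 : ℝ)) := by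
      have h2 : (n : ℝ) ^ (-(1 / 4 : ℝ)) = √((√n)⁻¹) := by
        rw [sqrt_eq_rpow, sqrt_eq_rpow, ← rpow_neg hn0.le, ← rpow_mul hn0.le]; norm_num
      rw [h2]
      refine sqrt_le_sqrt ?_
      rw [← sqrt_inv]
      refine le_sqrt_of_sq_le ?_
      rw [← one_div, le_div_iff₀ hn0]
      linarith
    have h3 : √ε / max 1 √(log (exp 1 * n * ε ^ 2)) ≤ (n : ℝ) ^ (-(1 / 4 : ℝ)) :=
      (div_le_self (sqrt_nonneg _) (le_max_left _ _)).trans h1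
    calc _ ≤ 1 / (10 * lam) * σ * ((n : ℝ) ^ (-(1 / 4 : ℝ)) + (n : ℝ) ^ (-(1 / 4 : ℝ))) := by
          gcongr
          exact min_le_left _ _
      _ = _ := by field_simp; ring
  · have hε0 : 0 < ε := by
      rcases hε.1.eq_or_lt with h | h
      · rw [← h] at hnε; norm_num at hnε
      · exact h
    refine le_trans ?_ (contamination_le_length hδ hεm hε hσ hl hu hlu hlam hC hε0 hnε.le)
    obtain ⟨hL, hN⟩ := rpow_neg_quarter_mul_sqrt_log_le hn0 hε0 hnε.le
    set L := log (exp 1 * n * ε ^ 2) with hLdef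
    have hsL : 0 < √L := sqrt_pos.2 (by linarith)
    rw [max_eq_right (one_le_sqrt.2 hL), sqrt_div' _ (by positivity),
      sqrt_mul' (34 * C ^ 2 + 2) (by linarith)]
    rw [← le_div_iff₀ hsL] at hN
    calc _ ≤ 1 / D * σ * (2 * √ε / √L + √ε / √L) := by
          gcongr
          exact min_le_right _ _
      _ = _ := by rw [hD]; field_simp; ring
end

section
/- Fix δ ∈ (0,1/4) and εmax ∈ (0,1/3]. There exists a constant c > 0 depending only on δ and εmax such that the following holds for every n ≥ 1. Let (l,u) be any confidence-interval procedure on n samples and r : (0,∞) × [0,εmax] → (0,∞) any function such that for all θ ∈ ℝ, all σ > 0, all ε ∈ [0,εmax], and all probability measures Q on ℝ: P_{θ,σ,ε,Q}^{⊗n}( {x : l(x) ≤ θ ≤ u(x)} ) ≥ 1 − δ and P_{θ,σ,ε,Q}^{⊗n}( {x : u(x) − l(x) ≤ r(σ,ε)} ) ≥ 1 − δ. Then for every σ > 0 and every ε ∈ [0,εmax], r(σ,ε) ≥ c·σ·n^{-1/8}. -/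
open MeasureTheory ProbabilityTheory Real
open scoped ENNReal NNReal

/-- A product of measures with densities has the product density. -/
lemma pi_withDensity_ofReal {ι α : Type*} [Fintype ι] [MeasurableSpace α] (G : Measure α)
    [IsProbabilityMeasure G] {L : α → ℝ} (hL0 : ∀ z, 0 ≤ L z) (hLi : Integrable L G) :
    Measure.pi (fun _ : ι => G.withDensity fun z => ENNReal.ofReal (L z)) =
      (Measure.pi fun _ : ι => G).withDensity fun x => ENNReal.ofReal (∏ i, L (x i)) := by
  have : IsFiniteMeasure (G.withDensity fun z => ENNReal.ofReal (L z)) :=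
    isFiniteMeasure_withDensity_ofReal hLi.2
  refine Measure.pi_eq fun s hs => ?_
  have hnn : ∀ x : ι → α, 0 ≤ ∏ i, L (x i) := fun x => Finset.prod_nonneg fun i _ => hL0 _
  rw [withDensity_apply _ (MeasurableSet.univ_pi hs), Measure.restrict_pi_pi,
    ← ofReal_integral_eq_lintegral_ofReal
      (Integrable.fintype_prod fun i => hLi.mono_measure Measure.restrict_le_self)
      (Filter.Eventually.of_forall hnn),
    integral_fintype_prod_eq_prod (fun _ : ι => L),
    ENNReal.ofReal_prod_of_nonneg fun i _ => integral_nonneg hL0]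
  refine Finset.prod_congr rfl fun i _ => ?_
  rw [withDensity_apply _ (hs i), ofReal_integral_eq_lintegral_ofReal
    (hLi.mono_measure Measure.restrict_le_self) (Filter.Eventually.of_forall hL0)]

/-- If the density `L` of `P` with respect to `G` has second moment at most `1 + χ` with
`(1 + χ)ⁿ ≤ 17/16`, then the `n`-fold products differ by at most `1/4` on every event. -/
lemma pi_real_le_add_quarter {ι α : Type*} [Fintype ι] [MeasurableSpace α] (G : Measure α)
    [IsProbabilityMeasure G] {L : α → ℝ} (hL0 : ∀ z, 0 ≤ L z) (hLi : Integrable L G)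
    (hL1 : ∫ z, L z ∂G = 1) (hL2 : Integrable (fun z => L z ^ 2) G)
    (hχ : (∫ z, L z ^ 2 ∂G) ^ Fintype.card ι ≤ 17 / 16)
    {S : Set (ι → α)} (hS : MeasurableSet S) :
    (Measure.pi fun _ : ι => G).real S ≤
      (Measure.pi fun _ : ι => G.withDensity fun z => ENNReal.ofReal (L z)).real S + 1 / 4 := by
  set μ := Measure.pi fun _ : ι => G
  set F : (ι → α) → ℝ := fun x => ∏ i, L (x i)
  have hF0 : ∀ x, 0 ≤ F x := fun x => Finset.prod_nonneg fun i _ => hL0 _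
  have hFi : Integrable F μ := Integrable.fintype_prod fun _ => hLi
  have hF2 : Integrable (fun x => F x ^ 2) μ := by
    have h := Integrable.fintype_prod (μ := fun _ : ι => G) (f := fun _ z => L z ^ 2) fun _ => hL2
    simpa only [F, Finset.prod_pow] using h
  have hF1 : ∫ x, F x ∂μ = 1 := by
    simp only [F, μ]
    rw [integral_fintype_prod_eq_pow, hL1, one_pow]
  have hF2' : ∫ x, F x ^ 2 ∂μ ≤ 17 / 16 := by
    have h := integral_fintype_prod_eq_pow (ι := ι) (μ := G) (fun z => L z ^ 2)
    simp only [Finset.prod_pow] at h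
    simpa only [F, μ, h] using hχ
  have hP : (Measure.pi fun _ : ι => G.withDensity fun z => ENNReal.ofReal (L z)).real S =
      ∫ x in S, F x ∂μ := by
    rw [pi_withDensity_ofReal G hL0 hLi, measureReal_def, withDensity_apply _ hS,
      ← ofReal_integral_eq_lintegral_ofReal hFi.integrableOn (Filter.Eventually.of_forall hF0),
      ENNReal.toReal_ofReal (integral_nonneg hF0)]
  have hbound : Integrable (fun x => 1 / 8 + 2 * (F x ^ 2 - 2 * F x + 1)) μ := by fun_prop
  have hdiff : μ.real S - ∫ x in S, F x ∂μ = ∫ x in S, (1 - F x) ∂μ := by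
    rw [integral_sub (integrable_const _) hFi.integrableOn]
    simp
  have hle : ∫ x in S, (1 - F x) ∂μ ≤ ∫ x, (1 / 8 + 2 * (F x ^ 2 - 2 * F x + 1)) ∂μ := by
    calc ∫ x in S, (1 - F x) ∂μ ≤ ∫ x in S, (1 / 8 + 2 * (F x ^ 2 - 2 * F x + 1)) ∂μ :=
          integral_mono ((integrable_const _).sub hFi).integrableOn hbound.integrableOn
            fun x => by nlinarith [sq_nonneg (4 * (1 - F x) - 1)]
      _ ≤ _ := setIntegral_le_integral hbound
            (Filter.Eventually.of_forall fun x => by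
              show 0 ≤ _
              nlinarith [sq_nonneg (1 - F x)])
  have hval : ∫ x, (1 / 8 + 2 * (F x ^ 2 - 2 * F x + 1)) ∂μ ≤ 1 / 4 := by
    rw [integral_add (by fun_prop) (by fun_prop), integral_const_mul,
      integral_add (by fun_prop) (by fun_prop), integral_sub hF2 (by fun_prop),
      integral_const_mul, hF1]
    simp
    linarith
  rw [hP]
  linarith

lemma gaussianPDFReal_toNNReal {v : ℝ} (hv : 0 ≤ v) (m z : ℝ) :
    gaussianPDFReal m v.toNNReal z = (√(2 * π * v))⁻¹ * exp (-(z - m) ^ 2 / (2 * v)) := by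
  rw [gaussianPDFReal, Real.coe_toNNReal v hv]

/-- The likelihood-ratio kernel of two Gaussians of variance `1 - h` with means `√h * x`, `√h * y`
relative to the standard Gaussian. -/
noncomputable def mehler (h x y : ℝ) : ℝ :=
  (√(1 - h ^ 2))⁻¹ * exp (h / (1 - h ^ 2) * (x * y - h * (x ^ 2 + y ^ 2) / 2))

lemma gaussianPDFReal_mul_div {σ h : ℝ} (hσ : 0 < σ) (h0 : 0 < h) (h1 : h < 1) (x y z : ℝ) :
    gaussianPDFReal (σ * √h * x) (σ ^ 2 * (1 - h)).toNNReal z *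
        gaussianPDFReal (σ * √h * y) (σ ^ 2 * (1 - h)).toNNReal z /
        gaussianPDFReal 0 (σ ^ 2).toNNReal z =
      mehler h x y * gaussianPDFReal (σ * √h * (x + y) / (1 + h))
        (σ ^ 2 * (1 - h) / (1 + h)).toNNReal z := by
  have h1' : 0 < 1 - h := by linarith
  have h1'' : 0 < 1 + h := by linarith
  have hh : 0 < 1 - h ^ 2 := by nlinarith
  rw [gaussianPDFReal_toNNReal (by positivity), gaussianPDFReal_toNNReal (by positivity),
    gaussianPDFReal_toNNReal (by positivity), gaussianPDFReal_toNNReal (by positivity), mehler]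
  have hsq : √h ^ 2 = h := Real.sq_sqrt h0.le
  have hconst : (√(2 * π * (σ ^ 2 * (1 - h))))⁻¹ * (√(2 * π * (σ ^ 2 * (1 - h))))⁻¹ /
      (√(2 * π * σ ^ 2))⁻¹ = (√(1 - h ^ 2))⁻¹ * (√(2 * π * (σ ^ 2 * (1 - h) / (1 + h))))⁻¹ := by
    rw [← sq_eq_sq₀ (by positivity) (by positivity)]
    simp only [div_pow, mul_pow, inv_pow]
    rw [Real.sq_sqrt (by positivity), Real.sq_sqrt (by positivity), Real.sq_sqrt (by positivity),
      Real.sq_sqrt (by positivity), show 1 - h ^ 2 = (1 - h) * (1 + h) by ring]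
    field_simp
  have hexp : exp (-(z - σ * √h * x) ^ 2 / (2 * (σ ^ 2 * (1 - h)))) *
      exp (-(z - σ * √h * y) ^ 2 / (2 * (σ ^ 2 * (1 - h)))) / exp (-(z - 0) ^ 2 / (2 * σ ^ 2)) =
      exp (h / (1 - h ^ 2) * (x * y - h * (x ^ 2 + y ^ 2) / 2)) *
        exp (-(z - σ * √h * (x + y) / (1 + h)) ^ 2 / (2 * (σ ^ 2 * (1 - h) / (1 + h)))) := by
    rw [← exp_add, ← exp_sub, ← exp_add]
    congr 1
    rw [show 1 - h ^ 2 = (1 - h) * (1 + h) by ring]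
    generalize √h = r at hsq
    subst hsq
    field_simp
    ring
  calc _ = ((√(2 * π * (σ ^ 2 * (1 - h))))⁻¹ * (√(2 * π * (σ ^ 2 * (1 - h))))⁻¹ /
        (√(2 * π * σ ^ 2))⁻¹) * (exp (-(z - σ * √h * x) ^ 2 / (2 * (σ ^ 2 * (1 - h)))) *
        exp (-(z - σ * √h * y) ^ 2 / (2 * (σ ^ 2 * (1 - h)))) /
        exp (-(z - 0) ^ 2 / (2 * σ ^ 2))) := by ring
    _ = _ := by rw [hconst, hexp]; ring

lemma exp_le_quartic {u : ℝ} (hu : |u| ≤ 1) :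
    exp u ≤ 1 + u + u ^ 2 / 2 + u ^ 3 / 6 + u ^ 4 := by
  have h := (abs_le.1 (Real.exp_bound hu (n := 4) (by norm_num))).2
  have h4 : |u| ^ 4 = u ^ 4 := by
    rw [← abs_pow, abs_of_nonneg (by positivity)]
  simp only [Finset.sum_range_succ, Finset.sum_range_zero, Nat.factorial, h4] at h
  norm_num at h
  nlinarith [sq_nonneg (u ^ 2)]

lemma inv_sqrt_one_sub_sq_le {h : ℝ} (h0 : 0 ≤ h) (h1 : h ≤ 1 / 2) :
    (√(1 - h ^ 2))⁻¹ ≤ 1 + h ^ 2 / 2 + h ^ 4 := by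
  have hz : h ^ 2 ≤ 1 / 4 := by nlinarith
  have hz0 : 0 ≤ h ^ 2 := by positivity
  rw [inv_le_comm₀ (Real.sqrt_pos.2 (by linarith)) (by positivity)]
  refine Real.le_sqrt_of_sq_le ?_
  rw [inv_pow, inv_le_comm₀ (by positivity) (by linarith), inv_le_iff_one_le_mul₀ (by linarith)]
  have : h ^ 4 = (h ^ 2) ^ 2 := by ring
  rw [this]
  generalize h ^ 2 = z at *
  have e : (1 + z / 2 + z ^ 2) ^ 2 * (1 - z) =
      1 + z ^ 2 * (5 / 4 * (1 - z) - z ^ 3) := by ring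
  rw [e]
  have : z ^ 3 ≤ 1 / 4 := by nlinarith [pow_le_pow_left₀ hz0 hz 3]
  nlinarith [mul_nonneg (sq_nonneg z) (show 0 ≤ 5 / 4 * (1 - z) - z ^ 3 by linarith)]

lemma sum_cubic_eq_moments (w y : Fin 3 → ℝ) (k h E : ℝ) :
    ∑ i, ∑ j, w i * w j * (1 + (k * (y i * y j - h * (y i ^ 2 + y j ^ 2) / 2)) +
      (k * (y i * y j - h * (y i ^ 2 + y j ^ 2) / 2)) ^ 2 / 2 +
      (k * (y i * y j - h * (y i ^ 2 + y j ^ 2) / 2)) ^ 3 / 6 + E) =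
    (∑ i, w i) ^ 2 * (1 + E) +
    k * ((∑ i, w i * y i) ^ 2 - h * (∑ i, w i * y i ^ 2) * ∑ i, w i) +
    k ^ 2 / 2 * ((∑ i, w i * y i ^ 2) ^ 2 - 2 * h * (∑ i, w i * y i ^ 3) * (∑ i, w i * y i) +
      h ^ 2 / 2 * ((∑ i, w i * y i ^ 4) * (∑ i, w i) + (∑ i, w i * y i ^ 2) ^ 2)) +
    k ^ 3 / 6 * ((∑ i, w i * y i ^ 3) ^ 2 -
      3 * h * (∑ i, w i * y i ^ 4) * (∑ i, w i * y i ^ 2) +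
      3 * h ^ 2 / 2 * ((∑ i, w i * y i ^ 5) * (∑ i, w i * y i) + (∑ i, w i * y i ^ 3) ^ 2) -
      h ^ 3 / 4 * ((∑ i, w i * y i ^ 6) * (∑ i, w i) +
        3 * (∑ i, w i * y i ^ 4) * (∑ i, w i * y i ^ 2))) := by
  simp only [Fin.sum_univ_three]
  ring

lemma sum_exp_le_of_moments (w y : Fin 3 → ℝ) (hw : ∀ i, 0 ≤ w i) (m0 : ∑ i, w i = 1)
    (m1 : ∑ i, w i * y i = 0) (m2 : ∑ i, w i * y i ^ 2 = 1) (m3 : ∑ i, w i * y i ^ 3 = 0)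
    {k h b : ℝ} (hk : 0 ≤ k) (hh : 0 ≤ h) (hb : b ≤ 1)
    (hu : ∀ i j, |k * (y i * y j - h * (y i ^ 2 + y j ^ 2) / 2)| ≤ b) :
    ∑ i, ∑ j, w i * w j * exp (k * (y i * y j - h * (y i ^ 2 + y j ^ 2) / 2)) ≤
      1 - k * h + k ^ 2 / 2 + k ^ 2 * h ^ 2 * ((∑ i, w i * y i ^ 4) + 1) / 4 + b ^ 4 := by
  have hpoint : ∀ i j, w i * w j * exp (k * (y i * y j - h * (y i ^ 2 + y j ^ 2) / 2)) ≤
      w i * w j * (1 + (k * (y i * y j - h * (y i ^ 2 + y j ^ 2) / 2)) +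
        (k * (y i * y j - h * (y i ^ 2 + y j ^ 2) / 2)) ^ 2 / 2 +
        (k * (y i * y j - h * (y i ^ 2 + y j ^ 2) / 2)) ^ 3 / 6 + b ^ 4) := by
    intro i j
    have hij := hu i j
    generalize k * (y i * y j - h * (y i ^ 2 + y j ^ 2) / 2) = u at hij ⊢
    refine mul_le_mul_of_nonneg_left ?_ (mul_nonneg (hw i) (hw j))
    have h4 : u ^ 4 ≤ b ^ 4 := by
      have := pow_le_pow_left₀ (abs_nonneg _) hij 4
      rwa [← abs_pow, abs_of_nonneg (by positivity)] at this
    linarith [exp_le_quartic (hij.trans hb)]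
  refine (Finset.sum_le_sum fun i _ => Finset.sum_le_sum fun j _ => hpoint i j).trans ?_
  have hm4 : 0 ≤ ∑ i, w i * y i ^ 4 :=
    Finset.sum_nonneg fun i _ => mul_nonneg (hw i) (by positivity)
  have hm6 : 0 ≤ ∑ i, w i * y i ^ 6 :=
    Finset.sum_nonneg fun i _ => mul_nonneg (hw i) (by positivity)
  rw [sum_cubic_eq_moments, m0, m1, m2, m3]
  generalize ∑ i, w i * y i ^ 4 = a at *
  generalize ∑ i, w i * y i ^ 6 = c at *
  have hcube : 0 ≤ k ^ 3 / 6 * (3 * h * a + h ^ 3 / 4 * (c + 3 * a)) := by positivity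
  linarith

lemma one_sub_add_sq_div_two_le {h k m b : ℝ} (h0 : 0 < h) (h1 : h ≤ 1 / 4)
    (hk : k * (1 - h ^ 2) = h) (hk0 : 0 < k) (hk2 : k ≤ 2 * h) (hm : 0 ≤ m) :
    1 - k * h + k ^ 2 / 2 + k ^ 2 * h ^ 2 * (m + 1) / 4 + b ≤
      1 - h ^ 2 / 2 + (2 + m) * h ^ 4 + b := by
  have hsmall : k ^ 2 ≤ 4 * h ^ 2 := by nlinarith
  have hquad : k ^ 2 / 2 - k * h ≤ -(h ^ 2) / 2 + h ^ 4 := by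
    have e : k ^ 2 / 2 - k * h = (k ^ 2 * h ^ 4 - h ^ 2) / 2 := by
      have h2 : k - h = k * h ^ 2 := by linarith
      have h3 : (k - h) ^ 2 = (k * h ^ 2) ^ 2 := by rw [h2]
      linarith
    have : k ^ 2 ≤ 1 := by nlinarith
    have : k ^ 2 * h ^ 4 ≤ 1 * h ^ 4 := by gcongr
    have : 0 ≤ h ^ 4 := by positivity
    rw [e]
    linarith
  have hquart : k ^ 2 * h ^ 2 * (m + 1) / 4 ≤ h ^ 4 * (m + 1) := by
    calc k ^ 2 * h ^ 2 * (m + 1) / 4 ≤ 4 * h ^ 2 * h ^ 2 * (m + 1) / 4 := by gcongr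
      _ = h ^ 4 * (m + 1) := by ring
  linarith

lemma quartic_mul_le {h D : ℝ} (hh : h ^ 2 ≤ 1 / 4) (hD : 0 ≤ D) :
    (1 + h ^ 2 / 2 + h ^ 4) * (1 - h ^ 2 / 2 + D * h ^ 4) ≤ 1 + (3 * D + 1) * h ^ 4 := by
  have hz0 : 0 ≤ h ^ 2 := by positivity
  have e : (1 + h ^ 2 / 2 + h ^ 4) * (1 - h ^ 2 / 2 + D * h ^ 4) =
      1 + (D + 3 / 4 + h ^ 2 * (D - 1) / 2 + D * (h ^ 2 * h ^ 2)) * h ^ 4 := by ring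
  rw [e]
  have h4 : 0 ≤ h ^ 4 := by positivity
  generalize h ^ 2 = z at *
  have hb : D + 3 / 4 + z * (D - 1) / 2 + D * (z * z) ≤ 3 * D + 1 := by
    nlinarith [mul_nonneg hD hz0, mul_nonneg hD (sub_nonneg.2 hh), mul_nonneg hz0 hz0,
      mul_nonneg (mul_nonneg hD hz0) (sub_nonneg.2 hh)]
  linarith [mul_le_mul_of_nonneg_right hb h4]

/-- If `w, y` is a three-atom law matching the first three moments of the standard Gaussian, then
the chi-square divergence between its Gaussian smoothing and the Gaussian is of order `h⁴`. -/
lemma exists_sum_mehler_le (w y : Fin 3 → ℝ) (hw : ∀ i, 0 ≤ w i) (m0 : ∑ i, w i = 1)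
    (m1 : ∑ i, w i * y i = 0) (m2 : ∑ i, w i * y i ^ 2 = 1) (m3 : ∑ i, w i * y i ^ 3 = 0) :
    ∃ C : ℝ, 0 < C ∧ ∃ h₁ : ℝ, 0 < h₁ ∧ h₁ ≤ 1 / 2 ∧ ∀ h : ℝ, 0 < h → h ≤ h₁ →
      ∑ i, ∑ j, w i * w j * mehler h (y i) (y j) ≤ 1 + C * h ^ 4 := by
  obtain ⟨Y, hY⟩ : ∃ Y : ℝ, ∀ i, |y i| ≤ Y :=
    ⟨∑ i, |y i|, fun i => Finset.single_le_sum (fun j _ => abs_nonneg (y j)) (Finset.mem_univ i)⟩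
  have hm4 : 0 ≤ ∑ i, w i * y i ^ 4 :=
    Finset.sum_nonneg fun i _ => mul_nonneg (hw i) (by positivity)
  obtain ⟨B, hB⟩ : ∃ B, B = 4 * (Y ^ 2 + 1) := ⟨_, rfl⟩
  have hB4 : 4 ≤ B := by nlinarith
  refine ⟨3 * (2 + (∑ i, w i * y i ^ 4) + B ^ 4) + 1, by positivity, 1 / B, by positivity, ?_, ?_⟩
  · rw [div_le_div_iff₀ (by positivity) (by positivity)]
    linarith
  intro h h0 hh
  have hBh : B * h ≤ 1 := by
    rw [le_div_iff₀ (by positivity)] at hh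
    linarith
  have hh2 : h ≤ 1 / 4 := by nlinarith
  have hden : 0 < 1 - h ^ 2 := by nlinarith
  obtain ⟨k, hk⟩ : ∃ k, k = h / (1 - h ^ 2) := ⟨_, rfl⟩
  have hk0 : 0 < k := hk ▸ div_pos h0 hden
  have hkden : k * (1 - h ^ 2) = h := by rw [hk]; field_simp
  have hk2 : k ≤ 2 * h := by
    rw [hk, div_le_iff₀ hden]
    nlinarith
  have hu : ∀ i j, |k * (y i * y j - h * (y i ^ 2 + y j ^ 2) / 2)| ≤ B * h := by
    intro i j
    have hq : ∀ i, y i ^ 2 ≤ Y ^ 2 := fun i => sq_le_sq' (abs_le.1 (hY i)).1 (abs_le.1 (hY i)).2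
    have hin : |y i * y j - h * (y i ^ 2 + y j ^ 2) / 2| ≤ 2 * Y ^ 2 := by
      have hs : h * ((y i ^ 2 + y j ^ 2) / 2) ≤ 1 * Y ^ 2 :=
        mul_le_mul (by linarith) (by linarith [hq i, hq j]) (by positivity) (by norm_num)
      have hs0 : 0 ≤ h * ((y i ^ 2 + y j ^ 2) / 2) := by positivity
      rw [abs_le]
      constructor <;>
        linarith [hq i, hq j, sq_nonneg (y i + y j), sq_nonneg (y i - y j),
          add_sq (y i) (y j), sub_sq (y i) (y j)]
    rw [abs_mul, abs_of_pos hk0, hB]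
    calc k * |y i * y j - h * (y i ^ 2 + y j ^ 2) / 2| ≤ 2 * h * (2 * Y ^ 2) := by gcongr
      _ ≤ 4 * (Y ^ 2 + 1) * h := by linarith
  have hfactor : ∑ i, ∑ j, w i * w j * mehler h (y i) (y j) = (√(1 - h ^ 2))⁻¹ *
      ∑ i, ∑ j, w i * w j * exp (k * (y i * y j - h * (y i ^ 2 + y j ^ 2) / 2)) := by
    simp only [Finset.mul_sum, mehler, hk]
    refine Finset.sum_congr rfl fun i _ => Finset.sum_congr rfl fun j _ => ?_
    ring
  rw [hfactor]
  refine (mul_le_mul (inv_sqrt_one_sub_sq_le h0.le (by linarith)) ?_ ?_ (by positivity)).trans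
    (quartic_mul_le (D := 2 + (∑ i, w i * y i ^ 4) + B ^ 4) (by nlinarith) (by positivity))
  · refine (sum_exp_le_of_moments w y hw m0 m1 m2 m3 hk0.le h0.le hBh hu).trans
      ((one_sub_add_sq_div_two_le h0 hh2 hkden hk0 hk2 hm4).trans (le_of_eq ?_))
    ring
  · exact Finset.sum_nonneg fun i _ => Finset.sum_nonneg fun j _ =>
      mul_nonneg (mul_nonneg (hw i) (hw j)) (exp_pos _).le

/-- Three-atom laws with an atom of mass at least `1 - e` at a positive point that match the first
three moments of the standard Gaussian. -/
lemma exists_three_atoms {e : ℝ} (he0 : 0 < e) (he1 : e ≤ 1) :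
    ∃ w y : Fin 3 → ℝ, (∀ i, 0 < w i) ∧ 1 - e ≤ w 0 ∧ 0 < y 0 ∧ ∑ i, w i = 1 ∧
      ∑ i, w i * y i = 0 ∧ ∑ i, w i * y i ^ 2 = 1 ∧ ∑ i, w i * y i ^ 3 = 0 := by
  obtain ⟨t, ht⟩ : ∃ t, t = 3 / e := ⟨_, rfl⟩
  have ht3 : 3 ≤ t := by rw [ht, le_div_iff₀ he0]; linarith
  have ht0 : 0 < t := by linarith
  have het : e * t = 3 := by rw [ht]; field_simp
  have hden : 0 < 2 * t ^ 3 + 3 * t ^ 2 - 1 := by nlinarith [pow_pos ht0 3]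
  have ha : 0 < 4 * t ^ 2 - 1 := by nlinarith
  have hb : 0 < t ^ 2 - 1 := by nlinarith
  obtain ⟨K, hK⟩ : ∃ K, K = 2 * t ^ 3 / (2 * t ^ 3 + 3 * t ^ 2 - 1) := ⟨_, rfl⟩
  have hK0 : 0 < K := hK ▸ div_pos (by positivity) hden
  obtain ⟨p, hp⟩ : ∃ p, p = K * (4 * t ^ 2 - 1) / (3 * t ^ 3) := ⟨_, rfl⟩
  obtain ⟨q, hq⟩ : ∃ q, q = K * (t ^ 2 - 1) / (6 * t ^ 3) := ⟨_, rfl⟩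
  have hp0 : 0 < p := hp ▸ by positivity
  have hq0 : 0 < q := hq ▸ by positivity
  obtain ⟨V, hV⟩ : ∃ V, V = K + p * t ^ 2 + 4 * q * t ^ 2 := ⟨_, rfl⟩
  have hV0 : 0 < V := by rw [hV]; positivity
  have hsq : √V ^ 2 = V := Real.sq_sqrt hV0.le
  have hr : 0 < √V := Real.sqrt_pos.2 hV0
  refine ⟨![K, p, q], ![1 / √V, -t / √V, 2 * t / √V], ?_, ?_, ?_, ?_, ?_, ?_, ?_⟩
  · intro i
    fin_cases i <;> simp [hK0, hp0, hq0]
  · simp only [Matrix.cons_val_zero]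
    rw [hK, le_div_iff₀ hden]
    have : e * t ^ 3 = 3 * t ^ 2 := by rw [← het]; ring
    have : e * t ^ 2 = 3 * t := by rw [← het]; ring
    nlinarith
  · simp only [Matrix.cons_val_zero]
    positivity
  · simp only [Fin.sum_univ_three, Matrix.cons_val]
    have hK' : K * (2 * t ^ 3 + 3 * t ^ 2 - 1) = 2 * t ^ 3 := by
      rw [hK, div_mul_cancel₀ _ hden.ne']
    rw [hp, hq]
    field_simp
    linarith
  · simp only [Fin.sum_univ_three, Matrix.cons_val]
    rw [hp, hq]
    field_simp
    ring
  · simp only [Fin.sum_univ_three, Matrix.cons_val, div_pow, hsq]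
    field_simp
    rw [hV]
    ring
  · simp only [Fin.sum_univ_three, Matrix.cons_val]
    rw [hp, hq]
    field_simp
    ring

lemma integrable_gaussianReal_iff {m : ℝ} {v : ℝ≥0} (hv : v ≠ 0) {f : ℝ → ℝ} :
    Integrable f (gaussianReal m v) ↔ Integrable (fun z => gaussianPDFReal m v z * f z) := by
  rw [gaussianReal_of_var_ne_zero m hv, integrable_withDensity_iff_integrable_smul'
    (measurable_gaussianPDF m v) (Filter.Eventually.of_forall fun _ => gaussianPDF_lt_top)]
  simp [toReal_gaussianPDF]

/-- A finite Gaussian mixture has the expected density relative to a Gaussian. -/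
lemma sum_smul_gaussianReal_eq_withDensity {ι : Type*} [Fintype ι] {w : ι → ℝ}
    (hw : ∀ i, 0 ≤ w i) (m : ι → ℝ) (m₀ : ℝ) {v v₀ : ℝ≥0} (hv : v ≠ 0) (hv₀ : v₀ ≠ 0) :
    ∑ i, ENNReal.ofReal (w i) • gaussianReal (m i) v =
      (gaussianReal m₀ v₀).withDensity fun z =>
        ENNReal.ofReal ((∑ i, w i * gaussianPDFReal (m i) v z) / gaussianPDFReal m₀ v₀ z) := by
  have hmeas : ∀ i, Measurable (gaussianPDFReal (m i) v) :=
    fun i => measurable_gaussianPDFReal _ _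
  have hmeas₀ := measurable_gaussianPDFReal m₀ v₀
  rw [gaussianReal_of_var_ne_zero m₀ hv₀,
    ← withDensity_mul _ (measurable_gaussianPDF m₀ v₀) (by fun_prop)]
  have hfun : (gaussianPDF m₀ v₀ * fun z =>
      ENNReal.ofReal ((∑ i, w i * gaussianPDFReal (m i) v z) / gaussianPDFReal m₀ v₀ z)) =
      fun z => ∑ i, ENNReal.ofReal (w i) * gaussianPDF (m i) v z := by
    ext z
    have h0 := gaussianPDFReal_pos m₀ v₀ z hv₀
    simp only [Pi.mul_apply, gaussianPDF]
    rw [← ENNReal.ofReal_mul h0.le, mul_div_cancel₀ _ h0.ne',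
      ENNReal.ofReal_sum_of_nonneg fun i _ => mul_nonneg (hw i) (gaussianPDFReal_nonneg _ _ _)]
    exact Finset.sum_congr rfl fun i _ => ENNReal.ofReal_mul (hw i)
  rw [hfun]
  ext s hs
  rw [withDensity_apply _ hs, lintegral_finsetSum _
    fun i _ => (measurable_gaussianPDF (m i) v).const_mul _, Measure.finsetSum_apply]
  refine Finset.sum_congr rfl fun i _ => ?_
  rw [lintegral_const_mul _ (measurable_gaussianPDF (m i) v), Measure.smul_apply, smul_eq_mul,
    gaussianReal_apply _ hv]

/-- The two-groups model contains every three-component Gaussian mixture with equal variances. -/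
lemma exists_efron_eq_sum {w : Fin 3 → ℝ} (hw : ∀ i, 0 < w i) (hw1 : ∑ i, w i = 1)
    (m : Fin 3 → ℝ) (s : ℝ) :
    ∃ Q : Measure ℝ, IsProbabilityMeasure Q ∧ efron (m 0) s (1 - w 0) Q =
      ∑ i, ENNReal.ofReal (w i) • gaussianReal (m i) (s ^ 2).toNNReal := by
  have hsum : w 0 + w 1 + w 2 = 1 := by rw [← hw1, Fin.sum_univ_three]
  have he : 0 < 1 - w 0 := by linarith [hw 1, hw 2]
  have hmul : ∀ i, ENNReal.ofReal (1 - w 0) * ENNReal.ofReal (w i / (1 - w 0)) =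
      ENNReal.ofReal (w i) := by
    intro i
    rw [← ENNReal.ofReal_mul he.le, mul_div_cancel₀ _ he.ne']
  refine ⟨ENNReal.ofReal (w 1 / (1 - w 0)) • Measure.dirac (m 1) +
    ENNReal.ofReal (w 2 / (1 - w 0)) • Measure.dirac (m 2), ⟨?_⟩, ?_⟩
  · simp only [Measure.add_apply, Measure.smul_apply, measure_univ, smul_eq_mul, mul_one]
    rw [← ENNReal.ofReal_add (div_pos (hw 1) he).le (div_pos (hw 2) he).le, ← add_div,
      show w 1 + w 2 = 1 - w 0 by linarith, div_self he.ne', ENNReal.ofReal_one]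
  · have hfin : ∀ (c : ℝ) (a : ℝ), IsFiniteMeasure (ENNReal.ofReal c • Measure.dirac a) :=
      fun c a => Measure.smul_finite _ ENNReal.ofReal_ne_top
    simp only [efron, gauss, Fin.sum_univ_three]
    rw [Measure.add_conv, Measure.conv_smul_left, Measure.conv_smul_left, Measure.dirac_conv,
      Measure.dirac_conv, gaussianReal_map_const_add, gaussianReal_map_const_add, smul_add,
      smul_smul, smul_smul, hmul, hmul, sub_sub_cancel, zero_add, zero_add, add_assoc]

lemma efron_dirac_zero {σ ε : ℝ} (h0 : 0 ≤ ε) (h1 : ε ≤ 1) :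
    efron 0 σ ε (Measure.dirac 0) = gaussianReal 0 (σ ^ 2).toNNReal := by
  rw [efron, gauss, Measure.dirac_zero_conv, ← add_smul,
    ← ENNReal.ofReal_add (by linarith) h0, sub_add_cancel, ENNReal.ofReal_one, one_smul]

/-- The density of a three-component mixture relative to `N(0, σ²)` has second moment given by
the kernel `mehler`. -/
lemma mixture_density_moments {σ h : ℝ} (hσ : 0 < σ) (h0 : 0 < h) (h1 : h < 1)
    {w : Fin 3 → ℝ} (hw1 : ∑ i, w i = 1) (y : Fin 3 → ℝ) {L : ℝ → ℝ}
    (hL : L = fun z => (∑ i, w i * gaussianPDFReal (σ * √h * y i) (σ ^ 2 * (1 - h)).toNNReal z) /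
      gaussianPDFReal 0 (σ ^ 2).toNNReal z) :
    Integrable L (gaussianReal 0 (σ ^ 2).toNNReal) ∧
      ∫ z, L z ∂gaussianReal 0 (σ ^ 2).toNNReal = 1 ∧
      Integrable (fun z => L z ^ 2) (gaussianReal 0 (σ ^ 2).toNNReal) ∧
      ∫ z, L z ^ 2 ∂gaussianReal 0 (σ ^ 2).toNNReal =
        ∑ i, ∑ j, w i * w j * mehler h (y i) (y j) := by
  have h1' : 0 < 1 - h := by linarith
  have hv₀ : (σ ^ 2).toNNReal ≠ 0 := (Real.toNNReal_pos.2 (by positivity)).ne'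
  have hv : (σ ^ 2 * (1 - h)).toNNReal ≠ 0 := (Real.toNNReal_pos.2 (by positivity)).ne'
  have hv' : (σ ^ 2 * (1 - h) / (1 + h)).toNNReal ≠ 0 :=
    (Real.toNNReal_pos.2 (by positivity)).ne'
  have hmul : ∀ z, gaussianPDFReal 0 (σ ^ 2).toNNReal z * L z =
      ∑ i, w i * gaussianPDFReal (σ * √h * y i) (σ ^ 2 * (1 - h)).toNNReal z := by
    intro z
    rw [hL]
    exact mul_div_cancel₀ _ (gaussianPDFReal_pos _ _ z hv₀).ne'
  have hmul2 : ∀ z, gaussianPDFReal 0 (σ ^ 2).toNNReal z * L z ^ 2 =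
      ∑ i, ∑ j, w i * w j * mehler h (y i) (y j) *
        gaussianPDFReal (σ * √h * (y i + y j) / (1 + h))
          (σ ^ 2 * (1 - h) / (1 + h)).toNNReal z := by
    intro z
    have hz := (gaussianPDFReal_pos 0 _ z hv₀).ne'
    calc _ = (gaussianPDFReal 0 (σ ^ 2).toNNReal z * L z) *
          (gaussianPDFReal 0 (σ ^ 2).toNNReal z * L z) / gaussianPDFReal 0 (σ ^ 2).toNNReal z := by
          field_simp
      _ = _ := by
          rw [hmul, Finset.sum_mul_sum, Finset.sum_div]
          refine Finset.sum_congr rfl fun i _ => ?_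
          rw [Finset.sum_div]
          refine Finset.sum_congr rfl fun j _ => ?_
          rw [mul_assoc (w i * w j), ← gaussianPDFReal_mul_div hσ h0 h1]
          ring
  have hi : ∀ i, Integrable fun z =>
      w i * gaussianPDFReal (σ * √h * y i) (σ ^ 2 * (1 - h)).toNNReal z :=
    fun i => (integrable_gaussianPDFReal _ _).const_mul _
  have hij : ∀ i j, Integrable fun z => w i * w j * mehler h (y i) (y j) *
      gaussianPDFReal (σ * √h * (y i + y j) / (1 + h))
        (σ ^ 2 * (1 - h) / (1 + h)).toNNReal z :=
    fun i j => (integrable_gaussianPDFReal _ _).const_mul _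
  refine ⟨?_, ?_, ?_, ?_⟩
  · rw [integrable_gaussianReal_iff hv₀]
    simp only [hmul]
    exact integrable_finsetSum _ fun i _ => hi i
  · rw [integral_gaussianReal_eq_integral_smul hv₀]
    simp only [smul_eq_mul, hmul]
    rw [integral_finsetSum _ fun i _ => hi i]
    refine Eq.trans ?_ hw1
    refine Finset.sum_congr rfl fun i _ => ?_
    rw [integral_const_mul, integral_gaussianPDFReal_eq_one _ hv, mul_one]
  · rw [integrable_gaussianReal_iff hv₀]
    simp only [hmul2]
    exact integrable_finsetSum _ fun i _ => integrable_finsetSum _ fun j _ => hij i j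
  · rw [integral_gaussianReal_eq_integral_smul hv₀]
    simp only [smul_eq_mul, hmul2]
    rw [integral_finsetSum _ fun i _ => integrable_finsetSum _ fun j _ => hij i j]
    refine Finset.sum_congr rfl fun i _ => ?_
    rw [integral_finsetSum _ fun j _ => hij i j]
    refine Finset.sum_congr rfl fun j _ => ?_
    rw [integral_const_mul, integral_gaussianPDFReal_eq_one _ hv', mul_one]

/-- A per-sample second moment `1 + O(h⁴)` with `h = h₀ n^{-1/4}` stays bounded over `n` samples. -/
lemma one_add_quartic_pow_le {C h₀ : ℝ} (hC : 0 < C) (h0 : 0 < h₀) (hle : h₀ ≤ 1)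
    (hCh : C * h₀ ≤ 1 / 32) {n : ℕ} (hn : 1 ≤ n) {a : ℝ} (ha0 : 0 ≤ a)
    (ha : a ≤ 1 + C * (h₀ * (n : ℝ) ^ (-(1 / 4 : ℝ))) ^ 4) : a ^ n ≤ 17 / 16 := by
  have hn0 : (0 : ℝ) < n := by exact_mod_cast hn
  have hpow : ((n : ℝ) ^ (-(1 / 4 : ℝ))) ^ 4 = (n : ℝ)⁻¹ := by
    rw [← Real.rpow_natCast, ← Real.rpow_mul hn0.le]
    norm_num
    exact Real.rpow_neg_one _
  have h4 : h₀ ^ 4 ≤ h₀ := pow_le_of_le_one h0.le hle (by norm_num)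
  have hx : a ≤ exp (1 / 32 * (n : ℝ)⁻¹) := by
    refine ha.trans (le_trans ?_ (Real.add_one_le_exp _))
    rw [mul_pow, hpow, ← mul_assoc, add_comm]
    gcongr
    exact (mul_le_mul_of_nonneg_left h4 hC.le).trans hCh
  calc a ^ n ≤ exp (1 / 32 * (n : ℝ)⁻¹) ^ n := by gcongr
    _ = exp (1 / 32) := by
        rw [← Real.exp_nat_mul]
        congr 1
        field_simp
    _ ≤ 1 / (1 - 1 / 32) := Real.exp_bound_div_one_sub_of_interval (by norm_num) (by norm_num)
    _ ≤ 17 / 16 := by norm_num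

lemma measureReal_compl_le {Ω : Type*} [MeasurableSpace Ω] {μ : Measure Ω}
    [IsProbabilityMeasure μ] {δ : ℝ} (hδ : δ ≤ 1) {S : Set Ω} (hS : MeasurableSet S)
    (h : ENNReal.ofReal (1 - δ) ≤ μ S) : μ.real Sᶜ ≤ δ := by
  rw [probReal_compl_eq_one_sub hS]
  have := (ENNReal.ofReal_le_iff_le_toReal (measure_ne_top μ S)).1 h
  rw [measureReal_def]
  linarith

/-- Unknown-variance lower bound (Theorem 5.5), `εmax ∈ (0,1/3]`: any confidence interval
with adaptive coverage `1-δ` over all `θ, σ, ε ∈ [0,εmax], Q` and length `r(σ,ε)` must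
satisfy `r(σ,ε) ≥ c·σ·n^{-1/8}`. -/
theorem unknownVariance_lower_bound (δ εmax : ℝ)
    (hδ : δ ∈ Set.Ioo (0:ℝ) (1/4)) (hεm : εmax ∈ Set.Ioc (0:ℝ) (1/3)) :
    ∃ c : ℝ, 0 < c ∧
      ∀ n : ℕ, 1 ≤ n →
        ∀ l u : (Fin n → ℝ) → ℝ, Measurable l → Measurable u → (∀ x, l x ≤ u x) →
          ∀ r : ℝ → ℝ → ℝ,
            (∀ σ : ℝ, 0 < σ → ∀ ε ∈ Set.Icc (0:ℝ) εmax, 0 < r σ ε) →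
            (∀ (θ σ ε : ℝ), 0 < σ → ε ∈ Set.Icc 0 εmax →
              ∀ Q : Measure ℝ, IsProbabilityMeasure Q →
                ENNReal.ofReal (1 - δ) ≤
                    iid n (efron θ σ ε Q) {x | l x ≤ θ ∧ θ ≤ u x} ∧
                ENNReal.ofReal (1 - δ) ≤
                    iid n (efron θ σ ε Q) {x | u x - l x ≤ r σ ε}) →
            ∀ σ : ℝ, 0 < σ → ∀ ε ∈ Set.Icc (0:ℝ) εmax,
              c * σ * (n : ℝ) ^ (-(1/8 : ℝ)) ≤ r σ ε := by
  obtain ⟨_, hδ1⟩ := hδ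
  obtain ⟨hε0, hε1⟩ := hεm
  obtain ⟨w, y, hw, hwε, hy, m0, m1, m2, m3⟩ := exists_three_atoms hε0 (by linarith)
  obtain ⟨C, hC, h₁, hh₁, hh₁', hbound⟩ :=
    exists_sum_mehler_le w y (fun i => (hw i).le) m0 m1 m2 m3
  obtain ⟨h₀, hh₀⟩ : ∃ h₀, h₀ = min h₁ (1 / (32 * C)) := ⟨_, rfl⟩
  have hh₀0 : 0 < h₀ := hh₀ ▸ lt_min hh₁ (by positivity)
  have hh₀1 : h₀ ≤ h₁ := hh₀ ▸ min_le_left _ _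
  have hCh : C * h₀ ≤ 1 / 32 := by
    calc C * h₀ ≤ C * (1 / (32 * C)) := by
          gcongr
          exact hh₀ ▸ min_le_right _ _
      _ = 1 / 32 := by field_simp
  refine ⟨√h₀ * y 0, by positivity, ?_⟩
  intro n hn l u hl hu _ r _ hCI σ hσ ε hε
  have hn0 : (0 : ℝ) < n := by exact_mod_cast hn
  obtain ⟨h, hh⟩ : ∃ h, h = h₀ * (n : ℝ) ^ (-(1 / 4 : ℝ)) := ⟨_, rfl⟩
  have h0 : 0 < h := by rw [hh]; positivity
  have hle : h ≤ h₁ := by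
    rw [hh]
    refine le_trans (mul_le_of_le_one_right hh₀0.le ?_) hh₀1
    exact Real.rpow_le_one_of_one_le_of_nonpos (by exact_mod_cast hn) (by norm_num)
  have h1 : h < 1 := by linarith
  have h1' : 0 < 1 - h := by linarith
  have hsqrt : √h = √h₀ * (n : ℝ) ^ (-(1 / 8 : ℝ)) := by
    rw [hh, Real.sqrt_mul hh₀0.le, Real.sqrt_eq_rpow ((n : ℝ) ^ _), ← Real.rpow_mul hn0.le]
    norm_num
  obtain ⟨θ, hθ⟩ : ∃ θ, θ = σ * √h * y 0 := ⟨_, rfl⟩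
  have hgoal : √h₀ * y 0 * σ * (n : ℝ) ^ (-(1 / 8 : ℝ)) = θ := by
    rw [hθ, hsqrt]
    ring
  rw [hgoal]
  have hs : (σ * √(1 - h)) ^ 2 = σ ^ 2 * (1 - h) := by rw [mul_pow, Real.sq_sqrt h1'.le]
  have hs0 : 0 < σ * √(1 - h) := mul_pos hσ (Real.sqrt_pos.2 h1')
  have hv₀ : (σ ^ 2).toNNReal ≠ 0 := (Real.toNNReal_pos.2 (by positivity)).ne'
  have hv : (σ ^ 2 * (1 - h)).toNNReal ≠ 0 := (Real.toNNReal_pos.2 (by positivity)).ne'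
  obtain ⟨Q, hQ, hQeq⟩ := exists_efron_eq_sum hw m0 (fun i => σ * √h * y i) (σ * √(1 - h))
  rw [hs, sum_smul_gaussianReal_eq_withDensity (fun i => (hw i).le) _ 0 hv hv₀] at hQeq
  obtain ⟨L, hL⟩ : ∃ L : ℝ → ℝ, L = fun z =>
    (∑ i, w i * gaussianPDFReal (σ * √h * y i) (σ ^ 2 * (1 - h)).toNNReal z) /
      gaussianPDFReal 0 (σ ^ 2).toNNReal z := ⟨_, rfl⟩
  have hQL : efron θ (σ * √(1 - h)) (1 - w 0) Q =
      (gaussianReal 0 (σ ^ 2).toNNReal).withDensity fun z => ENNReal.ofReal (L z) := by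
    rw [hθ, hL, hQeq]
  obtain ⟨hLi, hL1, hL2i, hL2⟩ := mixture_density_moments hσ h0 h1 m0 y hL
  have hL0 : ∀ z, 0 ≤ L z := fun z => hL ▸ div_nonneg
    (Finset.sum_nonneg fun i _ => mul_nonneg (hw i).le (gaussianPDFReal_nonneg _ _ _))
    (gaussianPDFReal_nonneg _ _ _)
  have hχ : (∫ z, L z ^ 2 ∂gaussianReal 0 (σ ^ 2).toNNReal) ^ Fintype.card (Fin n) ≤ 17 / 16 := by
    rw [Fintype.card_fin]
    refine one_add_quartic_pow_le hC hh₀0 (by linarith) hCh hn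
      (integral_nonneg fun z => sq_nonneg _) ?_
    rw [hL2, ← hh]
    exact hbound h h0 hle
  have hmeas : ∀ a : ℝ, MeasurableSet {x | l x ≤ a ∧ a ≤ u x} := fun a =>
    (measurableSet_le hl measurable_const).inter (measurableSet_le measurable_const hu)
  have hmeas' : MeasurableSet {x | u x - l x ≤ r σ ε} :=
    measurableSet_le (hu.sub hl) measurable_const
  have hnull := hCI 0 σ ε hσ hε (Measure.dirac 0) inferInstance
  rw [efron_dirac_zero hε.1 (by linarith [hε.2])] at hnull
  have w0 : w 0 ≤ 1 := by
    rw [← m0]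
    exact Finset.single_le_sum (fun i _ => (hw i).le) (Finset.mem_univ 0)
  have halt := (hCI θ (σ * √(1 - h)) (1 - w 0) hs0 ⟨by linarith, by linarith⟩ Q hQ).1
  rw [hQL] at halt
  have hprob : IsProbabilityMeasure
      ((gaussianReal 0 (σ ^ 2).toNNReal).withDensity fun z => ENNReal.ofReal (L z)) :=
    ⟨by rw [withDensity_apply _ .univ, Measure.restrict_univ,
      ← ofReal_integral_eq_lintegral_ofReal hLi (Filter.Eventually.of_forall hL0), hL1,
      ENNReal.ofReal_one]⟩
  simp only [iid] at hnull halt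
  have hA := measureReal_compl_le (by linarith) (hmeas 0) hnull.1
  have hB := measureReal_compl_le (by linarith) hmeas' hnull.2
  have hP := measureReal_compl_le (by linarith) (hmeas θ) halt
  have hD := pi_real_le_add_quarter (ι := Fin n) _ hL0 hLi hL1 hL2i hχ (hmeas θ).compl
  by_contra! hlt
  have hcover : (Set.univ : Set (Fin n → ℝ)) ⊆ ({x | l x ≤ 0 ∧ 0 ≤ u x}ᶜ ∪
      {x | u x - l x ≤ r σ ε}ᶜ) ∪ {x | l x ≤ θ ∧ θ ≤ u x}ᶜ := by
    intro x _
    by_contra hx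
    simp only [Set.mem_union, Set.mem_compl_iff, Set.mem_ofPred_eq, not_or, not_not] at hx
    linarith [hx.1.1.1, hx.1.2, hx.2.2]
  have hone := measureReal_mono (μ := Measure.pi fun _ : Fin n => gaussianReal 0 (σ ^ 2).toNNReal)
    hcover
  rw [probReal_univ] at hone
  have hun := measureReal_union_le (μ := Measure.pi fun _ : Fin n => gaussianReal 0 (σ ^ 2).toNNReal)
    ({x | l x ≤ 0 ∧ 0 ≤ u x}ᶜ ∪ {x | u x - l x ≤ r σ ε}ᶜ) {x | l x ≤ θ ∧ θ ≤ u x}ᶜ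
  have hun' := measureReal_union_le
    (μ := Measure.pi fun _ : Fin n => gaussianReal 0 (σ ^ 2).toNNReal)
    {x | l x ≤ 0 ∧ 0 ≤ u x}ᶜ {x | u x - l x ≤ r σ ε}ᶜ
  linarith
end

section
/- Fix δ ∈ (0,1/4) and εmax ∈ (1/3, 1/2). There exists a constant c > 0 depending only on δ and εmax such that the following holds for every n ≥ 1. Let (l,u) be any confidence-interval procedure on n samples and r : (0,∞) × [0,εmax] → (0,∞) any function such that for all θ ∈ ℝ, all σ > 0, all ε ∈ [0,εmax], and all probability measures Q on ℝ: P_{θ,σ,ε,Q}^{⊗n}( {x : l(x) ≤ θ ≤ u(x)} ) ≥ 1 − δ and P_{θ,σ,ε,Q}^{⊗n}( {x : u(x) − l(x) ≤ r(σ,ε)} ) ≥ 1 − δ. Then for all σ > 0 and ε ∈ [0,εmax]: r(σ,ε) ≥ c·σ·n^{-1/16} if εmax ∈ (1/3, 7/15], and r(σ,ε) ≥ c·σ·n^{-1/24} if εmax ∈ (7/15, 1/2). -/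
open MeasureTheory ProbabilityTheory Real
open scoped ENNReal NNReal

theorem lintegral_pi_prod {n : ℕ} (P : Measure ℝ) [IsProbabilityMeasure P] (f : Fin n → ℝ → ℝ≥0∞)
    (hf : ∀ i, Measurable (f i)) :
    ∫⁻ x, ∏ i, f i (x i) ∂(Measure.pi fun _ : Fin n => P) = ∏ i, ∫⁻ x, f i x ∂P := by
  rw [lintegral_prod_eq_prod_lintegral_of_indepFun (Finset.univ)
    (fun (i : Fin n) (x : Fin n → ℝ) => f i (x i))
    (iIndepFun_pi fun i => (hf i).aemeasurable)
    (fun i => (hf i).comp (measurable_pi_apply i))]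
  refine Finset.prod_congr rfl fun i _ => ?_
  exact (measurePreserving_eval (fun _ : Fin n => P) i).lintegral_comp (hf i)

theorem pi_withDensity {n : ℕ} (P : Measure ℝ) [IsProbabilityMeasure P] (f : ℝ → ℝ≥0∞)
    (hf : Measurable f) [IsProbabilityMeasure (P.withDensity f)] :
    Measure.pi (fun _ : Fin n => P.withDensity f) =
      (Measure.pi fun _ : Fin n => P).withDensity fun x => ∏ i, f (x i) := by
  refine Measure.pi_eq fun s hs => ?_
  rw [withDensity_apply _ (MeasurableSet.univ_pi hs),
    ← lintegral_indicator (MeasurableSet.univ_pi hs)]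
  have : (Set.univ.pi s).indicator (fun x : Fin n → ℝ => ∏ i, f (x i)) =
      fun x => ∏ i, (s i).indicator f (x i) := by
    funext x
    by_cases hx : x ∈ Set.univ.pi s
    · rw [Set.indicator_of_mem hx]
      exact Finset.prod_congr rfl fun i _ => (Set.indicator_of_mem (hx i trivial) f).symm
    · rw [Set.indicator_of_notMem hx]
      simp only [Set.mem_pi, Set.mem_univ, true_imp_iff, not_forall] at hx
      obtain ⟨i, hi⟩ := hx
      exact (Finset.prod_eq_zero (Finset.mem_univ i) (Set.indicator_of_notMem hi f)).symm
  rw [this, lintegral_pi_prod P (fun i => (s i).indicator f) fun i => hf.indicator (hs i)]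
  refine Finset.prod_congr rfl fun i _ => ?_
  rw [withDensity_apply _ (hs i), lintegral_indicator (hs i)]

/-- A small chi-square divergence forces the product measures to be close on events of moderate
probability. -/
theorem pi_withDensity_lt {n : ℕ} (P : Measure ℝ) [IsProbabilityMeasure P] (f : ℝ → ℝ≥0∞)
    (hf : Measurable f) [IsProbabilityMeasure (P.withDensity f)]
    {a : ℝ} (ha : 0 ≤ a) (hna : n * a ≤ 9 / 100)
    (h2 : ∫⁻ x, f x ^ 2 ∂P ≤ ENNReal.ofReal (1 + a))
    {A : Set (Fin n → ℝ)} (hA : MeasurableSet A)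
    (hPA : Measure.pi (fun _ : Fin n => P) A ≤ ENNReal.ofReal (1 / 2)) :
    Measure.pi (fun _ : Fin n => P.withDensity f) A < ENNReal.ofReal (3 / 4) := by
  have hpt : ∀ t : ℝ≥0∞, t ≤ ENNReal.ofReal (3 / 8) * t ^ 2 + ENNReal.ofReal (2 / 3) := by
    intro t
    induction t with
    | top => simp
    | coe t =>
      rw [← ENNReal.ofReal_coe_nnreal, ← ENNReal.ofReal_pow t.coe_nonneg,
        ← ENNReal.ofReal_mul (by norm_num), ← ENNReal.ofReal_add (by positivity) (by norm_num)]
      exact ENNReal.ofReal_le_ofReal (by nlinarith [sq_nonneg (3 * (t : ℝ) - 4)])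
  have hpow : (1 + a) ^ n ≤ 11 / 10 := by
    calc (1 + a) ^ n ≤ (rexp a) ^ n := by
          gcongr; linarith [Real.add_one_le_exp a]
      _ = rexp (n * a) := by rw [← Real.exp_nat_mul]
      _ ≤ rexp (9 / 100) := Real.exp_le_exp.2 hna
      _ ≤ 11 / 10 := by
          have h := Real.add_one_le_exp (-(9 / 100 : ℝ))
          rw [Real.exp_neg] at h
          have hp := Real.exp_pos (9 / 100)
          have : (91 / 100) * rexp (9 / 100) ≤ 1 := by
            calc (91 / 100) * rexp (9 / 100) ≤ (rexp (9 / 100))⁻¹ * rexp (9 / 100) := by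
                  gcongr; linarith
              _ = 1 := inv_mul_cancel₀ hp.ne'
          linarith
  have hmeas : Measurable fun x : Fin n → ℝ => ∏ i, f (x i) :=
    Finset.measurable_fun_prod _ fun i _ => hf.comp (measurable_pi_apply i)
  rw [pi_withDensity P f hf, withDensity_apply _ hA]
  calc ∫⁻ x in A, ∏ i, f (x i) ∂(Measure.pi fun _ : Fin n => P)
      ≤ ∫⁻ x in A, (ENNReal.ofReal (3 / 8) * (∏ i, f (x i)) ^ 2 + ENNReal.ofReal (2 / 3))
          ∂(Measure.pi fun _ : Fin n => P) := lintegral_mono fun x => hpt _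
    _ = ENNReal.ofReal (3 / 8) * ∫⁻ x in A, (∏ i, f (x i)) ^ 2 ∂(Measure.pi fun _ : Fin n => P)
          + ENNReal.ofReal (2 / 3) * Measure.pi (fun _ : Fin n => P) A := by
        rw [lintegral_add_right _ measurable_const, lintegral_const_mul _ (hmeas.pow_const 2)]
        simp
    _ ≤ ENNReal.ofReal (3 / 8) * ENNReal.ofReal (11 / 10)
          + ENNReal.ofReal (2 / 3) * ENNReal.ofReal (1 / 2) := by
        gcongr
        calc ∫⁻ x in A, (∏ i, f (x i)) ^ 2 ∂(Measure.pi fun _ : Fin n => P)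
            ≤ ∫⁻ x, ∏ i, (f (x i)) ^ 2 ∂(Measure.pi fun _ : Fin n => P) := by
              simp_rw [Finset.prod_pow]
              exact setLIntegral_le_lintegral _ _
          _ = (∫⁻ x, f x ^ 2 ∂P) ^ n := by
              rw [lintegral_pi_prod P (fun _ x => f x ^ 2) fun _ => hf.pow_const 2]
              simp
          _ ≤ ENNReal.ofReal (1 + a) ^ n := by gcongr
          _ = ENNReal.ofReal ((1 + a) ^ n) := (ENNReal.ofReal_pow (by linarith) n).symm
          _ ≤ ENNReal.ofReal (11 / 10) := ENNReal.ofReal_le_ofReal hpow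
    _ < ENNReal.ofReal (3 / 4) := by
        rw [← ENNReal.ofReal_mul (by norm_num), ← ENNReal.ofReal_mul (by norm_num),
          ← ENNReal.ofReal_add (by norm_num) (by norm_num)]
        exact (ENNReal.ofReal_lt_ofReal_iff (by norm_num)).2 (by norm_num)

/-- Two-point lower bound: an interval that covers the centers of two nearly indistinguishable
models is at least as long as the distance between the centers. -/
theorem dist_le_of_coverage {n : ℕ} (P : Measure ℝ) [IsProbabilityMeasure P] (f : ℝ → ℝ≥0∞)
    (hf : Measurable f) [IsProbabilityMeasure (P.withDensity f)]
    {a : ℝ} (ha : 0 ≤ a) (hna : n * a ≤ 9 / 100)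
    (h2 : ∫⁻ x, f x ^ 2 ∂P ≤ ENNReal.ofReal (1 + a))
    {δ : ℝ} (hδ : δ ∈ Set.Ioo (0 : ℝ) (1 / 4)) {l u : (Fin n → ℝ) → ℝ}
    (hl : Measurable l) (hu : Measurable u) {θ₀ θ₁ ρ : ℝ}
    (h₀ : ENNReal.ofReal (1 - δ) ≤ Measure.pi (fun _ : Fin n => P) {x | l x ≤ θ₀ ∧ θ₀ ≤ u x})
    (hρ : ENNReal.ofReal (1 - δ) ≤ Measure.pi (fun _ : Fin n => P) {x | u x - l x ≤ ρ})
    (h₁ : ENNReal.ofReal (1 - δ) ≤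
      Measure.pi (fun _ : Fin n => P.withDensity f) {x | l x ≤ θ₁ ∧ θ₁ ≤ u x}) :
    θ₁ - θ₀ ≤ ρ := by
  by_contra! hlt
  have hm : ∀ θ : ℝ, MeasurableSet {x | l x ≤ θ ∧ θ ≤ u x} := fun θ =>
    (measurableSet_le hl measurable_const).inter (measurableSet_le measurable_const hu)
  have hmρ : MeasurableSet {x | u x - l x ≤ ρ} := measurableSet_le (hu.sub hl) measurable_const
  have hcompl : ∀ s : Set (Fin n → ℝ), MeasurableSet s →
      ENNReal.ofReal (1 - δ) ≤ Measure.pi (fun _ : Fin n => P) s →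
      Measure.pi (fun _ : Fin n => P) sᶜ ≤ ENNReal.ofReal δ := by
    intro s hs h
    rw [prob_compl_eq_one_sub hs, tsub_le_iff_left]
    calc (1 : ℝ≥0∞) = ENNReal.ofReal (1 - δ) + ENNReal.ofReal δ := by
          rw [← ENNReal.ofReal_add (by linarith [hδ.2]) hδ.1.le]; simp
      _ ≤ _ := by gcongr
  have hsub : {x | l x ≤ θ₁ ∧ θ₁ ≤ u x} ⊆ {x | l x ≤ θ₀ ∧ θ₀ ≤ u x}ᶜ ∪ {x | u x - l x ≤ ρ}ᶜ := by
    rintro x ⟨hx, hx'⟩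
    by_contra hc
    simp only [Set.mem_union, Set.mem_compl_iff, Set.mem_ofPred_eq, not_or, not_not] at hc
    linarith [hc.1.1, hc.2]
  have hle : Measure.pi (fun _ : Fin n => P) {x | l x ≤ θ₁ ∧ θ₁ ≤ u x} ≤ ENNReal.ofReal (1 / 2) :=
    calc _ ≤ _ := measure_mono hsub
      _ ≤ _ := measure_union_le _ _
      _ ≤ ENNReal.ofReal δ + ENNReal.ofReal δ := by
        gcongr
        exacts [hcompl _ (hm _) h₀, hcompl _ hmρ hρ]
      _ ≤ ENNReal.ofReal (1 / 2) := by
        rw [← ENNReal.ofReal_add hδ.1.le hδ.1.le]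
        exact ENNReal.ofReal_le_ofReal (by linarith [hδ.2])
  refine absurd (h₁.trans_lt (pi_withDensity_lt P f hf ha hna h2 (hm θ₁) hle)) (not_lt.2 ?_)
  exact ENNReal.ofReal_le_ofReal (by linarith [hδ.2])

/-- The density of `gaussianReal a v` with respect to `gaussianReal 0 v`, where `a = b * v`. -/
noncomputable def shiftDensity (v b x : ℝ) : ℝ := rexp (b * x - v * b ^ 2 / 2)

/-- The density of `gaussianReal 0 (v * (1 + u))` with respect to `gaussianReal 0 v`. -/
noncomputable def scaleDensity (v u x : ℝ) : ℝ :=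
  (√(1 + u))⁻¹ * rexp (x ^ 2 / (2 * v) - x ^ 2 / (2 * (v * (1 + u))))

theorem gaussianReal_shift {v : ℝ} (hv : 0 < v) (b : ℝ) :
    gaussianReal (b * v) v.toNNReal =
      (gaussianReal 0 v.toNNReal).withDensity fun x => ENNReal.ofReal (shiftDensity v b x) := by
  have hv' : v.toNNReal ≠ 0 := by simpa using hv
  rw [gaussianReal_of_var_ne_zero _ hv', gaussianReal_of_var_ne_zero _ hv', ← withDensity_mul _
    (measurable_gaussianPDF _ _) (by unfold shiftDensity; fun_prop)]
  congr 1
  funext x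
  simp only [Pi.mul_apply, gaussianPDF, gaussianPDFReal, shiftDensity, Real.coe_toNNReal v hv.le]
  rw [← ENNReal.ofReal_mul (by positivity), mul_assoc (_)⁻¹, ← Real.exp_add]
  congr 3
  field_simp
  ring

theorem gaussianReal_scale {v q : ℝ} (hv : 0 < v) (hq : 0 < q) :
    gaussianReal 0 q.toNNReal =
      (gaussianReal 0 v.toNNReal).withDensity fun x =>
        ENNReal.ofReal ((√(q / v))⁻¹ * rexp (x ^ 2 / (2 * v) - x ^ 2 / (2 * q))) := by
  have hv' : v.toNNReal ≠ 0 := by simpa using hv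
  have hq' : q.toNNReal ≠ 0 := by simpa using hq
  rw [gaussianReal_of_var_ne_zero _ hv', gaussianReal_of_var_ne_zero _ hq', ← withDensity_mul _
    (measurable_gaussianPDF _ _) (by fun_prop)]
  congr 1
  funext x
  simp only [Pi.mul_apply, gaussianPDF, gaussianPDFReal, Real.coe_toNNReal v hv.le,
    Real.coe_toNNReal q hq.le]
  rw [← ENNReal.ofReal_mul (by positivity)]
  congr 1
  have h1 : √(2 * π * q) = √(2 * π * v) * √(q / v) := by
    rw [← Real.sqrt_mul (by positivity)]
    congr 1
    field_simp
  have h2 : rexp (-(x - 0) ^ 2 / (2 * q)) =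
      rexp (-(x - 0) ^ 2 / (2 * v)) * rexp (x ^ 2 / (2 * v) - x ^ 2 / (2 * q)) := by
    rw [← Real.exp_add]
    congr 1
    ring
  rw [h1, h2, mul_inv]
  ring

theorem gaussianReal_eq_scaleDensity {v u : ℝ} (hv : 0 < v) (hu : 0 < u) :
    gaussianReal 0 (v * (1 + u)).toNNReal =
      (gaussianReal 0 v.toNNReal).withDensity fun x => ENNReal.ofReal (scaleDensity v u x) := by
  rw [gaussianReal_scale hv (by positivity : 0 < v * (1 + u))]
  simp only [scaleDensity]
  rw [mul_div_cancel_left₀ _ hv.ne']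

theorem scaleDensity_ge {v u : ℝ} (hv : 0 < v) (hu : 0 < u) (x : ℝ) :
    (√(1 + u))⁻¹ ≤ scaleDensity v u x := by
  unfold scaleDensity
  refine le_mul_of_one_le_right (by positivity) (Real.one_le_exp (sub_nonneg.2 ?_))
  gcongr
  nlinarith

theorem scaleDensity_pos {v u : ℝ} (hv : 0 < v) (hu : 0 < u) (x : ℝ) : 0 < scaleDensity v u x :=
  lt_of_lt_of_le (by positivity) (scaleDensity_ge hv hu x)

theorem measurable_scaleDensity (v u : ℝ) : Measurable (scaleDensity v u) := by
  unfold scaleDensity; fun_prop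

theorem integral_gaussianReal_exp (q : ℝ≥0) (b : ℝ) :
    ∫ x, rexp (b * x) ∂(gaussianReal 0 q) = rexp (q * b ^ 2 / 2) := by
  have h := congrFun (mgf_id_gaussianReal (μ := 0) (v := q)) b
  simpa [mgf] using h

theorem integral_shiftDensity {v q : ℝ} (hq : 0 ≤ q) (b : ℝ) :
    ∫ x, shiftDensity v b x ∂(gaussianReal 0 q.toNNReal) = rexp ((q - v) * b ^ 2 / 2) := by
  simp only [shiftDensity, Real.exp_sub, integral_div, integral_gaussianReal_exp,
    Real.coe_toNNReal q hq]
  rw [← Real.exp_sub]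
  congr 1
  ring

theorem integral_shiftDensity_mul {v : ℝ} (hv : 0 < v) (b b' : ℝ) :
    ∫ x, shiftDensity v b x * shiftDensity v b' x ∂(gaussianReal 0 v.toNNReal) =
      rexp (v * b * b') := by
  have : ∀ x, shiftDensity v b x * shiftDensity v b' x =
      rexp (v * b * b') * shiftDensity v (b + b') x := by
    intro x
    simp only [shiftDensity, ← Real.exp_add]
    congr 1
    ring
  simp_rw [this, integral_const_mul, integral_shiftDensity hv.le]
  simp

theorem integral_mul_scaleDensity {v u : ℝ} (hv : 0 < v) (hu : 0 < u) (g : ℝ → ℝ) :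
    ∫ x, g x * scaleDensity v u x ∂(gaussianReal 0 v.toNNReal) =
      ∫ x, g x ∂(gaussianReal 0 (v * (1 + u)).toNNReal) := by
  rw [gaussianReal_eq_scaleDensity hv hu, integral_withDensity_eq_integral_toReal_smul
    (measurable_scaleDensity v u).ennreal_ofReal (by simp)]
  refine integral_congr_ae (ae_of_all _ fun x => ?_)
  simp [ENNReal.toReal_ofReal (scaleDensity_pos hv hu x).le, mul_comm]

theorem integral_shiftDensity_mul_scaleDensity {v u : ℝ} (hv : 0 < v) (hu : 0 < u) (b : ℝ) :
    ∫ x, shiftDensity v b x * scaleDensity v u x ∂(gaussianReal 0 v.toNNReal) =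
      rexp (v * u * b ^ 2 / 2) := by
  rw [integral_mul_scaleDensity hv hu, integral_shiftDensity (by positivity)]
  congr 1
  ring

theorem integral_scaleDensity {v u : ℝ} (hv : 0 < v) (hu : 0 < u) :
    ∫ x, scaleDensity v u x ∂(gaussianReal 0 v.toNNReal) = 1 := by
  simpa using integral_mul_scaleDensity hv hu (fun _ => 1)

theorem integral_scaleDensity_sq {v u : ℝ} (hv : 0 < v) (hu : 0 < u) (hu1 : u < 1) :
    ∫ x, scaleDensity v u x * scaleDensity v u x ∂(gaussianReal 0 v.toNNReal) =
      (√(1 - u ^ 2))⁻¹ := by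
  have hu' : 0 < 1 - u := by linarith
  have hq : 0 < v * (1 + u) / (1 - u) := by positivity
  have h1 : ∫ x, (√(v * (1 + u) / (1 - u) / v))⁻¹ *
      rexp (x ^ 2 / (2 * v) - x ^ 2 / (2 * (v * (1 + u) / (1 - u))))
        ∂(gaussianReal 0 v.toNNReal) = 1 := by
    have h := congrArg (fun μ : Measure ℝ => μ Set.univ) (gaussianReal_scale hv hq)
    simp only [measure_univ, withDensity_apply _ MeasurableSet.univ, Measure.restrict_univ] at h
    rw [integral_eq_lintegral_of_nonneg_ae (ae_of_all _ fun x => by positivity)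
      (by fun_prop)]
    exact (congrArg ENNReal.toReal h.symm).trans (by simp)
  have h2 : ∀ x, scaleDensity v u x * scaleDensity v u x = (√(1 - u ^ 2))⁻¹ *
      ((√(v * (1 + u) / (1 - u) / v))⁻¹ *
      rexp (x ^ 2 / (2 * v) - x ^ 2 / (2 * (v * (1 + u) / (1 - u))))) := by
    intro x
    have e1 : (√(1 - u ^ 2))⁻¹ * (√(v * (1 + u) / (1 - u) / v))⁻¹ =
        (√(1 + u))⁻¹ * (√(1 + u))⁻¹ := by
      rw [← mul_inv, ← mul_inv, ← Real.sqrt_mul (by nlinarith), ← Real.sqrt_mul (by positivity)]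
      congr 2
      field_simp
      ring
    rw [← mul_assoc, e1]
    unfold scaleDensity
    rw [mul_mul_mul_comm, ← Real.exp_add]
    congr 2
    field_simp
    ring
  rw [integral_congr_ae (ae_of_all _ h2), integral_const_mul, h1, mul_one]

theorem shiftDensity_pos (v b x : ℝ) : 0 < shiftDensity v b x := Real.exp_pos _

section Mixture

variable {ι : Type*} [Fintype ι]

theorem withDensity_mixture {v : ℝ} (hv : 0 < v) (w b : ι → ℝ) (hw : ∀ i, 0 ≤ w i) :
    (gaussianReal 0 v.toNNReal).withDensity
        (fun x => ENNReal.ofReal (∑ i, w i * shiftDensity v (b i) x)) =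
      ∑ i, ENNReal.ofReal (w i) • gaussianReal (b i * v) v.toNNReal := by
  have hm : ∀ i, Measurable fun x => ENNReal.ofReal (shiftDensity v (b i) x) := fun i => by
    unfold shiftDensity; fun_prop
  ext s hs
  rw [withDensity_apply _ hs, Measure.finsetSum_apply]
  simp_rw [Measure.smul_apply, gaussianReal_shift hv, withDensity_apply _ hs, smul_eq_mul,
    ← lintegral_const_mul _ (hm _)]
  rw [← lintegral_finsetSum _ fun i _ => (hm i).const_mul _]
  refine lintegral_congr fun x => ?_
  rw [ENNReal.ofReal_sum_of_nonneg fun i _ => mul_nonneg (hw i) (shiftDensity_pos v (b i) x).le]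
  exact Finset.sum_congr rfl fun i _ => ENNReal.ofReal_mul (hw i)

theorem withDensity_ratio {v u : ℝ} (hv : 0 < v) (hu : 0 < u) (g : ℝ → ℝ) (hg : Measurable g) :
    (gaussianReal 0 (v * (1 + u)).toNNReal).withDensity
        (fun x => ENNReal.ofReal (g x / scaleDensity v u x)) =
      (gaussianReal 0 v.toNNReal).withDensity fun x => ENNReal.ofReal (g x) := by
  have hm := measurable_scaleDensity v u
  have hr : Measurable fun x => ENNReal.ofReal (g x / scaleDensity v u x) :=
    (hg.div hm).ennreal_ofReal
  rw [gaussianReal_eq_scaleDensity hv hu, ← withDensity_mul _ hm.ennreal_ofReal hr]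
  congr 1
  funext x
  have hp := scaleDensity_pos hv hu x
  rw [Pi.mul_apply, ← ENNReal.ofReal_mul hp.le, mul_div_cancel₀ _ hp.ne']

theorem integrable_shiftDensity_mul {v : ℝ} (hv : 0 < v) (b b' : ℝ) :
    Integrable (fun x => shiftDensity v b x * shiftDensity v b' x) (gaussianReal 0 v.toNNReal) :=
  .of_integral_ne_zero (by rw [integral_shiftDensity_mul hv]; positivity)

theorem integrable_shiftDensity_mul_scaleDensity {v u : ℝ} (hv : 0 < v) (hu : 0 < u) (b : ℝ) :
    Integrable (fun x => shiftDensity v b x * scaleDensity v u x) (gaussianReal 0 v.toNNReal) :=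
  .of_integral_ne_zero (by rw [integral_shiftDensity_mul_scaleDensity hv hu]; positivity)

/-- The squared distance in `L²(gaussianReal 0 v)` between the mixture of Gaussian densities with
weights `w` at the rescaled nodes `y` and the density of a Gaussian of variance `v * (1 + u)`. -/
noncomputable def mixtureGap (w y : ι → ℝ) (u : ℝ) : ℝ :=
  (∑ i, ∑ j, w i * w j * rexp (u * (y i * y j))) - 2 * (∑ i, w i * rexp (u ^ 2 * y i ^ 2 / 2)) +
    (√(1 - u ^ 2))⁻¹

/-- Bound on the second moment of the likelihood ratio by `mixtureGap`. -/
theorem lintegral_ratio_sq_le {v u : ℝ} (hv : 0 < v) (hu : 0 < u) (hu1 : u < 1) (w y : ι → ℝ)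
    (hw1 : ∑ i, w i = 1) :
    ∫⁻ x, ENNReal.ofReal ((∑ i, w i * shiftDensity v (y i * √(u / v)) x) /
        scaleDensity v u x) ^ 2 ∂(gaussianReal 0 (v * (1 + u)).toNNReal) ≤
      ENNReal.ofReal (1 + √(1 + u) * mixtureGap w y u) := by
  set ν := gaussianReal 0 v.toNNReal with hν
  set b : ι → ℝ := fun i => y i * √(u / v) with hb
  set f : ℝ → ℝ := fun x => ∑ i, w i * shiftDensity v (b i) x with hf
  set g := scaleDensity v u with hg
  have hsq : √(u / v) * √(u / v) = u / v := Real.mul_self_sqrt (by positivity)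
  have hgpos : ∀ x, 0 < g x := scaleDensity_pos hv hu
  have hgm : Measurable g := measurable_scaleDensity v u
  have hfm : Measurable f := by simp only [hf, shiftDensity]; fun_prop
  have hff : ∀ x, f x * f x = ∑ i, ∑ j, w i * w j * (shiftDensity v (b i) x *
      shiftDensity v (b j) x) := by
    intro x
    simp only [hf, Finset.sum_mul_sum]
    exact Finset.sum_congr rfl fun i _ => Finset.sum_congr rfl fun j _ => by ring
  have hfg : ∀ x, f x * g x = ∑ i, w i * (shiftDensity v (b i) x * g x) := by
    intro x
    simp only [hf, Finset.sum_mul, mul_assoc]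
  have If1 : ∀ i, Integrable (fun x => shiftDensity v (b i) x) ν := fun i => by
    simpa [shiftDensity] using integrable_shiftDensity_mul hv (b i) 0
  have If : Integrable f ν := integrable_finsetSum _ fun i _ => (If1 i).const_mul _
  have Iff : Integrable (fun x => f x * f x) ν := by
    simp_rw [hff]
    exact integrable_finsetSum _ fun i _ => integrable_finsetSum _ fun j _ =>
      (integrable_shiftDensity_mul hv _ _).const_mul _
  have Ifg : Integrable (fun x => f x * g x) ν := by
    simp_rw [hfg]
    exact integrable_finsetSum _ fun i _ =>
      (integrable_shiftDensity_mul_scaleDensity hv hu _).const_mul _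
  have Ig : Integrable g ν := .of_integral_ne_zero (by rw [integral_scaleDensity hv hu]; simp)
  have Igg : Integrable (fun x => g x * g x) ν := .of_integral_ne_zero (by
    rw [integral_scaleDensity_sq hv hu hu1]
    have : 0 < 1 - u ^ 2 := by nlinarith
    positivity)
  have Ef : ∫ x, f x ∂ν = 1 := by
    simp only [hf]
    rw [integral_finsetSum _ fun i _ => (If1 i).const_mul _]
    simp_rw [integral_const_mul, hν, integral_shiftDensity hv.le]
    simpa using hw1
  have Eff : ∫ x, f x * f x ∂ν = ∑ i, ∑ j, w i * w j * rexp (u * (y i * y j)) := by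
    simp_rw [hff]
    rw [integral_finsetSum _ fun i _ => integrable_finsetSum _ fun j _ =>
      (integrable_shiftDensity_mul hv _ _).const_mul _]
    refine Finset.sum_congr rfl fun i _ => ?_
    rw [integral_finsetSum _ fun j _ => (integrable_shiftDensity_mul hv _ _).const_mul _]
    refine Finset.sum_congr rfl fun j _ => ?_
    rw [integral_const_mul, integral_shiftDensity_mul hv]
    congr 2
    calc v * (y i * √(u / v)) * (y j * √(u / v)) = v * (√(u / v) * √(u / v)) * (y i * y j) := by
          ring
      _ = u * (y i * y j) := by rw [hsq, mul_div_cancel₀ _ hv.ne']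
  have Efg : ∫ x, f x * g x ∂ν = ∑ i, w i * rexp (u ^ 2 * y i ^ 2 / 2) := by
    simp_rw [hfg]
    rw [integral_finsetSum _ fun i _ =>
      (integrable_shiftDensity_mul_scaleDensity hv hu _).const_mul _]
    refine Finset.sum_congr rfl fun i _ => ?_
    rw [integral_const_mul, integral_shiftDensity_mul_scaleDensity hv hu]
    congr 2
    calc v * u * (y i * √(u / v)) ^ 2 / 2 = v * (√(u / v) * √(u / v)) * u * y i ^ 2 / 2 := by
          ring
      _ = u ^ 2 * y i ^ 2 / 2 := by rw [hsq, mul_div_cancel₀ _ hv.ne']; ring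
  have hpt : ∀ x, f x ^ 2 / g x ≤
      √(1 + u) * (f x * f x - 2 * (f x * g x) + g x * g x) + (2 * f x - g x) := by
    intro x
    have hinv : (g x)⁻¹ ≤ √(1 + u) := inv_le_of_inv_le₀ (by positivity) (scaleDensity_ge hv hu x)
    have : f x ^ 2 / g x = (g x)⁻¹ * (f x - g x) ^ 2 + (2 * f x - g x) := by
      have := (hgpos x).ne'
      field_simp
      ring
    rw [this]
    have h := mul_le_mul_of_nonneg_right hinv (sq_nonneg (f x - g x))
    linarith [h, show √(1 + u) * (f x - g x) ^ 2 =
      √(1 + u) * (f x * f x - 2 * (f x * g x) + g x * g x) by ring]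
  have Isub : Integrable (fun x => f x * f x - 2 * (f x * g x)) ν := Iff.sub (Ifg.const_mul 2)
  have Isq : Integrable (fun x => f x * f x - 2 * (f x * g x) + g x * g x) ν :=
    Isub.add Igg
  have Ilin : Integrable (fun x => 2 * f x - g x) ν := (If.const_mul 2).sub Ig
  have Isum : Integrable (fun x => √(1 + u) * (f x * f x - 2 * (f x * g x) + g x * g x) +
      (2 * f x - g x)) ν := (Isq.const_mul _).add Ilin
  have hr : Measurable fun x => ENNReal.ofReal (f x / g x) ^ 2 :=
    (hfm.div hgm).ennreal_ofReal.pow_const 2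
  change ∫⁻ x, ENNReal.ofReal (f x / g x) ^ 2 ∂_ ≤ _
  rw [gaussianReal_eq_scaleDensity hv hu, lintegral_withDensity_eq_lintegral_mul _
    hgm.ennreal_ofReal hr]
  calc ∫⁻ x, ((fun x => ENNReal.ofReal (g x)) * fun x => ENNReal.ofReal (f x / g x) ^ 2) x ∂ν
      ≤ ∫⁻ x, ENNReal.ofReal (√(1 + u) * (f x * f x - 2 * (f x * g x) + g x * g x) +
          (2 * f x - g x)) ∂ν := by
        refine lintegral_mono fun x => ?_
        have h0 := hgpos x
        refine le_trans ?_ (ENNReal.ofReal_le_ofReal (hpt x))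
        by_cases hx : 0 ≤ f x
        · rw [Pi.mul_apply, ← ENNReal.ofReal_pow (by positivity), ← ENNReal.ofReal_mul h0.le]
          refine ENNReal.ofReal_le_ofReal (le_of_eq ?_)
          field_simp
        · rw [Pi.mul_apply, ENNReal.ofReal_of_nonpos (div_nonpos_of_nonpos_of_nonneg
            (not_le.1 hx).le h0.le)]
          simp
    _ = ENNReal.ofReal (1 + √(1 + u) * mixtureGap w y u) := by
        rw [← ofReal_integral_eq_lintegral_ofReal Isum
          (ae_of_all _ fun x => le_trans (div_nonneg (sq_nonneg _) (hgpos x).le) (hpt x))]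
        congr 1
        rw [integral_add (Isq.const_mul _) Ilin, integral_const_mul,
          integral_add Isub Igg, integral_sub Iff (Ifg.const_mul 2),
          integral_sub (If.const_mul 2) Ig, integral_const_mul, integral_const_mul, Eff, Efg, Ef,
          integral_scaleDensity_sq hv hu hu1, integral_scaleDensity hv hu, mixtureGap]
        ring

end Mixture

/-- The moments of the standard Gaussian distribution. -/
noncomputable def gaussMoment (k : ℕ) : ℝ :=
  if Even k then (k.factorial : ℝ) / (2 ^ (k / 2) * (k / 2).factorial) else 0

theorem gaussMoment_even (l : ℕ) :
    gaussMoment (2 * l) = ((2 * l).factorial : ℝ) / (2 ^ l * l.factorial) := by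
  simp [gaussMoment]

theorem gaussMoment_odd (l : ℕ) : gaussMoment (2 * l + 1) = 0 := by
  simp [gaussMoment]

/-- The coefficients of the Taylor series of `(1 - x)^(-1/2)`. -/
noncomputable def invSqrtCoeff (l : ℕ) : ℝ :=
  ((2 * l).factorial : ℝ) / (4 ^ l * (l.factorial : ℝ) ^ 2)

theorem sum_range_two_mul (f : ℕ → ℝ) (L : ℕ) :
    ∑ k ∈ Finset.range (2 * L), f k = ∑ l ∈ Finset.range L, (f (2 * l) + f (2 * l + 1)) := by
  induction L with
  | zero => simp
  | succ L ih =>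
    rw [Nat.mul_succ, Finset.sum_range_succ, Finset.sum_range_succ, Finset.sum_range_succ, ih]
    ring

theorem exp_le_sum_add (x : ℝ) (n : ℕ) :
    rexp x ≤ ∑ k ∈ Finset.range n, x ^ k / k.factorial + |x| ^ n * rexp |x| := by
  have h := Complex.norm_exp_sub_sum_le_norm_mul_exp x n
  have e : Complex.exp x - ∑ k ∈ Finset.range n, (x : ℂ) ^ k / k.factorial =
      ((rexp x - ∑ k ∈ Finset.range n, x ^ k / k.factorial : ℝ) : ℂ) := by
    push_cast; rfl
  rw [e, Complex.norm_real, Complex.norm_real, Real.norm_eq_abs, Real.norm_eq_abs] at h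
  linarith [le_abs_self (rexp x - ∑ k ∈ Finset.range n, x ^ k / k.factorial)]

theorem mixtureGap_le {ι : Type*} [Fintype ι] (w y : ι → ℝ) (hw : ∀ i, 0 ≤ w i) (L : ℕ)
    (hmom : ∀ k < 2 * L, ∑ i, w i * y i ^ k = gaussMoment k) {C : ℝ} (hC : 0 ≤ C)
    (hinv : ∀ x : ℝ, 0 ≤ x → x ≤ 1 / 4 →
      (√(1 - x))⁻¹ ≤ ∑ l ∈ Finset.range L, invSqrtCoeff l * x ^ l + C * x ^ L) :
    ∃ C' : ℝ, 0 ≤ C' ∧ ∀ u : ℝ, 0 < u → u ≤ 1 / 2 → mixtureGap w y u ≤ C' * u ^ (2 * L) := by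
  refine ⟨(∑ i, ∑ j, w i * w j * (|y i * y j| ^ (2 * L) * rexp |y i * y j|)) + C,
    add_nonneg (Finset.sum_nonneg fun i _ => Finset.sum_nonneg fun j _ =>
      mul_nonneg (mul_nonneg (hw i) (hw j)) (by positivity)) hC, fun u hu hu' => ?_⟩
  have h1 : ∑ i, ∑ j, w i * w j * rexp (u * (y i * y j)) ≤
      ∑ l ∈ Finset.range L, invSqrtCoeff l * (u ^ 2) ^ l +
        (∑ i, ∑ j, w i * w j * (|y i * y j| ^ (2 * L) * rexp |y i * y j|)) * u ^ (2 * L) := by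
    calc ∑ i, ∑ j, w i * w j * rexp (u * (y i * y j))
        ≤ ∑ i, ∑ j, w i * w j * (∑ k ∈ Finset.range (2 * L), (u * (y i * y j)) ^ k / k.factorial +
            |y i * y j| ^ (2 * L) * rexp |y i * y j| * u ^ (2 * L)) := by
          refine Finset.sum_le_sum fun i _ => Finset.sum_le_sum fun j _ => ?_
          refine mul_le_mul_of_nonneg_left ?_ (mul_nonneg (hw i) (hw j))
          refine (exp_le_sum_add _ (2 * L)).trans (add_le_add_right ?_ _)
          rw [abs_mul, abs_of_pos hu, mul_pow, mul_comm (u ^ _), mul_right_comm]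
          gcongr
          exact mul_le_of_le_one_left (abs_nonneg _) (by linarith)
      _ = (∑ k ∈ Finset.range (2 * L), u ^ k / k.factorial * (∑ i, w i * y i ^ k) ^ 2) +
            (∑ i, ∑ j, w i * w j * (|y i * y j| ^ (2 * L) * rexp |y i * y j|)) * u ^ (2 * L) := by
          simp_rw [mul_add, Finset.sum_add_distrib, Finset.sum_mul]
          congr 1
          · simp_rw [sq, Finset.sum_mul_sum, Finset.mul_sum]
            rw [Finset.sum_congr rfl fun i _ => Finset.sum_comm, Finset.sum_comm]
            refine Finset.sum_congr rfl fun k _ => Finset.sum_congr rfl fun i _ =>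
              Finset.sum_congr rfl fun j _ => ?_
            rw [mul_pow, mul_pow]
            ring
          · exact Finset.sum_congr rfl fun i _ => Finset.sum_congr rfl fun j _ => by ring
      _ = _ := by
          congr 1
          rw [sum_range_two_mul]
          refine Finset.sum_congr rfl fun l hl => ?_
          have hl' := Finset.mem_range.1 hl
          rw [hmom _ (by omega), hmom _ (by omega), gaussMoment_even, gaussMoment_odd, invSqrtCoeff,
            show (4 : ℝ) ^ l = 2 ^ l * 2 ^ l by rw [← mul_pow]; norm_num, ← pow_mul]
          have : ((2 * l).factorial : ℝ) ≠ 0 := by positivity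
          field_simp
          simp
  have h2 : ∑ l ∈ Finset.range L, invSqrtCoeff l * (u ^ 2) ^ l ≤
      ∑ i, w i * rexp (u ^ 2 * y i ^ 2 / 2) := by
    calc ∑ l ∈ Finset.range L, invSqrtCoeff l * (u ^ 2) ^ l
        = ∑ l ∈ Finset.range L, (u ^ 2 / 2) ^ l / l.factorial * ∑ i, w i * y i ^ (2 * l) := by
          refine Finset.sum_congr rfl fun l hl => ?_
          have hl' := Finset.mem_range.1 hl
          rw [hmom _ (by omega), gaussMoment_even, invSqrtCoeff,
            show (4 : ℝ) = 2 ^ 2 by norm_num, ← pow_mul]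
          field_simp
          rw [div_pow, pow_mul 2 2 l, sq (2 : ℝ), mul_pow]
          field_simp
      _ = ∑ i, w i * ∑ l ∈ Finset.range L, (u ^ 2 * y i ^ 2 / 2) ^ l / l.factorial := by
          simp_rw [Finset.mul_sum]
          rw [Finset.sum_comm]
          refine Finset.sum_congr rfl fun i _ => Finset.sum_congr rfl fun l _ => ?_
          ring
      _ ≤ _ := Finset.sum_le_sum fun i _ =>
          mul_le_mul_of_nonneg_left (Real.sum_le_exp_of_nonneg (by positivity) L) (hw i)
  have h3 := hinv (u ^ 2) (sq_nonneg u) (by nlinarith)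
  rw [mixtureGap, add_mul, pow_mul u 2 L] at *
  linarith

theorem inv_sqrt_le_of {x t : ℝ} (hx : x < 1) (ht : 0 < t) (h : 1 ≤ (1 - x) * t ^ 2) :
    (√(1 - x))⁻¹ ≤ t := by
  have h0 : 0 < 1 - x := by linarith
  rw [← Real.sqrt_inv, Real.sqrt_le_left ht.le]
  exact (inv_le_iff_one_le_mul₀' h0).2 h

theorem inv_sqrt_le_four (x : ℝ) (hx : 0 ≤ x) (hx' : x ≤ 1 / 4) :
    (√(1 - x))⁻¹ ≤ ∑ l ∈ Finset.range 4, invSqrtCoeff l * x ^ l + 10 * x ^ 4 := by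
  simp only [Finset.sum_range_succ, invSqrtCoeff, Finset.sum_range_zero, Nat.factorial]
  norm_num
  refine inv_sqrt_le_of (by linarith) (by positivity) ?_
  have h2 : x ^ 2 ≤ (1 / 4) ^ 2 := pow_le_pow_left₀ hx hx' 2
  have h3 : x ^ 3 ≤ (1 / 4) ^ 3 := pow_le_pow_left₀ hx hx' 3
  have h4 : x ^ 4 ≤ (1 / 4) ^ 4 := pow_le_pow_left₀ hx hx' 4
  have h5 : x ^ 5 ≤ (1 / 4) ^ 5 := pow_le_pow_left₀ hx hx' 5
  have h : 0 ≤ x ^ 4 * (1245 / 64 - 327 / 32 * x - 675 / 256 * x ^ 2 - 345 / 256 * x ^ 3 +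
      375 / 4 * x ^ 4 - 100 * x ^ 5) :=
    mul_nonneg (by positivity) (by nlinarith [pow_nonneg hx 4])
  linarith

theorem inv_sqrt_le_six (x : ℝ) (hx : 0 ≤ x) (hx' : x ≤ 1 / 4) :
    (√(1 - x))⁻¹ ≤ ∑ l ∈ Finset.range 6, invSqrtCoeff l * x ^ l + 10 * x ^ 6 := by
  simp only [Finset.sum_range_succ, invSqrtCoeff, Finset.sum_range_zero, Nat.factorial]
  norm_num
  refine inv_sqrt_le_of (by linarith) (by positivity) ?_
  have h2 : x ^ 2 ≤ (1 / 4) ^ 2 := pow_le_pow_left₀ hx hx' 2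
  have h3 : x ^ 3 ≤ (1 / 4) ^ 3 := pow_le_pow_left₀ hx hx' 3
  have h4 : x ^ 4 ≤ (1 / 4) ^ 4 := pow_le_pow_left₀ hx hx' 4
  have h5 : x ^ 5 ≤ (1 / 4) ^ 5 := pow_le_pow_left₀ hx hx' 5
  have h7 : x ^ 7 ≤ (1 / 4) ^ 7 := pow_le_pow_left₀ hx hx' 7
  have h : 0 ≤ x ^ 6 * (10009 / 512 - 5219 / 512 * x - 43039 / 16384 * x ^ 2 -
      5505 / 4096 * x ^ 3 - 56051 / 65536 * x ^ 4 - 39809 / 65536 * x ^ 5 +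
      6085 / 64 * x ^ 6 - 100 * x ^ 7) :=
    mul_nonneg (by positivity) (by nlinarith [pow_nonneg hx 6])
  linarith

theorem exists_linear_le_of_notMem_interior {V : Type*} [NormedAddCommGroup V] [NormedSpace ℝ V]
    [FiniteDimensional ℝ V] {s : Set V} (h0 : (0 : V) ∈ s) {x : V}
    (hx : x ∉ interior (convexHull ℝ s)) :
    ∃ f : V →ₗ[ℝ] ℝ, f ≠ 0 ∧ ∀ a ∈ s, f x ≤ f a := by
  by_cases hne : (interior (convexHull ℝ s)).Nonempty
  · obtain ⟨f, hf, hle⟩ :=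
      geometric_hahn_banach_of_nonempty_interior_point (convex_convexHull ℝ s) hx hne
    refine ⟨-(f : V →ₗ[ℝ] ℝ), fun h => hf ?_, fun a ha => ?_⟩
    · ext v
      simpa using congrArg (fun g => g v) h
    · simpa using hle a (subset_convexHull ℝ s ha)
  · have hspan : Submodule.span ℝ s < ⊤ := by
      refine lt_top_iff_ne_top.2 fun h => hne ?_
      rw [interior_convexHull_nonempty_iff_affineSpan_eq_top, ← Set.insert_eq_of_mem h0]
      apply SetLike.coe_injective
      rw [affineSpan_insert_zero, h]
      rfl
    obtain ⟨f, hf, hker⟩ := Submodule.exists_le_ker_of_lt_top _ hspan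
    have hz : ∀ a ∈ s, f a = 0 := fun a ha => hker (Submodule.subset_span ha)
    rcases le_total (f x) 0 with h | h
    · exact ⟨f, hf, fun a ha => by simpa [hz a ha] using h⟩
    · exact ⟨-f, neg_ne_zero.2 hf, fun a ha => by simpa [hz a ha] using h⟩

/-- If every polynomial of degree at most `m` that is nonnegative on `ℝ` and whose Gaussian mean
equals `p` times its value at `0` is constant, then an atom of mass `p` placed slightly to the
right of `0` extends to a discrete probability measure with the first `m` Gaussian moments. -/
theorem exists_moment_matching_s4 (m : ℕ) {p : ℝ} (hp : p < 1)
    (H : ∀ (c : Fin m → ℝ) (c₀ : ℝ), (∀ y : ℝ, 0 ≤ c₀ + ∑ i, c i * y ^ (i.val + 1)) →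
      c₀ + ∑ i, c i * gaussMoment (i.val + 1) = p * c₀ → c = 0) :
    ∃ η : ℝ, 0 < η ∧ ∃ (ι : Type) (_ : Fintype ι) (α z : ι → ℝ), (∀ i, 0 ≤ α i) ∧
      ∑ i, α i = 1 ∧
      ∀ k < m, p * η ^ (k + 1) + (1 - p) * ∑ i, α i * z i ^ (k + 1) = gaussMoment (k + 1) := by
  have hq : 0 < 1 - p := by linarith
  let v : ℝ → Fin m → ℝ := fun y i => y ^ (i.val + 1)
  let g : Fin m → ℝ := fun i => gaussMoment (i.val + 1)
  have hmem : (1 - p)⁻¹ • g ∈ interior (convexHull ℝ (Set.range v)) := by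
    by_contra hx
    obtain ⟨f, hf, hle⟩ := exists_linear_le_of_notMem_interior
      (s := Set.range v) ⟨0, by ext; simp [v]⟩ hx
    have hfs : ∀ a : Fin m → ℝ, f a = ∑ i, f (Pi.single i 1) * a i := fun a => by
      rw [LinearMap.pi_apply_eq_sum_univ f a]
      refine Finset.sum_congr rfl fun i _ => ?_
      rw [smul_eq_mul, mul_comm]
      congr 2
      ext j
      simp [Pi.single_apply, eq_comm]
    have hc := H (fun i => f (Pi.single i 1)) (-f ((1 - p)⁻¹ • g)) (fun y => by
      have := hle _ ⟨y, rfl⟩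
      rw [hfs (v y)] at this
      simp only [v] at this
      linarith) (by
      have := hfs g
      simp only [g] at this
      rw [← this, map_smul, smul_eq_mul]
      change -((1 - p)⁻¹ * f g) + f g = _
      field_simp
      ring)
    refine hf (LinearMap.ext fun a => ?_)
    rw [hfs a]
    simp [fun i => congrFun hc i]
  have hcont : Continuous fun η : ℝ => (1 - p)⁻¹ • (g - p • v η) := by
    have : Continuous v := by fun_prop
    fun_prop
  have hv0 : v 0 = 0 := by ext; simp [v]
  have hnhds : ∀ᶠ η in nhds (0 : ℝ),
      (1 - p)⁻¹ • (g - p • v η) ∈ interior (convexHull ℝ (Set.range v)) :=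
    hcont.continuousAt.eventually (isOpen_interior.mem_nhds (by simpa [hv0] using hmem))
  obtain ⟨η, hη, hη0⟩ :=
    ((hnhds.filter_mono nhdsWithin_le_nhds).and
      (self_mem_nhdsWithin : Set.Ioi (0 : ℝ) ∈ nhdsWithin 0 (Set.Ioi 0))).exists
  obtain ⟨ι, hι, α, Z, hα, hα1, hZ, hsum⟩ :=
    mem_convexHull_iff_exists_fintype.1 (interior_subset hη)
  choose z hz using hZ
  refine ⟨η, hη0, ι, hι, α, z, hα, hα1, fun k hk => ?_⟩
  have := congrFun hsum ⟨k, hk⟩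
  simp only [Finset.sum_apply, Pi.smul_apply, smul_eq_mul, Pi.sub_apply, ← hz, v, g] at this
  rw [this]
  field_simp
  ring

theorem eq_zero_of_forall_poly_eq_zero {m : ℕ} {c : Fin m → ℝ} {c₀ : ℝ}
    (h : ∀ y : ℝ, c₀ + ∑ i, c i * y ^ (i.val + 1) = 0) : c = 0 := by
  have hP : Polynomial.C c₀ + ∑ i, Polynomial.C (c i) * Polynomial.X ^ (i.val + 1) = 0 :=
    Polynomial.funext fun y => by simpa [Polynomial.eval_finsetSum] using h y
  ext j
  have := congrArg (fun P => Polynomial.coeff P (j.val + 1)) hP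
  simpa [Polynomial.coeff_C, Fin.val_inj] using this

theorem eq_zero_of_even_part_eq_zero {m : ℕ} {c : Fin m → ℝ} {c₀ : ℝ}
    (hq : ∀ y : ℝ, 0 ≤ c₀ + ∑ i, c i * y ^ (i.val + 1))
    (h : ∀ y : ℝ, (c₀ + ∑ i, c i * y ^ (i.val + 1)) + (c₀ + ∑ i, c i * (-y) ^ (i.val + 1)) = 0) :
    c = 0 :=
  eq_zero_of_forall_poly_eq_zero fun y => by linarith [hq y, hq (-y), h y]

theorem nonneg_zero_of_nonneg_pos {f : ℝ → ℝ} (hf : Continuous f) (h : ∀ t > 0, 0 ≤ f t) :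
    0 ≤ f 0 :=
  ge_of_tendsto (hf.continuousAt.tendsto.mono_left nhdsWithin_le_nhds)
    (Filter.eventually_of_mem (self_mem_nhdsWithin : Set.Ioi (0 : ℝ) ∈ _) h)

theorem eq_zero_of_cubic {p a₀ a₁ a₂ a₃ : ℝ} (hp : p < 2 / 3)
    (h : ∀ Y : ℝ, 0 ≤ Y → 0 ≤ a₀ + a₁ * Y + a₂ * Y ^ 2 + a₃ * Y ^ 3)
    (hE : a₀ + a₁ + 3 * a₂ + 15 * a₃ = p * a₀) : a₀ = 0 ∧ a₁ = 0 ∧ a₂ = 0 ∧ a₃ = 0 := by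
  have h0 : 0 ≤ a₀ := by simpa using h 0 le_rfl
  have h3 : 0 ≤ a₃ := by
    have := nonneg_zero_of_nonneg_pos
      (f := fun t => a₀ * t ^ 3 + a₁ * t ^ 2 + a₂ * t + a₃) (by fun_prop) fun t ht => by
        have := mul_nonneg (pow_nonneg ht.le 3) (h t⁻¹ (inv_nonneg.2 ht.le))
        refine this.trans_eq ?_
        have ht0 : t ≠ 0 := ne_of_gt ht
        field_simp
    simpa using this
  have hY := h 3 (by norm_num)
  have hz : (2 / 3 - p) * a₀ = 0 :=
    le_antisymm (by linarith) (mul_nonneg (by linarith) h0)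
  have h00 : a₀ = 0 := (mul_eq_zero.1 hz).resolve_left (by linarith)
  subst h00
  have h1 := h 1 (by norm_num)
  have h4 := h 4 (by norm_num)
  refine ⟨rfl, ?_, ?_, ?_⟩ <;> linarith

theorem eq_zero_of_quintic {p a₀ a₁ a₂ a₃ a₄ a₅ : ℝ} (hp : p < 8 / 15)
    (h : ∀ Y : ℝ, 0 ≤ Y →
      0 ≤ a₀ + a₁ * Y + a₂ * Y ^ 2 + a₃ * Y ^ 3 + a₄ * Y ^ 4 + a₅ * Y ^ 5)
    (hE : a₀ + a₁ + 3 * a₂ + 15 * a₃ + 105 * a₄ + 945 * a₅ = p * a₀) :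
    a₀ = 0 ∧ a₁ = 0 ∧ a₂ = 0 ∧ a₃ = 0 ∧ a₄ = 0 ∧ a₅ = 0 := by
  have h0 : 0 ≤ a₀ := by simpa using h 0 le_rfl
  have h5 : 0 ≤ a₅ := by
    have := nonneg_zero_of_nonneg_pos
      (f := fun t => a₀ * t ^ 5 + a₁ * t ^ 4 + a₂ * t ^ 3 + a₃ * t ^ 2 + a₄ * t + a₅)
      (by fun_prop) fun t ht => by
        have := mul_nonneg (pow_nonneg ht.le 5) (h t⁻¹ (inv_nonneg.2 ht.le))
        refine this.trans_eq ?_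
        have ht0 : t ≠ 0 := ne_of_gt ht
        field_simp
    simpa using this
  obtain ⟨s, hs0, hs⟩ : ∃ s : ℝ, 0 < s ∧ s ^ 2 = 10 := ⟨√10, by positivity, by norm_num⟩
  have hs' : 2 * s < 7 := by nlinarith
  have key : ∀ t : ℝ, t ^ 2 = 10 →
      a₀ + a₁ * (5 + t) + a₂ * (5 + t) ^ 2 + a₃ * (5 + t) ^ 3 + a₄ * (5 + t) ^ 4
        + a₅ * (5 + t) ^ 5 =
      a₀ + 5 * a₁ + 35 * a₂ + 275 * a₃ + 2225 * a₄ + 18125 * a₅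
        + (a₁ + 10 * a₂ + 85 * a₃ + 700 * a₄ + 5725 * a₅) * t := fun t ht => by
    linear_combination (a₂ + a₃ * (15 + t) + a₄ * (t ^ 2 + 20 * t + 160)
      + a₅ * (t ^ 3 + 25 * t ^ 2 + 260 * t + 1500)) * ht
  have hA := h (5 + s) (by linarith)
  have hB := h (5 + -s) (by linarith)
  rw [key s hs] at hA
  rw [key (-s) (by rw [neg_sq, hs])] at hB
  set U := a₀ + 5 * a₁ + 35 * a₂ + 275 * a₃ + 2225 * a₄ + 18125 * a₅ with hU
  set W := a₁ + 10 * a₂ + 85 * a₃ + 700 * a₄ + 5725 * a₅ with hW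
  have hdecomp : (8 / 15 - p) * a₀ + (7 - 2 * s) / 30 * (U + W * s)
      + (7 + 2 * s) / 30 * (U + W * -s) + 120 * a₅ = 0 := by
    linear_combination hE + (- 4 * W / 30) * hs + 7 / 15 * hU - 4 / 3 * hW
  have hz₀ : 0 ≤ (8 / 15 - p) * a₀ := mul_nonneg (by linarith) h0
  have hz₁ : 0 ≤ (7 - 2 * s) / 30 * (U + W * s) := mul_nonneg (by linarith) hA
  have hz₂ : 0 ≤ (7 + 2 * s) / 30 * (U + W * -s) := mul_nonneg (by linarith) hB
  have h00 : a₀ = 0 :=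
    (mul_eq_zero.1 (by linarith : (8 / 15 - p) * a₀ = 0)).resolve_left (by linarith)
  have h50 : a₅ = 0 := by linarith
  have hA0 : U + W * s = 0 :=
    (mul_eq_zero.1 (by linarith : (7 - 2 * s) / 30 * (U + W * s) = 0)).resolve_left (by linarith)
  have hB0 : U + W * -s = 0 :=
    (mul_eq_zero.1 (by linarith : (7 + 2 * s) / 30 * (U + W * -s) = 0)).resolve_left (by linarith)
  have hW0 : W = 0 :=
    (mul_eq_zero.1 (by linarith : W * s = 0)).resolve_right hs0.ne'
  have hU0 : U = 0 := by simpa [hW0] using hA0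
  rw [hU] at hU0
  rw [hW] at hW0
  clear_value U W
  subst h00 h50
  have h1 := h 1 (by norm_num)
  have h2 := h 2 (by norm_num)
  have h8 := h 8 (by norm_num)
  have h9 := h 9 (by norm_num)
  refine ⟨rfl, ?_, ?_, ?_, ?_, rfl⟩ <;> linarith

theorem gaussMoment_values :
    gaussMoment 1 = 0 ∧ gaussMoment 2 = 1 ∧ gaussMoment 3 = 0 ∧ gaussMoment 4 = 3 ∧
    gaussMoment 5 = 0 ∧ gaussMoment 6 = 15 ∧ gaussMoment 7 = 0 ∧ gaussMoment 8 = 105 ∧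
    gaussMoment 9 = 0 ∧ gaussMoment 10 = 945 ∧ gaussMoment 11 = 0 := by
  refine ⟨gaussMoment_odd 0, ?_, gaussMoment_odd 1, ?_, gaussMoment_odd 2, ?_, gaussMoment_odd 3,
    ?_, gaussMoment_odd 4, ?_, gaussMoment_odd 5⟩
  · rw [gaussMoment_even 1]; norm_num [Nat.factorial]
  · rw [gaussMoment_even 2]; norm_num [Nat.factorial]
  · rw [gaussMoment_even 3]; norm_num [Nat.factorial]
  · rw [gaussMoment_even 4]; norm_num [Nat.factorial]
  · rw [gaussMoment_even 5]; norm_num [Nat.factorial]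

theorem eq_zero_of_nonneg_seven {p : ℝ} (hp : p < 2 / 3) (c : Fin 7 → ℝ) (c₀ : ℝ)
    (hq : ∀ y : ℝ, 0 ≤ c₀ + ∑ i, c i * y ^ (i.val + 1))
    (hE : c₀ + ∑ i, c i * gaussMoment (i.val + 1) = p * c₀) : c = 0 := by
  obtain ⟨g1, g2, g3, g4, g5, g6, g7, -⟩ := gaussMoment_values
  have hc := eq_zero_of_cubic (a₀ := c₀) (a₁ := c 1) (a₂ := c 3) (a₃ := c 5) hp
    (fun Y hY => by
      have h1 := hq (√Y)
      have h2 := hq (-√Y)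
      simp only [Fin.sum_univ_succ, Fin.sum_univ_zero, Fin.isValue, Fin.val_zero,
        Fin.val_succ] at h1 h2
      obtain ⟨s, hs⟩ : ∃ s, s = √Y := ⟨_, rfl⟩
      have hY' : Y = s ^ 2 := by rw [hs, Real.sq_sqrt hY]
      rw [← hs] at h1 h2
      rw [hY']
      simp only [Fin.isValue, Fin.succ_zero_eq_one, Fin.reduceSucc] at h1 h2
      ring_nf at h1 h2 ⊢
      linarith)
    (by
      simp only [Fin.sum_univ_succ, Fin.sum_univ_zero, Fin.val_zero, Fin.val_succ, g1, g2, g3,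
        g4, g5, g6, g7, Fin.isValue, Fin.succ_zero_eq_one, Fin.reduceSucc, Nat.reduceAdd] at hE
      linarith)
  obtain ⟨h0, h1, h2, h3⟩ := hc
  refine eq_zero_of_even_part_eq_zero hq fun y => ?_
  simp only [Fin.sum_univ_succ, Fin.sum_univ_zero, Fin.val_zero, Fin.val_succ, Fin.isValue,
    Fin.succ_zero_eq_one, Fin.reduceSucc, h0, h1, h2, h3]
  ring

theorem eq_zero_of_nonneg_eleven {p : ℝ} (hp : p < 8 / 15) (c : Fin 11 → ℝ) (c₀ : ℝ)
    (hq : ∀ y : ℝ, 0 ≤ c₀ + ∑ i, c i * y ^ (i.val + 1))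
    (hE : c₀ + ∑ i, c i * gaussMoment (i.val + 1) = p * c₀) : c = 0 := by
  obtain ⟨g1, g2, g3, g4, g5, g6, g7, g8, g9, g10, g11⟩ := gaussMoment_values
  have hc := eq_zero_of_quintic (a₀ := c₀) (a₁ := c 1) (a₂ := c 3) (a₃ := c 5) (a₄ := c 7)
    (a₅ := c 9) hp
    (fun Y hY => by
      have h1 := hq (√Y)
      have h2 := hq (-√Y)
      simp only [Fin.sum_univ_succ, Fin.sum_univ_zero, Fin.isValue, Fin.val_zero,
        Fin.val_succ] at h1 h2
      obtain ⟨s, hs⟩ : ∃ s, s = √Y := ⟨_, rfl⟩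
      have hY' : Y = s ^ 2 := by rw [hs, Real.sq_sqrt hY]
      rw [← hs] at h1 h2
      rw [hY']
      simp only [Fin.isValue, Fin.succ_zero_eq_one, Fin.reduceSucc] at h1 h2
      ring_nf at h1 h2 ⊢
      linarith)
    (by
      simp only [Fin.sum_univ_succ, Fin.sum_univ_zero, Fin.val_zero, Fin.val_succ, g1, g2, g3,
        g4, g5, g6, g7, g8, g9, g10, g11, Fin.isValue, Fin.succ_zero_eq_one, Fin.reduceSucc,
        Nat.reduceAdd] at hE
      linarith)
  obtain ⟨h0, h1, h2, h3, h4, h5⟩ := hc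
  refine eq_zero_of_even_part_eq_zero hq fun y => ?_
  simp only [Fin.sum_univ_succ, Fin.sum_univ_zero, Fin.val_zero, Fin.val_succ, Fin.isValue,
    Fin.succ_zero_eq_one, Fin.reduceSucc, h0, h1, h2, h3, h4, h5]
  ring

theorem finsetSum_smul_dirac_conv {ι : Type*} (s : Finset ι) (a : ι → ℝ≥0∞) (m : ι → ℝ)
    (ν : Measure ℝ) [SFinite ν] :
    (∑ i ∈ s, a i • Measure.dirac (m i)).conv ν = ∑ i ∈ s, a i • ν.map (m i + ·) := by
  ext t ht
  rw [← lintegral_indicator_one ht, Measure.lintegral_conv (measurable_one.indicator ht),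
    lintegral_finsetSum_measure, Measure.finsetSum_apply]
  refine Finset.sum_congr rfl fun i _ => ?_
  have hm : Measurable fun x : ℝ => ∫⁻ y, t.indicator 1 (x + y) ∂ν := by
    have : Measurable fun q : ℝ × ℝ => (t.indicator 1 (q.1 + q.2) : ℝ≥0∞) :=
      (measurable_one.indicator ht).comp (measurable_fst.add measurable_snd)
    exact this.lintegral_prod_right'
  rw [lintegral_smul_measure, lintegral_dirac' _ hm, Measure.smul_apply,
    ← lintegral_indicator_one ht, lintegral_map (measurable_one.indicator ht) (by fun_prop)]

theorem efron_dirac_zero_s4 (σ ε : ℝ) (hε : ε ∈ Set.Icc (0 : ℝ) 1) :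
    efron 0 σ ε (Measure.dirac 0) = gauss 0 (σ ^ 2) := by
  unfold efron gauss
  rw [Measure.dirac_zero_conv, ← add_smul, ← ENNReal.ofReal_add (by linarith [hε.2]) hε.1]
  simp

theorem isProbabilityMeasure_sum_dirac {ι : Type*} [Fintype ι] {α : ι → ℝ} (hα : ∀ i, 0 ≤ α i)
    (hα1 : ∑ i, α i = 1) (m : ι → ℝ) :
    IsProbabilityMeasure (∑ i, ENNReal.ofReal (α i) • Measure.dirac (m i)) := by
  refine ⟨?_⟩
  simp [Measure.finsetSum_apply, ← ENNReal.ofReal_sum_of_nonneg fun i _ => hα i, hα1]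

theorem efron_sum_dirac {ι : Type*} [Fintype ι] (θ : ℝ) {σ ε : ℝ} (hε : 0 ≤ ε)
    (α m : ι → ℝ) :
    efron θ σ ε (∑ i, ENNReal.ofReal (α i) • Measure.dirac (m i)) =
      ∑ o : Option ι, ENNReal.ofReal (o.elim (1 - ε) fun i => ε * α i) •
        gauss (o.elim θ m) (σ ^ 2) := by
  unfold efron gauss
  rw [finsetSum_smul_dirac_conv, Fintype.sum_option, Finset.smul_sum]
  simp only [gaussianReal_map_const_add, zero_add, Option.elim, smul_smul,
    ENNReal.ofReal_mul hε]

theorem isProbabilityMeasure_efron (θ σ : ℝ) {ε : ℝ} (hε : ε ∈ Set.Icc (0 : ℝ) 1) (Q : Measure ℝ)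
    [IsProbabilityMeasure Q] : IsProbabilityMeasure (efron θ σ ε Q) := by
  refine ⟨?_⟩
  have : IsProbabilityMeasure (Q.conv (gauss 0 (σ ^ 2))) := by unfold gauss; infer_instance
  have : IsProbabilityMeasure (gauss θ (σ ^ 2)) := by unfold gauss; infer_instance
  simp [efron, ← ENNReal.ofReal_add (sub_nonneg.2 hε.2) hε.1]

/-- Coverage with probability at least `1 - δ`, by an interval of length at most `r σ ε`, under
every distribution in Efron's model with contamination at most `εmax`. -/
def IsAdaptive (δ εmax : ℝ) (n : ℕ) (l u : (Fin n → ℝ) → ℝ) (r : ℝ → ℝ → ℝ) : Prop :=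
  ∀ (θ σ ε : ℝ), 0 < σ → ε ∈ Set.Icc 0 εmax → ∀ Q : Measure ℝ, IsProbabilityMeasure Q →
    ENNReal.ofReal (1 - δ) ≤ iid n (efron θ σ ε Q) {x | l x ≤ θ ∧ θ ≤ u x} ∧
    ENNReal.ofReal (1 - δ) ≤ iid n (efron θ σ ε Q) {x | u x - l x ≤ r σ ε}

theorem le_radius_of_mixtureGap {ι : Type*} [Fintype ι] {δ εmax : ℝ}
    (hδ : δ ∈ Set.Ioo (0 : ℝ) (1 / 4)) (hεm : εmax ∈ Set.Icc (0 : ℝ) 1) {α z : ι → ℝ}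
    (hα : ∀ i, 0 ≤ α i) (hα1 : ∑ i, α i = 1) (η : ℝ) {n : ℕ} {l u : (Fin n → ℝ) → ℝ}
    (hl : Measurable l) (hu : Measurable u) {r : ℝ → ℝ → ℝ} (hr : IsAdaptive δ εmax n l u r)
    {t a : ℝ} (ht : 0 < t) (ht' : t ≤ 1 / 2) (ha : 0 ≤ a) (hna : n * a ≤ 9 / 100)
    (hgap : √(1 + t) * mixtureGap (fun o : Option ι => o.elim (1 - εmax) fun i => εmax * α i)
      (fun o => o.elim η z) t ≤ a)
    {σ ε : ℝ} (hσ : 0 < σ) (hε : ε ∈ Set.Icc 0 εmax) :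
    η * √(t / (1 + t)) * σ ≤ r σ ε := by
  set w : Option ι → ℝ := fun o => o.elim (1 - εmax) fun i => εmax * α i with hw
  set y : Option ι → ℝ := fun o => o.elim η z with hy
  have hw0 : ∀ o, 0 ≤ w o
    | none => sub_nonneg.2 hεm.2
    | some i => mul_nonneg hεm.1 (hα i)
  have hw1 : ∑ o, w o = 1 := by
    simp [Fintype.sum_option, hw, ← Finset.mul_sum, hα1]
  set v := σ ^ 2 / (1 + t) with hv
  have hvpos : 0 < v := by positivity
  have hvt : v * (1 + t) = σ ^ 2 := by rw [hv]; field_simp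
  set b : Option ι → ℝ := fun o => y o * √(t / v) with hb
  set g : ℝ → ℝ := fun x => ∑ o, w o * shiftDensity v (b o) x with hg
  have hgm : Measurable g := by
    unfold g shiftDensity
    fun_prop
  set Q : Measure ℝ := ∑ i, ENNReal.ofReal (α i) • Measure.dirac (b (some i) * v) with hQ
  have : IsProbabilityMeasure Q := isProbabilityMeasure_sum_dirac hα hα1 _
  have hnull : efron 0 σ ε (Measure.dirac 0) = gaussianReal 0 (v * (1 + t)).toNNReal := by
    rw [hvt]
    exact efron_dirac_zero_s4 σ ε ⟨hε.1, hε.2.trans hεm.2⟩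
  have halt : efron (b none * v) (√v) εmax Q =
      (gaussianReal 0 (v * (1 + t)).toNNReal).withDensity
        fun x => ENNReal.ofReal (g x / scaleDensity v t x) := by
    rw [withDensity_ratio hvpos ht g hgm, withDensity_mixture hvpos w b hw0, hQ,
      efron_sum_dirac _ hεm.1, Real.sq_sqrt hvpos.le]
    refine Finset.sum_congr rfl fun o _ => ?_
    cases o <;> rfl
  have hprob : IsProbabilityMeasure ((gaussianReal 0 (v * (1 + t)).toNNReal).withDensity
      fun x => ENNReal.ofReal (g x / scaleDensity v t x)) := by
    rw [← halt]
    exact isProbabilityMeasure_efron _ _ hεm Q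
  have hcov := hr 0 σ ε hσ hε (Measure.dirac 0) inferInstance
  have hcov' := (hr (b none * v) (√v) εmax (Real.sqrt_pos.2 hvpos) ⟨hεm.1, le_rfl⟩ Q
    inferInstance).1
  rw [hnull] at hcov
  rw [halt] at hcov'
  have key := dist_le_of_coverage _ _ (hgm.div (measurable_scaleDensity v t)).ennreal_ofReal ha hna
    ((lintegral_ratio_sq_le hvpos ht (by linarith) w y hw1).trans
      (ENNReal.ofReal_le_ofReal (by linarith))) hδ hl hu hcov.1 hcov.2 hcov'
  convert key using 1
  have hcenter : √(t / v) * v = √(t / (1 + t)) * σ := by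
    rw [← Real.sqrt_sq hσ.le, ← Real.sqrt_mul (by positivity), ← hvt]
    nth_rewrite 2 [← Real.sqrt_sq hvpos.le]
    rw [← Real.sqrt_mul (by positivity)]
    congr 1
    field_simp
  rw [sub_zero, mul_assoc, ← hcenter, ← mul_assoc]
  rfl

theorem exists_rate {δ εmax : ℝ} (hδ : δ ∈ Set.Ioo (0 : ℝ) (1 / 4))
    (hεm : εmax ∈ Set.Ioo (0 : ℝ) 1) {L : ℕ} (hL : 0 < L) {C : ℝ} (hC : 0 ≤ C)
    (hinv : ∀ x : ℝ, 0 ≤ x → x ≤ 1 / 4 →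
      (√(1 - x))⁻¹ ≤ ∑ l ∈ Finset.range L, invSqrtCoeff l * x ^ l + C * x ^ L)
    (H : ∀ (c : Fin (2 * L - 1) → ℝ) (c₀ : ℝ),
      (∀ y : ℝ, 0 ≤ c₀ + ∑ i, c i * y ^ (i.val + 1)) →
      c₀ + ∑ i, c i * gaussMoment (i.val + 1) = (1 - εmax) * c₀ → c = 0) :
    ∃ c : ℝ, 0 < c ∧ ∀ n : ℕ, 1 ≤ n → ∀ l u : (Fin n → ℝ) → ℝ, Measurable l → Measurable u →
      ∀ r : ℝ → ℝ → ℝ, IsAdaptive δ εmax n l u r → ∀ σ : ℝ, 0 < σ → ∀ ε ∈ Set.Icc (0 : ℝ) εmax,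
        c * σ * (n : ℝ) ^ (-(1 / (4 * L : ℝ))) ≤ r σ ε := by
  obtain ⟨η, hη, ι, _, α, z, hα, hα1, hmom⟩ :=
    exists_moment_matching_s4 (2 * L - 1) (sub_lt_self 1 hεm.1) H
  obtain ⟨C', hC', hgap⟩ := mixtureGap_le
    (fun o : Option ι => o.elim (1 - εmax) fun i => εmax * α i) (fun o => o.elim η z)
    (by
      rintro (_ | i)
      · exact sub_nonneg.2 hεm.2.le
      · exact mul_nonneg hεm.1.le (hα i))
    L (fun k hk => by
      rcases k with _ | k
      · simp [Fintype.sum_option, ← Finset.mul_sum, hα1, gaussMoment]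
      · rw [← hmom k (by omega), Fintype.sum_option, Finset.mul_sum]
        simp [mul_assoc]) hC hinv
  set s : ℝ := 1 / (50 * (C' + 1)) with hs
  have hs0 : 0 < s := by positivity
  have hs1 : s ≤ 1 / 50 := by
    rw [hs]
    exact one_div_le_one_div_of_le (by norm_num) (by linarith)
  have hCs : 2 * C' * s ≤ 9 / 100 := by
    rw [hs, mul_one_div, div_le_iff₀ (by positivity)]
    linarith
  refine ⟨η * √(s / 2), by positivity, fun n hn l u hl hu r hr σ hσ ε hε => ?_⟩
  have hn0 : (0 : ℝ) < n := by exact_mod_cast hn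
  have hL0 : (0 : ℝ) < L := by exact_mod_cast hL
  set q : ℝ := (n : ℝ) ^ (-(1 / (4 * L : ℝ))) with hq
  have hq0 : 0 < q := Real.rpow_pos_of_pos hn0 _
  have hq1 : q ≤ 1 := Real.rpow_le_one_of_one_le_of_nonpos (by exact_mod_cast hn)
    (neg_nonpos.2 (by positivity))
  have hqpow : n * q ^ (4 * L) = 1 := by
    rw [hq, ← Real.rpow_natCast, ← Real.rpow_mul hn0.le]
    have : -(1 / (4 * L : ℝ)) * ((4 * L : ℕ) : ℝ) = -1 := by
      push_cast
      field_simp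
    rw [this, Real.rpow_neg_one, mul_inv_cancel₀ hn0.ne']
  have ht : s * q ^ 2 ≤ 1 / 2 := by nlinarith
  have hspow : s ^ (2 * L) ≤ s := pow_le_of_le_one hs0.le (by linarith) (by omega)
  have ht0 : 0 < s * q ^ 2 := by positivity
  have hsqrt : √(1 + s * q ^ 2) ≤ 2 := Real.sqrt_le_iff.2 ⟨by norm_num, by linarith⟩
  have key := le_radius_of_mixtureGap hδ ⟨hεm.1.le, hεm.2.le⟩ hα hα1 η hl hu hr ht0 ht
    (a := 2 * (C' * (s * q ^ 2) ^ (2 * L))) (by positivity)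
    (by
      have : (n : ℝ) * (2 * (C' * (s * q ^ 2) ^ (2 * L))) =
          2 * C' * s ^ (2 * L) * (n * q ^ (4 * L)) := by ring
      rw [this, hqpow]
      nlinarith)
    ((mul_le_mul_of_nonneg_left (hgap _ ht0 ht) (Real.sqrt_nonneg _)).trans
      (mul_le_mul_of_nonneg_right hsqrt (by positivity))) hσ hε
  refine le_trans ?_ key
  have : √(s / 2) * q ≤ √(s * q ^ 2 / (1 + s * q ^ 2)) := by
    refine Real.le_sqrt_of_sq_le ?_
    rw [mul_pow, Real.sq_sqrt (by positivity), le_div_iff₀ (by positivity)]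
    nlinarith
  calc η * √(s / 2) * σ * q = η * (√(s / 2) * q) * σ := by ring
    _ ≤ _ := by gcongr

/-- Unknown-variance lower bound above `1/3` (Theorem 5.6): for `εmax ∈ (1/3, 1/2)`, any
adaptive confidence interval must have length `r(σ,ε) ≥ c·σ·n^{-1/16}` when
`εmax ∈ (1/3, 7/15]`, and `r(σ,ε) ≥ c·σ·n^{-1/24}` when `εmax ∈ (7/15, 1/2)`. -/
theorem unknownVariance_lower_bound_above_third (δ εmax : ℝ)
    (hδ : δ ∈ Set.Ioo (0:ℝ) (1/4)) (hεm : εmax ∈ Set.Ioo (1/3 : ℝ) (1/2)) :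
    ∃ c : ℝ, 0 < c ∧
      ∀ n : ℕ, 1 ≤ n →
        ∀ l u : (Fin n → ℝ) → ℝ, Measurable l → Measurable u → (∀ x, l x ≤ u x) →
          ∀ r : ℝ → ℝ → ℝ,
            (∀ σ : ℝ, 0 < σ → ∀ ε ∈ Set.Icc (0:ℝ) εmax, 0 < r σ ε) →
            (∀ (θ σ ε : ℝ), 0 < σ → ε ∈ Set.Icc 0 εmax →
              ∀ Q : Measure ℝ, IsProbabilityMeasure Q →
                ENNReal.ofReal (1 - δ) ≤
                    iid n (efron θ σ ε Q) {x | l x ≤ θ ∧ θ ≤ u x} ∧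
                ENNReal.ofReal (1 - δ) ≤
                    iid n (efron θ σ ε Q) {x | u x - l x ≤ r σ ε}) →
            ∀ σ : ℝ, 0 < σ → ∀ ε ∈ Set.Icc (0:ℝ) εmax,
              (εmax ≤ 7/15 → c * σ * (n : ℝ) ^ (-(1/16 : ℝ)) ≤ r σ ε) ∧
              (7/15 < εmax → c * σ * (n : ℝ) ^ (-(1/24 : ℝ)) ≤ r σ ε) := by
  rcases le_or_gt εmax (7 / 15) with h | h
  · obtain ⟨c, hc, key⟩ := exists_rate hδ ⟨by linarith [hεm.1], by linarith [hεm.2]⟩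
      (L := 4) (by norm_num) (by norm_num) inv_sqrt_le_four
      (eq_zero_of_nonneg_seven (p := 1 - εmax) (by linarith [hεm.1]))
    refine ⟨c, hc, fun n hn l u hl hu _ r _ hr σ hσ ε hε => ⟨fun _ => ?_, fun h' => by linarith⟩⟩
    have := key n hn l u hl hu r hr σ hσ ε hε
    norm_num at this ⊢
    exact this
  · obtain ⟨c, hc, key⟩ := exists_rate hδ ⟨by linarith [hεm.1], by linarith [hεm.2]⟩
      (L := 6) (by norm_num) (by norm_num) inv_sqrt_le_six
      (eq_zero_of_nonneg_eleven (p := 1 - εmax) (by linarith))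
    refine ⟨c, hc, fun n hn l u hl hu _ r _ hr σ hσ ε hε => ⟨fun h' => by linarith, fun _ => ?_⟩⟩
    have := key n hn l u hl hu r hr σ hσ ε hε
    norm_num at this ⊢
    exact this
end
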